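/- Let U ⊆ ℚ_p^n be a nonempty open set, let f, g : U → ℚ_p be nonzero p-adic analytic functions such that there is no constant c ∈ ℚ_p with f(x) = c·g(x) for all x ∈ U, let D = {x ∈ U : f(x)·g(x) = 0}, and let W ⊆ U be a nonempty compact open set. Define B = {σ ∈ ℝ : the function x ↦ |f(x)/g(x)|_p^σ is integrable on W ∖ D}. Then B is an open interval of ℝ containing 0. In particular: if β := inf B > −∞, then the integral ∫_{W∖D} |f(x)/g(x)|_p^σ dμ(x) diverges at σ = β and tends to +∞ as σ decreases to β; and if α := sup B < +∞, then the integral diverges at σ = α and tends to +∞ as σ increases to α. -/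

import Mathlib

open MeasureTheory Complex

open Filter Topology Set
open scoped ENNReal NNReal

set_option linter.unusedSectionVars false

namespace PadicMonomialization

section Division

variable {𝕜 : Type*} [NontriviallyNormedField 𝕜] [CompleteSpace 𝕜]
  {E : Type*} [NormedAddCommGroup E] [NormedSpace 𝕜 E]

/-- Hadamard's lemma for analytic germs: `f (t, x) - f (0, x)` is divisible by `t`. -/
theorem exists_eq_add_fst_mul {f : 𝕜 × E → 𝕜} (hf : AnalyticAt 𝕜 f 0) :
    ∃ h : 𝕜 × E → 𝕜, AnalyticAt 𝕜 h 0 ∧ ∀ᶠ z in 𝓝 0, f z = f (0, z.2) + z.1 * h z := by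
  obtain ⟨P, R, hP⟩ := hf
  let A : 𝕜 × E →L[𝕜] 𝕜 × E :=
    (ContinuousLinearMap.inr 𝕜 𝕜 E).comp (ContinuousLinearMap.snd 𝕜 𝕜 E)
  have hA : ∀ z, A z = (0, z.2) := fun z => rfl
  have hA1 : ‖A‖ ≤ 1 := by
    refine ContinuousLinearMap.opNorm_le_bound _ zero_le_one fun z => ?_
    rw [hA, one_mul, Prod.norm_def, Prod.norm_def]
    simp
  let B : (k : ℕ) → Fin (k + 1) → Fin k → (𝕜 × E →L[𝕜] 𝕜 × E) := fun k j i =>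
    if i.castSucc < j then A else ContinuousLinearMap.id 𝕜 _
  have hB1 : ∀ k j i, ‖B k j i‖ ≤ 1 := by
    intro k j i
    dsimp only [B]
    split_ifs
    · exact hA1
    · exact ContinuousLinearMap.norm_id_le
  let q : FormalMultilinearSeries 𝕜 (𝕜 × E) 𝕜 := fun k =>
    ∑ j : Fin (k + 1), ((P (k + 1)).curryMid j ((1, 0) : 𝕜 × E)).compContinuousLinearMap (B k j)
  have hqn : ∀ k, ‖q k‖ ≤ (k + 1) * ‖P (k + 1)‖ := by
    intro k
    refine (norm_sum_le _ _).trans ?_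
    have : ∀ j ∈ (Finset.univ : Finset (Fin (k + 1))),
        ‖((P (k + 1)).curryMid j ((1, 0) : 𝕜 × E)).compContinuousLinearMap (B k j)‖
          ≤ ‖P (k + 1)‖ := by
      intro j _
      refine (ContinuousMultilinearMap.norm_compContinuousLinearMap_le _ _).trans ?_
      have h1 : ∏ i, ‖B k j i‖ ≤ 1 :=
        Finset.prod_le_one (fun _ _ => norm_nonneg _) (fun i _ => hB1 k j i)
      have h2 : ‖(P (k + 1)).curryMid j ((1, 0) : 𝕜 × E)‖ ≤ ‖P (k + 1)‖ := by
        refine (ContinuousLinearMap.le_opNorm _ _).trans ?_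
        rw [ContinuousMultilinearMap.norm_curryMid]
        have : ‖((1, 0) : 𝕜 × E)‖ = 1 := by simp [Prod.norm_def]
        rw [this, mul_one]
      calc _ ≤ ‖P (k + 1)‖ * 1 := mul_le_mul h2 h1 (by positivity) (norm_nonneg _)
        _ = _ := mul_one _
    refine (Finset.sum_le_card_nsmul _ _ _ this).trans ?_
    simp
  have hqrad : 0 < q.radius := by
    obtain ⟨r, hr0, hr⟩ := ENNReal.lt_iff_exists_nnreal_btwn.1 (hP.r_pos.trans_le hP.r_le)
    have hr0' : (0 : ℝ) < r := by exact_mod_cast hr0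
    obtain ⟨C, hC, hb⟩ := P.norm_mul_pow_le_of_lt_radius hr
    have : ((r / 2 : ℝ≥0) : ℝ≥0∞) ≤ q.radius := by
      refine q.le_radius_of_bound (C / r) fun k => ?_
      have h2 : ((k : ℝ) + 1) ≤ 2 ^ k := by
        exact_mod_cast Nat.lt_two_pow_self
      have h3 := hb (k + 1)
      rw [le_div_iff₀ hr0']
      calc ‖q k‖ * ((r / 2 : ℝ≥0) : ℝ) ^ k * r
          ≤ ((k + 1) * ‖P (k + 1)‖) * ((r / 2 : ℝ≥0) : ℝ) ^ k * r := by
            gcongr; exact hqn k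
        _ = (((k : ℝ) + 1) / 2 ^ k) * (‖P (k + 1)‖ * r ^ (k + 1)) := by
            push_cast; rw [div_pow]; field_simp; ring
        _ ≤ 1 * C := by
            gcongr
            rw [div_le_one (by positivity)]; exact h2
        _ = C := one_mul _
    refine lt_of_lt_of_le ?_ this
    exact_mod_cast (half_pos hr0')
  have hq := q.hasFPowerSeriesOnBall hqrad
  refine ⟨q.sum, hq.analyticAt, ?_⟩
  have hball : Metric.eball (0 : 𝕜 × E) (min R q.radius) ∈ 𝓝 (0 : 𝕜 × E) :=
    Metric.eball_mem_nhds _ (lt_min hP.r_pos hqrad)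
  filter_upwards [hball] with z hz
  have hzR : z ∈ Metric.eball (0 : 𝕜 × E) R := Metric.eball_subset_eball (min_le_left _ _) hz
  have hzq : z ∈ Metric.eball (0 : 𝕜 × E) q.radius :=
    Metric.eball_subset_eball (min_le_right _ _) hz
  have hAzR : A z ∈ Metric.eball (0 : 𝕜 × E) R := by
    rw [Metric.mem_eball, edist_zero_right] at hzR ⊢
    refine lt_of_le_of_lt ?_ hzR
    rw [enorm_le_iff_norm_le]
    calc ‖A z‖ ≤ ‖A‖ * ‖z‖ := A.le_opNorm z
      _ ≤ 1 * ‖z‖ := by gcongr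
      _ = _ := one_mul _
  have s1 := hP.hasSum hzR
  have s2 := hP.hasSum hAzR
  have s3 := (hq.hasSum hzq).mul_left z.1
  rw [zero_add] at s1 s2 s3
  have key : ∀ k, (P (k + 1) fun _ => z) - (P (k + 1) fun _ => A z)
      = z.1 * (q k fun _ => z) := by
    intro k
    let w : ℕ → Fin (k + 1) → 𝕜 × E := fun j i => if (i : ℕ) < j then A z else z
    have hw0 : w 0 = fun _ => z := by funext i; simp [w]
    have hwk : w (k + 1) = fun _ => A z := by
      funext i; simp only [w]; rw [if_pos i.2]
    have e1 : (P (k + 1) fun _ => z) - (P (k + 1) fun _ => A z)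
        = ∑ j ∈ Finset.range (k + 1), (P (k + 1) (w j) - P (k + 1) (w (j + 1))) := by
      rw [Finset.sum_range_sub', hw0, hwk]
    rw [e1, Finset.sum_range]
    simp only [q, _root_.sum_apply, Finset.mul_sum]
    refine Finset.sum_congr rfl fun j _ => ?_
    rw [ContinuousMultilinearMap.compContinuousLinearMap_apply,
      ContinuousMultilinearMap.curryMid_apply]
    have hu1 : w j = Function.update (w j) j z := by
      rw [eq_comm, Function.update_eq_self_iff]; simp [w]
    have hu2 : w (j + 1) = Function.update (w j) j (A z) := by
      funext i
      rcases eq_or_ne i j with rfl | hij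
      · simp [w]
      · rw [Function.update_of_ne hij]
        simp only [w]
        have : (i : ℕ) ≠ j := fun h => hij (Fin.ext h)
        congr 1
        simp only [eq_iff_iff]
        omega
    have hz : z - A z = z.1 • ((1, 0) : 𝕜 × E) := by
      rw [hA]; ext <;> simp
    have hins : j.insertNth ((1, 0) : 𝕜 × E) (fun i => B k j i z)
        = Function.update (w j) j ((1, 0) : 𝕜 × E) := by
      funext i
      rcases Fin.eq_self_or_eq_succAbove j i with rfl | ⟨i', rfl⟩
      · simp
      · rw [Fin.insertNth_apply_succAbove, Function.update_of_ne (Fin.succAbove_ne _ _)]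
        simp only [B, w]
        by_cases h : i'.castSucc < j
        · rw [Fin.succAbove_of_castSucc_lt _ _ h, if_pos h, if_pos (Fin.lt_def.1 h)]
        · rw [Fin.succAbove_of_le_castSucc _ _ (not_lt.1 h), if_neg h, if_neg]
          · simp
          · have := not_lt.1 h
            rw [Fin.le_def] at this
            simp at this ⊢
            omega
    rw [hins]
    conv_lhs => rw [hu2]; rw [hu1]
    rw [Function.update_idem, ← ContinuousMultilinearMap.map_update_sub, hz,
      ContinuousMultilinearMap.map_update_smul, smul_eq_mul]
  have s4 := s1.sub s2
  have s5 : HasSum (fun k => z.1 * (q k fun _ => z)) (f z - f (A z)) := by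
    have := (hasSum_nat_add_iff' 1).2 s4
    simp only [key, Finset.sum_range_one] at this
    have h0 : (P 0 fun _ => z) = (P 0 fun _ => A z) := by congr 1; funext i; exact i.elim0
    rw [h0, sub_self, sub_zero] at this
    exact this
  have := s5.unique s3
  rw [hA] at this
  rw [← this]; ring

end Division

section Covers

variable {K : Type*} [NontriviallyNormedField K] [ProperSpace K]

/-- A germ at the origin is a monomial times a nonvanishing analytic germ. -/
def IsMon {n : ℕ} (f : (Fin n → K) → K) : Prop :=
  ∃ (α : Fin n → ℕ) (u : (Fin n → K) → K), AnalyticAt K u 0 ∧ u 0 ≠ 0 ∧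
    f =ᶠ[𝓝 0] fun x => (∏ k, x k ^ α k) * u x

theorem IsMon.of_unit {n : ℕ} {f : (Fin n → K) → K} (hf : AnalyticAt K f 0) (h0 : f 0 ≠ 0) :
    IsMon f :=
  ⟨0, f, hf, h0, Eventually.of_forall fun x => by simp⟩

theorem IsMon.congr {n : ℕ} {f g : (Fin n → K) → K} (hf : IsMon f) (h : f =ᶠ[𝓝 0] g) :
    IsMon g := by
  obtain ⟨α, u, hu, hu0, he⟩ := hf
  exact ⟨α, u, hu, hu0, h.symm.trans he⟩

theorem IsMon.mul {n : ℕ} {f g : (Fin n → K) → K} (hf : IsMon f) (hg : IsMon g) :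
    IsMon (f * g) := by
  obtain ⟨α, u, hu, hu0, he⟩ := hf
  obtain ⟨β, v, hv, hv0, he'⟩ := hg
  refine ⟨α + β, u * v, hu.mul hv, mul_ne_zero hu0 hv0, ?_⟩
  filter_upwards [he, he'] with x h1 h2
  simp only [Pi.mul_apply, h1, h2, Pi.add_apply, pow_add, Finset.prod_mul_distrib]
  ring

theorem IsMon.one {n : ℕ} : IsMon (1 : (Fin n → K) → K) :=
  IsMon.of_unit analyticAt_const one_ne_zero

theorem IsMon.coord {n : ℕ} (k : Fin n) : IsMon (fun x : Fin n → K => x k) := by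
  refine ⟨Pi.single k 1, 1, analyticAt_const, one_ne_zero, Eventually.of_forall fun x => ?_⟩
  simp only [Pi.one_apply, mul_one]
  rw [Finset.prod_eq_single k]
  · simp
  · intro j _ hj; simp [hj]
  · simp

theorem IsMon.pow {n : ℕ} {f : (Fin n → K) → K} (hf : IsMon f) (m : ℕ) : IsMon (f ^ m) := by
  induction m with
  | zero => simpa using IsMon.one
  | succ m ih => rw [pow_succ]; exact ih.mul hf

variable {E E' E'' : Type*}
  [NormedAddCommGroup E] [NormedSpace K E] [MeasureSpace E]
  [NormedAddCommGroup E'] [NormedSpace K E'] [MeasureSpace E']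
  [NormedAddCommGroup E''] [NormedSpace K E''] [MeasureSpace E'']
  [MeasureSpace K] [BorelSpace K] [(volume : Measure K).IsAddHaarMeasure]

/-- A family of analytic charts `π r` with Jacobian factors `G r` such that integrals near the
origin of the target are comparable with sums of integrals near the origins of the charts. -/
structure IsCover {I : Type} (π : I → E' → E) (G : I → E' → K) : Prop where
  measurable_chart : ∀ r, Measurable (π r)
  analyticAt_chart : ∀ r, AnalyticAt K (π r) 0
  chart_zero : ∀ r, π r 0 = 0
  measurable_jac : ∀ r, Measurable (G r)
  analyticAt_jac : ∀ r, AnalyticAt K (G r) 0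
  upper : ∀ N : I → Set E', (∀ r, N r ∈ 𝓝 0) → ∃ (I0 : Finset I) (V : Set E) (C : ℝ≥0∞),
    V ∈ 𝓝 0 ∧ C ≠ ⊤ ∧ ∀ h : E → ℝ≥0∞, Measurable h →
      ∫⁻ x in V, h x ≤ C * ∑ r ∈ I0, ∫⁻ y in N r, h (π r y) * ‖G r y‖ₑ
  lower : ∀ r, ∀ V ∈ 𝓝 (0 : E), ∃ (N : Set E') (C : ℝ≥0∞), N ∈ 𝓝 0 ∧ C ≠ ⊤ ∧
    ∀ h : E → ℝ≥0∞, Measurable h → ∫⁻ y in N, h (π r y) * ‖G r y‖ₑ ≤ C * ∫⁻ x in V, h x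

theorem IsCover.tendsto_chart {I : Type} {π : I → E' → E} {G : I → E' → K} (h : IsCover π G)
    (r : I) : Tendsto (π r) (𝓝 0) (𝓝 0) := by
  have := (h.analyticAt_chart r).continuousAt.tendsto
  rwa [h.chart_zero] at this

theorem IsCover.comp {I : Type} {π : I → E' → E} {G : I → E' → K} (h : IsCover π G)
    {J : I → Type} {ρ : ∀ r, J r → E'' → E'} {H : ∀ r, J r → E'' → K}
    (h' : ∀ r, IsCover (ρ r) (H r)) :
    IsCover (I := Σ r, J r) (fun s y => π s.1 (ρ s.1 s.2 y))
      (fun s y => G s.1 (ρ s.1 s.2 y) * H s.1 s.2 y) where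
  measurable_chart s := (h.measurable_chart _).comp ((h' _).measurable_chart _)
  analyticAt_chart s := (h.analyticAt_chart s.1).comp_of_eq ((h' s.1).analyticAt_chart s.2)
    ((h' s.1).chart_zero s.2)
  chart_zero s := by rw [(h' s.1).chart_zero, h.chart_zero]
  measurable_jac s := ((h.measurable_jac _).comp ((h' _).measurable_chart _)).mul
    ((h' _).measurable_jac _)
  analyticAt_jac s := ((h.analyticAt_jac s.1).comp_of_eq ((h' s.1).analyticAt_chart s.2)
    ((h' s.1).chart_zero s.2)).mul ((h' s.1).analyticAt_jac s.2)
  upper N hN := by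
    classical
    choose J0 V C hV hC hJ using fun r => (h' r).upper (fun j => N ⟨r, j⟩) (fun j => hN ⟨r, j⟩)
    obtain ⟨I0, V0, C0, hV0, hC0, hI⟩ := h.upper V hV
    refine ⟨I0.sigma J0, V0, C0 * ∑ r ∈ I0, C r, hV0,
      ENNReal.mul_ne_top hC0 (ENNReal.sum_ne_top.2 fun r _ => hC r), fun f hf => ?_⟩
    refine (hI f hf).trans ?_
    rw [mul_assoc]
    gcongr
    rw [Finset.sum_sigma, Finset.mul_sum]
    refine Finset.sum_le_sum fun r hr => ?_
    refine (hJ r (fun y => f (π r y) * ‖G r y‖ₑ)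
      ((hf.comp (h.measurable_chart r)).mul (h.measurable_jac r).enorm)).trans ?_
    refine mul_le_mul' (Finset.single_le_sum (fun _ _ => zero_le) hr)
      (Finset.sum_le_sum fun j hj => le_of_eq (lintegral_congr fun y => ?_))
    rw [enorm_mul, mul_assoc]
  lower s V hV := by
    obtain ⟨N, C, hN, hC, hh⟩ := h.lower s.1 V hV
    obtain ⟨N', C', hN', hC', hh'⟩ := (h' s.1).lower s.2 N hN
    refine ⟨N', C' * C, hN', ENNReal.mul_ne_top hC' hC, fun f hf => ?_⟩
    have := hh' (fun y => f (π s.1 y) * ‖G s.1 y‖ₑ)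
      ((hf.comp (h.measurable_chart s.1)).mul (h.measurable_jac s.1).enorm)
    simp only [enorm_mul, ← mul_assoc]
    refine this.trans ?_
    rw [mul_assoc]
    gcongr
    exact hh f hf

variable (n : ℕ)

/-- The germs in `S` become monomial in all charts of some cover. -/
def Resolvable (S : Set (E → K)) : Prop :=
  ∃ (I : Type) (π : I → (Fin n → K) → E) (G : I → (Fin n → K) → K), IsCover π G ∧
    ∀ r, IsMon (G r) ∧ ∀ f ∈ S, IsMon fun y => f (π r y)

variable {n}

theorem Resolvable.of_cover {I : Type} {π : I → E' → E}
    {G : I → E' → K} (h : IsCover π G) {S : Set (E → K)}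
    (hr : ∀ r, Resolvable n (insert (G r) ((fun f y => f (π r y)) '' S))) : Resolvable n S := by
  choose J ρ H hc hm using hr
  refine ⟨_, _, _, h.comp hc, fun s => ⟨?_, fun f hf => ?_⟩⟩
  · exact ((hm s.1 s.2).2 _ (mem_insert _ _)).mul (hm s.1 s.2).1
  · exact (hm s.1 s.2).2 _ (mem_insert_of_mem _ ⟨f, hf, rfl⟩)

theorem Resolvable.of_closure {S S' : Set (E → K)}
    (h : Resolvable n S')
    (hs : ∀ f ∈ S, ∃ g ∈ Submonoid.closure S', ∃ u : E → K, AnalyticAt K u 0 ∧ u 0 ≠ 0 ∧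
      f =ᶠ[𝓝 0] fun x => g x * u x) : Resolvable n S := by
  obtain ⟨I, π, G, hc, hm⟩ := h
  refine ⟨I, π, G, hc, fun r => ⟨(hm r).1, fun f hf => ?_⟩⟩
  obtain ⟨g, hg, u, hu, hu0, he⟩ := hs f hf
  have hgm : IsMon fun y => g (π r y) := by
    clear he
    induction hg using Submonoid.closure_induction with
    | mem x hx => exact (hm r).2 x hx
    | one => exact IsMon.one
    | mul x y _ _ hx hy => exact hx.mul hy
  have hum : IsMon fun y => u (π r y) :=
    IsMon.of_unit (hu.comp_of_eq (hc.analyticAt_chart r) (hc.chart_zero r))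
      (by rw [hc.chart_zero]; exact hu0)
  exact (hgm.mul hum).congr (((hc.tendsto_chart r).eventually he).mono fun x hx => hx.symm)

theorem IsCover.of_measurableEquiv (e : E' ≃ᵐ E) (C : ℝ≥0∞) (hC0 : C ≠ 0) (hC : C ≠ ⊤)
    (hmap : Measure.map e volume = C • (volume : Measure E)) (he : AnalyticAt K e 0) (he0 : e 0 = 0)
    (hs : ContinuousAt e.symm 0) :
    IsCover (fun _ : Unit => (e : E' → E)) (fun _ _ => (1 : K)) := by
  have hs0 : e.symm 0 = 0 := by rw [← he0, e.symm_apply_apply]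
  have h_int : ∀ (V : Set E) (f : E → ℝ≥0∞), Measurable f →
      ∫⁻ y in e ⁻¹' V, f (e y) = C * ∫⁻ x in V, f x := by
    intro V f hf
    rw [← smul_eq_mul, ← lintegral_smul_measure, ← Measure.restrict_smul, ← hmap,
      e.restrict_map, lintegral_map_equiv]
  refine ⟨fun _ => e.measurable, fun _ => he, fun _ => he0, fun _ => measurable_const,
    fun _ => analyticAt_const, fun N hN => ?_, fun _ V hV => ?_⟩
  · refine ⟨{()}, e.symm ⁻¹' N (), C⁻¹, hs (by rw [hs0]; exact hN ()),
      ENNReal.inv_ne_top.2 hC0, fun f hf => ?_⟩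
    have h1 := h_int (e.symm ⁻¹' N ()) f hf
    have h2 : e ⁻¹' (e.symm ⁻¹' N ()) = N () := by ext; simp
    rw [h2] at h1
    simp only [Finset.sum_singleton, enorm_one, mul_one, h1]
    rw [← mul_assoc, ENNReal.inv_mul_cancel hC0 hC, one_mul]
  · refine ⟨e ⁻¹' V, C, he.continuousAt (by rw [he0]; exact hV), hC, fun f hf => ?_⟩
    simp only [enorm_one, mul_one]
    exact (h_int V f hf).le


end Covers

section PadicMeasure

variable {p : ℕ} [Fact p.Prime] [MeasureSpace ℚ_[p]] [BorelSpace ℚ_[p]]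
  [(volume : Measure ℚ_[p]).IsAddHaarMeasure]

theorem norm_le_inv_iff_exists (x : ℚ_[p]) (hx : ‖x‖ ≤ 1) :
    ∃ i : Fin p, ‖x - (i : ℕ)‖ ≤ (p : ℝ)⁻¹ := by
  obtain ⟨i, hi, h⟩ := PadicInt.exists_mem_range (⟨x, hx⟩ : ℤ_[p])
  refine ⟨⟨i, hi⟩, ?_⟩
  rw [PadicInt.maximalIdeal_eq_span_p] at h
  have h2 := (PadicInt.norm_le_pow_iff_mem_span_pow (⟨x, hx⟩ - (i : ℤ_[p])) 1).2 (by simpa using h)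
  rw [PadicInt.norm_def] at h2
  push_cast at h2
  rwa [zpow_neg_one] at h2

theorem volume_closedBall_one :
    volume (Metric.closedBall (0 : ℚ_[p]) 1) = p * volume (Metric.closedBall (0 : ℚ_[p]) (p : ℝ)⁻¹) := by
  have hp : (p : ℝ)⁻¹ ≤ 1 := by
    have : (1 : ℝ) ≤ p := by exact_mod_cast (Fact.out : p.Prime).one_le
    exact inv_le_one_of_one_le₀ this
  have hU : Metric.closedBall (0 : ℚ_[p]) 1
      = ⋃ i : Fin p, Metric.closedBall ((i : ℕ) : ℚ_[p]) (p : ℝ)⁻¹ := by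
    ext x
    simp only [mem_iUnion, Metric.mem_closedBall, dist_eq_norm, sub_zero]
    refine ⟨norm_le_inv_iff_exists x, fun ⟨i, hi⟩ => ?_⟩
    have h1 : ‖((i : ℕ) : ℚ_[p])‖ ≤ 1 := by
      simpa using Padic.norm_int_le_one (p := p) (i : ℕ)
    calc ‖x‖ = ‖(x - (i : ℕ)) + (i : ℕ)‖ := by rw [sub_add_cancel]
      _ ≤ max ‖x - (i : ℕ)‖ ‖((i : ℕ) : ℚ_[p])‖ := IsUltrametricDist.norm_add_le_max _ _
      _ ≤ 1 := max_le (hi.trans hp) h1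
  rw [hU, measure_iUnion]
  · simp_rw [Measure.addHaar_closedBall_center]
    simp
  · intro i j hij
    rcases IsUltrametricDist.closedBall_eq_or_disjoint ((i : ℕ) : ℚ_[p]) ((j : ℕ) : ℚ_[p])
      (p : ℝ)⁻¹ with h | h
    · exfalso
      have h1 : ((i : ℕ) : ℚ_[p]) ∈ Metric.closedBall ((j : ℕ) : ℚ_[p]) (p : ℝ)⁻¹ := by
        rw [← h]; exact Metric.mem_closedBall_self (by positivity)
      rw [Metric.mem_closedBall, dist_eq_norm] at h1
      have h2 : ‖(((i : ℕ) - (j : ℕ) : ℤ) : ℚ_[p])‖ ≤ (p : ℝ) ^ (-(1 : ℕ) : ℤ) := by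
        push_cast; simpa using h1
      rw [Padic.norm_int_le_pow_iff_dvd] at h2
      apply hij
      have hi := i.2
      have hj := j.2
      have : ((i : ℕ) : ℤ) = (j : ℕ) := by
        refine sub_eq_zero.1 (Int.eq_zero_of_abs_lt_dvd (by simpa using h2) ?_)
        rw [abs_lt]; constructor <;> omega
      exact Fin.ext (by exact_mod_cast this)
    · exact h
  · exact fun i => Metric.isClosed_closedBall.measurableSet

/-- Multiplication by `c` scales the measure by `‖c‖`. -/
theorem lintegral_mul_left {c : ℚ_[p]} (hc : c ≠ 0) {h : ℚ_[p] → ℝ≥0∞} (hh : Measurable h) :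
    ∫⁻ t, h (c * t) * ‖c‖ₑ = ∫⁻ t, h t := by
  have main : ∀ (c : ℚ_[p]), c ≠ 0 → ∀ r : ℝ, 0 < r →
      volume (Metric.closedBall (0 : ℚ_[p]) (r * ‖c‖⁻¹)) * ‖c‖ₑ
        = volume (Metric.closedBall (0 : ℚ_[p]) r) →
      ∀ h : ℚ_[p] → ℝ≥0∞, Measurable h → ∫⁻ t, h (c * t) * ‖c‖ₑ = ∫⁻ t, h t := by
    intro c hc r hr hb h hh
    let e : ℚ_[p] ≃L[ℚ_[p]] ℚ_[p] :=
      ContinuousLinearEquiv.unitsEquivAut ℚ_[p] (Units.mk0 c hc)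
    have hee : ∀ t, e t = c * t := fun t => by
      simp [e, ContinuousLinearEquiv.unitsEquivAut_apply, mul_comm]
    have hae : (Measure.map e (volume : Measure ℚ_[p])).IsAddHaarMeasure :=
      e.isAddHaarMeasure_map volume
    obtain ⟨m, hm⟩ : ∃ m : ℝ≥0∞, Measure.map e (volume : Measure ℚ_[p]) = m • volume :=
      ⟨_, Measure.isAddLeftInvariant_eq_smul _ _⟩
    have h_int : ∀ f : ℚ_[p] → ℝ≥0∞, Measurable f → ∫⁻ t, f (c * t) = m * ∫⁻ t, f t := by
      intro f hf
      rw [← smul_eq_mul, ← lintegral_smul_measure, ← hm, lintegral_map hf e.continuous.measurable]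
      simp_rw [hee]
    have h1 := h_int ((Metric.closedBall (0 : ℚ_[p]) r).indicator 1)
      (measurable_one.indicator Metric.isClosed_closedBall.measurableSet)
    rw [lintegral_indicator_one Metric.isClosed_closedBall.measurableSet] at h1
    have h2 : (fun t => (Metric.closedBall (0 : ℚ_[p]) r).indicator (1 : ℚ_[p] → ℝ≥0∞) (c * t))
        = (Metric.closedBall (0 : ℚ_[p]) (r * ‖c‖⁻¹)).indicator 1 := by
      funext t
      refine indicator_eq_indicator ?_ rfl
      rw [mem_closedBall_zero_iff, mem_closedBall_zero_iff, norm_mul, ← div_eq_mul_inv,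
        le_div_iff₀ (norm_pos_iff.2 hc), mul_comm]
    rw [h2, lintegral_indicator_one Metric.isClosed_closedBall.measurableSet] at h1
    have hpos : volume (Metric.closedBall (0 : ℚ_[p]) r) ≠ 0 :=
      (Metric.measure_closedBall_pos _ _ hr).ne'
    have hfin : volume (Metric.closedBall (0 : ℚ_[p]) r) ≠ ⊤ :=
      (isCompact_closedBall _ _).measure_lt_top.ne
    have h3 : m * ‖c‖ₑ = 1 := by
      rw [h1, mul_right_comm] at hb
      rw [← ENNReal.mul_left_inj hpos hfin, hb, one_mul]
    rw [lintegral_mul_const _ (by fun_prop), h_int h hh, mul_right_comm, h3, one_mul]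
  have hunit : ∀ c : ℚ_[p], ‖c‖ = 1 → ∀ h : ℚ_[p] → ℝ≥0∞, Measurable h →
      ∫⁻ t, h (c * t) * ‖c‖ₑ = ∫⁻ t, h t := by
    intro c hc
    refine main c (norm_ne_zero_iff.1 (by rw [hc]; exact one_ne_zero)) 1 one_pos ?_
    have : ‖c‖ₑ = 1 := by rw [← ofReal_norm, hc, ENNReal.ofReal_one]
    rw [hc, this, inv_one, mul_one, mul_one]
  have hp0 : (p : ℝ) ≠ 0 := by exact_mod_cast (Fact.out : p.Prime).ne_zero
  have hpK : (p : ℚ_[p]) ≠ 0 := by exact_mod_cast (Fact.out : p.Prime).ne_zero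
  have hp : ∀ h : ℚ_[p] → ℝ≥0∞, Measurable h →
      ∫⁻ t, h (p * t) * ‖(p : ℚ_[p])‖ₑ = ∫⁻ t, h t := by
    refine main p hpK (p : ℝ)⁻¹ (by positivity) ?_
    have : ‖(p : ℚ_[p])‖ₑ = (p : ℝ≥0∞)⁻¹ := by
      rw [← ofReal_norm, Padic.norm_p, ENNReal.ofReal_inv_of_pos (by positivity)]
      simp
    rw [this, Padic.norm_p, inv_inv, inv_mul_cancel₀ hp0, volume_closedBall_one, mul_right_comm,
      ENNReal.mul_inv_cancel, one_mul]
    · exact_mod_cast (Fact.out : p.Prime).ne_zero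
    · exact ENNReal.natCast_ne_top p
  have hpow : ∀ (j : ℕ) (h : ℚ_[p] → ℝ≥0∞), Measurable h →
      ∫⁻ t, h ((p : ℚ_[p]) ^ j * t) * ‖(p : ℚ_[p]) ^ j‖ₑ = ∫⁻ t, h t := by
    intro j
    induction j with
    | zero => intro h hh; simp
    | succ j ih =>
      intro h hh
      rw [← ih h hh, ← hp (fun t => h ((p : ℚ_[p]) ^ j * t) * ‖(p : ℚ_[p]) ^ j‖ₑ) (by fun_prop)]
      simp only [pow_succ, enorm_mul, mul_assoc]
  have hinv : ∀ c : ℚ_[p], c ≠ 0 → (∀ h : ℚ_[p] → ℝ≥0∞, Measurable h →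
      ∫⁻ t, h (c * t) * ‖c‖ₑ = ∫⁻ t, h t) → ∀ h : ℚ_[p] → ℝ≥0∞, Measurable h →
      ∫⁻ t, h (c⁻¹ * t) * ‖c⁻¹‖ₑ = ∫⁻ t, h t := by
    intro c hc H h hh
    rw [← H (fun t => h (c⁻¹ * t) * ‖c⁻¹‖ₑ) (by fun_prop)]
    refine lintegral_congr fun t => ?_
    rw [inv_mul_cancel_left₀ hc, mul_assoc, ← enorm_mul, inv_mul_cancel₀ hc, enorm_one, mul_one]
  have hz : ∀ (j : ℤ) (h : ℚ_[p] → ℝ≥0∞), Measurable h →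
      ∫⁻ t, h ((p : ℚ_[p]) ^ j * t) * ‖(p : ℚ_[p]) ^ j‖ₑ = ∫⁻ t, h t := by
    intro j
    obtain ⟨k, rfl | rfl⟩ := j.eq_nat_or_neg
    · simpa using hpow k
    · rw [zpow_neg, zpow_natCast]
      exact hinv _ (pow_ne_zero _ hpK) (hpow k)
  have hj := Padic.norm_eq_zpow_neg_valuation hc
  have hu : ‖c * ((p : ℚ_[p]) ^ c.valuation)⁻¹‖ = 1 := by
    rw [norm_mul, norm_inv, Padic.norm_p_zpow, hj]
    exact mul_inv_cancel₀ (zpow_ne_zero _ hp0)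
  set u := c * ((p : ℚ_[p]) ^ c.valuation)⁻¹ with hu_def
  have hcu : u * (p : ℚ_[p]) ^ c.valuation = c := by
    rw [hu_def, inv_mul_cancel_right₀ (zpow_ne_zero _ hpK)]
  rw [← hunit u hu h hh, ← hz c.valuation (fun t => h (u * t) * ‖u‖ₑ) (by fun_prop)]
  refine lintegral_congr fun t => ?_
  rw [mul_assoc (h _), ← enorm_mul, ← mul_assoc, hcu]

end PadicMeasure

section PowerMap

variable {p : ℕ} [Fact p.Prime] [MeasureSpace ℚ_[p]] [BorelSpace ℚ_[p]]
  [(volume : Measure ℚ_[p]).IsAddHaarMeasure]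

theorem volume_ball_scale (x y : ℚ_[p]) {c : ℚ_[p]} (hc : c ≠ 0) (s : ℝ) :
    ‖c‖ₑ * volume (Metric.ball x (s / ‖c‖)) = volume (Metric.ball y s) := by
  rw [Measure.addHaar_ball_center _ x, Measure.addHaar_ball_center _ y]
  have h := lintegral_mul_left hc (h := (Metric.ball (0 : ℚ_[p]) s).indicator 1)
    (measurable_one.indicator Metric.isOpen_ball.measurableSet)
  rw [lintegral_indicator_one Metric.isOpen_ball.measurableSet] at h
  rw [← h, mul_comm, lintegral_mul_const _ (by
    refine (measurable_one.indicator Metric.isOpen_ball.measurableSet).comp ?_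
    fun_prop)]
  congr 1
  rw [← lintegral_indicator_one Metric.isOpen_ball.measurableSet]
  refine lintegral_congr fun t => ?_
  refine indicator_eq_indicator ?_ rfl
  rw [mem_ball_zero_iff, mem_ball_zero_iff, norm_mul, lt_div_iff₀ (norm_pos_iff.2 hc), mul_comm]

theorem lintegral_ball_of_norm_sub_eq {φ : ℚ_[p] → ℚ_[p]} (hφ : Continuous φ) {m : ℚ_[p]}
    (hm : m ≠ 0) {a : ℚ_[p]} {r : ℝ} (hr : 0 < r)
    (hiso : ∀ x ∈ Metric.ball a r, ∀ y ∈ Metric.ball a r, ‖φ x - φ y‖ = ‖m‖ * ‖x - y‖)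
    (hsurj : ∀ w ∈ Metric.ball (φ a) (‖m‖ * r), ∃ z ∈ Metric.ball a r, φ z = w)
    {h : ℚ_[p] → ℝ≥0∞} (hh : Measurable h) :
    ∫⁻ x in Metric.ball a r, h (φ x) * ‖m‖ₑ = ∫⁻ w in Metric.ball (φ a) (‖m‖ * r), h w := by
  have hm0 : 0 < ‖m‖ := norm_pos_iff.2 hm
  set S := Metric.ball a r
  set T := Metric.ball (φ a) (‖m‖ * r)
  have hST : ∀ x ∈ S, φ x ∈ T := by
    intro x hx
    have := hiso x hx a (Metric.mem_ball_self hr)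
    rw [mem_ball_iff_norm, this]
    exact mul_lt_mul_of_pos_left (mem_ball_iff_norm.1 hx) hm0
  have hfin : ∀ (x : ℚ_[p]) (s : ℝ), volume (Metric.ball x s) ≠ ⊤ := fun x s =>
    measure_ball_lt_top.ne
  have key : ‖m‖ₑ • Measure.map φ (volume.restrict S) = volume.restrict T := by
    have hballs : ∀ y s, 0 < s → (‖m‖ₑ • Measure.map φ (volume.restrict S)) (Metric.ball y s)
        = volume.restrict T (Metric.ball y s) := by
      intro y s hs
      rw [Measure.smul_apply, Measure.map_apply hφ.measurable Metric.isOpen_ball.measurableSet,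
        Measure.restrict_apply (hφ.measurable Metric.isOpen_ball.measurableSet),
        Measure.restrict_apply Metric.isOpen_ball.measurableSet, smul_eq_mul]
      rcases (Metric.ball y s ∩ T).eq_empty_or_nonempty with he | ⟨w, hw, hwT⟩
      · have : φ ⁻¹' Metric.ball y s ∩ S = ∅ := by
          rw [eq_empty_iff_forall_notMem] at he ⊢
          exact fun x hx => he (φ x) ⟨hx.1, hST x hx.2⟩
        rw [this, he]; simp
      · obtain ⟨x, hx, rfl⟩ := hsurj w hwT
        have e1 : Metric.ball y s ∩ T = Metric.ball (φ x) (min s (‖m‖ * r)) := by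
          rw [IsUltrametricDist.ball_eq_of_mem hw]
          have hT : T = Metric.ball (φ x) (‖m‖ * r) := IsUltrametricDist.ball_eq_of_mem hwT
          rw [hT]
          ext z
          simp
        have e2 : φ ⁻¹' Metric.ball y s ∩ S = Metric.ball x (min s (‖m‖ * r) / ‖m‖) := by
          rw [IsUltrametricDist.ball_eq_of_mem hw]
          have hS : S = Metric.ball x r := IsUltrametricDist.ball_eq_of_mem hx
          ext z
          rw [mem_inter_iff, mem_preimage, mem_ball_iff_norm, Metric.mem_ball (x := x),
            dist_eq_norm, lt_div_iff₀ hm0, lt_min_iff]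
          have : ‖z - x‖ * ‖m‖ < ‖m‖ * r ↔ z ∈ S := by
            rw [hS, mem_ball_iff_norm, mul_comm, mul_lt_mul_iff_right₀ hm0]
          rw [this]
          refine and_congr_left fun hz => ?_
          rw [hiso z hz x hx, mul_comm]
        rw [e1, e2, volume_ball_scale _ _ hm]
    have hgen : (inferInstance : MeasurableSpace ℚ_[p])
        = MeasurableSpace.generateFrom {s | ∃ x r, 0 < r ∧ s = Metric.ball x r} := by
      rw [BorelSpace.measurable_eq (α := ℚ_[p])]
      refine TopologicalSpace.IsTopologicalBasis.borel_eq_generateFrom ?_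
      refine TopologicalSpace.isTopologicalBasis_of_isOpen_of_nhds ?_ ?_
      · rintro _ ⟨x, r, _, rfl⟩; exact Metric.isOpen_ball
      · intro x u hx hu
        obtain ⟨ε, hε, h⟩ := Metric.isOpen_iff.1 hu x hx
        exact ⟨_, ⟨x, ε, hε, rfl⟩, Metric.mem_ball_self hε, h⟩
    have hpi : IsPiSystem {s | ∃ (x : ℚ_[p]) (r : ℝ), 0 < r ∧ s = Metric.ball x r} := by
      rintro _ ⟨x, r, hr, rfl⟩ _ ⟨y, s, hs, rfl⟩ ⟨z, hzx, hzy⟩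
      refine ⟨z, min r s, lt_min hr hs, ?_⟩
      rw [IsUltrametricDist.ball_eq_of_mem hzx, IsUltrametricDist.ball_eq_of_mem hzy]
      ext; simp
    have : IsFiniteMeasure (‖m‖ₑ • Measure.map φ (volume.restrict S)) := by
      have : IsFiniteMeasure (volume.restrict S) := ⟨by
        rw [Measure.restrict_apply_univ]; exact (hfin _ _).lt_top⟩
      exact ⟨by
        rw [Measure.smul_apply, smul_eq_mul]
        exact ENNReal.mul_lt_top enorm_lt_top (measure_lt_top _ _)⟩
    refine ext_of_generate_finite _ hgen hpi ?_ ?_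
    · rintro _ ⟨y, s, hs, rfl⟩
      exact hballs y s hs
    · have hpre : φ ⁻¹' T ∩ S = S := inter_eq_right.2 hST
      have hb := hballs (φ a) (‖m‖ * r) (by positivity)
      rw [Measure.smul_apply, Measure.map_apply hφ.measurable Metric.isOpen_ball.measurableSet,
        Measure.restrict_apply (hφ.measurable Metric.isOpen_ball.measurableSet),
        hpre, Measure.restrict_apply Metric.isOpen_ball.measurableSet,
        inter_self] at hb
      rw [Measure.smul_apply, Measure.map_apply hφ.measurable MeasurableSet.univ, preimage_univ,
        Measure.restrict_apply_univ, Measure.restrict_apply_univ, hb]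
  rw [← key, lintegral_smul_measure, lintegral_map hh hφ.measurable, smul_eq_mul, mul_comm,
    lintegral_mul_const _ (f := fun x => h (φ x)) (hh.comp hφ.measurable)]

theorem norm_sum_pow_mul_pow {N : ℕ} (hN : N ≠ 0) {a x y : ℚ_[p]} (ha : ‖a‖ = 1)
    (hx : x ∈ Metric.ball a ‖(N : ℚ_[p])‖) (hy : y ∈ Metric.ball a ‖(N : ℚ_[p])‖) :
    ‖x ^ N - y ^ N‖ = ‖(N : ℚ_[p])‖ * ‖x - y‖ := by
  have hN1 : ‖(N : ℚ_[p])‖ ≤ 1 := by simpa using Padic.norm_int_le_one (p := p) N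
  have hN0 : 0 < ‖(N : ℚ_[p])‖ := norm_pos_iff.2 (by exact_mod_cast hN)
  have hone : ∀ z ∈ Metric.ball a ‖(N : ℚ_[p])‖, ‖z‖ = 1 := by
    intro z hz
    rw [mem_ball_iff_norm] at hz
    have : ‖z - a‖ < ‖a‖ := by rw [ha]; exact hz.trans_le hN1
    have h2 := IsUltrametricDist.norm_add_eq_max_of_norm_ne_norm this.ne
    rw [sub_add_cancel, max_eq_right this.le] at h2
    rw [h2, ha]
  have hx1 := hone x hx
  have hy1 := hone y hy
  have hxy : ‖x - y‖ < ‖(N : ℚ_[p])‖ := by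
    rw [IsUltrametricDist.ball_eq_of_mem hy] at hx
    exact mem_ball_iff_norm.1 hx
  rw [← (Commute.all x y).geom_sum₂_mul, norm_mul]
  congr 1
  have hsum : ‖(∑ i ∈ Finset.range N, x ^ i * y ^ (N - 1 - i)) - N * y ^ (N - 1)‖
      ≤ ‖x - y‖ := by
    have : (∑ i ∈ Finset.range N, x ^ i * y ^ (N - 1 - i)) - N * y ^ (N - 1)
        = ∑ i ∈ Finset.range N, (x ^ i - y ^ i) * y ^ (N - 1 - i) := by
      have h3 : (N : ℚ_[p]) * y ^ (N - 1) = ∑ i ∈ Finset.range N, y ^ i * y ^ (N - 1 - i) := by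
        rw [Finset.sum_congr rfl (g := fun _ => y ^ (N - 1))]
        · simp
        · intro i hi
          rw [← pow_add]; congr 1
          have := Finset.mem_range.1 hi; omega
      rw [h3, ← Finset.sum_sub_distrib]
      simp_rw [sub_mul]
    rw [this]
    refine IsUltrametricDist.norm_sum_le_of_forall_le_of_nonneg (norm_nonneg _) fun i _ => ?_
    rw [norm_mul, norm_pow, hy1, one_pow, mul_one, ← (Commute.all x y).geom_sum₂_mul, norm_mul]
    refine mul_le_of_le_one_left (norm_nonneg _) ?_
    refine IsUltrametricDist.norm_sum_le_of_forall_le_of_nonneg zero_le_one fun j _ => ?_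
    simp [hx1, hy1]
  have hb : ‖(N : ℚ_[p]) * y ^ (N - 1)‖ = ‖(N : ℚ_[p])‖ := by simp [hy1]
  have := IsUltrametricDist.norm_add_eq_max_of_norm_ne_norm
    (x := (∑ i ∈ Finset.range N, x ^ i * y ^ (N - 1 - i)) - N * y ^ (N - 1))
    (y := (N : ℚ_[p]) * y ^ (N - 1)) (by rw [hb]; exact (hsum.trans_lt hxy).ne)
  rw [sub_add_cancel, hb, max_eq_right (hsum.trans hxy.le)] at this
  exact this

theorem exists_pow_eq_of_mem_ball {N : ℕ} {a w : ℚ_[p]} (ha : ‖a‖ = 1)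
    (hw : w ∈ Metric.ball (a ^ N) (‖(N : ℚ_[p])‖ * ‖(N : ℚ_[p])‖)) :
    ∃ z ∈ Metric.ball a ‖(N : ℚ_[p])‖, z ^ N = w := by
  have hN1 : ‖(N : ℚ_[p])‖ ≤ 1 := by simpa using Padic.norm_int_le_one (p := p) N
  have hw1 : ‖w‖ ≤ 1 := by
    rw [mem_ball_iff_norm] at hw
    have : ‖w - a ^ N‖ ≤ 1 := hw.le.trans (mul_le_one₀ hN1 (norm_nonneg _) hN1)
    calc ‖w‖ = ‖w - a ^ N + a ^ N‖ := by rw [sub_add_cancel]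
      _ ≤ max _ _ := IsUltrametricDist.norm_add_le_max _ _
      _ ≤ 1 := max_le this (by simp [ha])
  obtain ⟨a', ha'⟩ : ∃ a' : ℤ_[p], (a' : ℚ_[p]) = a := ⟨⟨a, ha.le⟩, rfl⟩
  obtain ⟨w', hw'⟩ : ∃ w' : ℤ_[p], (w' : ℚ_[p]) = w := ⟨⟨w, hw1⟩, rfl⟩
  let F : Polynomial ℤ_[p] := Polynomial.X ^ N - Polynomial.C w'
  have hd : ‖F.derivative.aeval a'‖ = ‖(N : ℚ_[p])‖ := by
    have h1 : F.derivative.aeval a' = N * a' ^ (N - 1) := by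
      simp [F, Polynomial.derivative_X_pow]
    rw [h1, PadicInt.norm_def]
    push_cast
    rw [ha', norm_mul, norm_pow, ha, one_pow, mul_one]
  have he : ‖F.aeval a'‖ = ‖w - a ^ N‖ := by
    have h1 : F.aeval a' = a' ^ N - w' := by simp [F]
    rw [h1, norm_sub_rev, PadicInt.norm_def]
    push_cast
    rw [ha', hw']
  obtain ⟨z, hz, hza, -⟩ := hensels_lemma (F := F) (a := a') (by
    rw [hd, he, sq]; exact mem_ball_iff_norm.1 hw)
  refine ⟨z, ?_, ?_⟩
  · rw [mem_ball_iff_norm, ← ha']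
    rw [hd, PadicInt.norm_def] at hza
    exact_mod_cast hza
  · have := congrArg (fun x : ℤ_[p] => (x : ℚ_[p])) hz
    simpa [F, sub_eq_zero, hw'] using this

end PowerMap

theorem setLIntegral_le_sum_of_subset {α ι : Type*} [MeasurableSpace α] {μ : Measure α}
    {s : Set α} (t : Finset ι) (A : ι → Set α) (hs : s ⊆ ⋃ i ∈ t, A i) (h : α → ℝ≥0∞) :
    ∫⁻ x in s, h x ∂μ ≤ ∑ i ∈ t, ∫⁻ x in A i, h x ∂μ := by
  classical
  refine (lintegral_mono_set hs).trans ?_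
  clear hs
  induction t using Finset.induction_on with
  | empty => simp
  | insert a t ha ih =>
    rw [Finset.set_biUnion_insert, Finset.sum_insert ha]
    exact (lintegral_union_le _ _ _).trans (by gcongr)

section PowerCover

variable {p : ℕ} [Fact p.Prime] [MeasureSpace ℚ_[p]] [BorelSpace ℚ_[p]]
  [(volume : Measure ℚ_[p]).IsAddHaarMeasure]

theorem norm_eq_one_of_mem_ball {a w : ℚ_[p]} {r : ℝ} (ha : ‖a‖ = 1) (hr : r ≤ 1)
    (hw : w ∈ Metric.ball a r) : ‖w‖ = 1 := by
  rw [mem_ball_iff_norm] at hw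
  have : ‖w - a‖ < ‖a‖ := by rw [ha]; exact hw.trans_le hr
  have h2 := IsUltrametricDist.norm_add_eq_max_of_norm_ne_norm this.ne
  rw [sub_add_cancel, max_eq_right this.le] at h2
  rw [h2, ha]

theorem lintegral_ball_pow {N : ℕ} (hN : N ≠ 0) {a : ℚ_[p]} (ha : ‖a‖ = 1)
    {h : ℚ_[p] → ℝ≥0∞} (hh : Measurable h) :
    ∫⁻ x in Metric.ball a ‖(N : ℚ_[p])‖, h (x ^ N) * ‖(N : ℚ_[p])‖ₑ
      = ∫⁻ w in Metric.ball (a ^ N) (‖(N : ℚ_[p])‖ * ‖(N : ℚ_[p])‖), h w := by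
  have hN' : (N : ℚ_[p]) ≠ 0 := by exact_mod_cast hN
  exact lintegral_ball_of_norm_sub_eq (φ := fun x => x ^ N) (by fun_prop) hN'
    (norm_pos_iff.2 hN') (fun x hx y hy => norm_sum_pow_mul_pow hN ha hx hy)
    (fun w hw => exists_pow_eq_of_mem_ball ha hw) hh

theorem norm_natCast_le_one (N : ℕ) : ‖(N : ℚ_[p])‖ ≤ 1 := by
  simpa using Padic.norm_int_le_one (p := p) N

theorem lintegral_sphere_mul_left {c : ℚ_[p]} (hc : c ≠ 0) {h : ℚ_[p] → ℝ≥0∞}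
    (hh : Measurable h) :
    ∫⁻ x in Metric.sphere 0 ‖c‖, h x = (∫⁻ x in Metric.sphere 0 1, h (c * x)) * ‖c‖ₑ := by
  rw [← lintegral_mul_const _ (by fun_prop),
    ← lintegral_indicator Metric.isClosed_sphere.measurableSet,
    ← lintegral_indicator Metric.isClosed_sphere.measurableSet,
    ← lintegral_mul_left hc (hh.indicator Metric.isClosed_sphere.measurableSet)]
  refine lintegral_congr fun t => ?_
  have : c * t ∈ Metric.sphere (0 : ℚ_[p]) ‖c‖ ↔ t ∈ Metric.sphere (0 : ℚ_[p]) 1 := by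
    rw [mem_sphere_zero_iff_norm, mem_sphere_zero_iff_norm, norm_mul]
    exact mul_eq_left₀ (norm_ne_zero_iff.2 hc)
  by_cases ht : t ∈ Metric.sphere (0 : ℚ_[p]) 1
  · rw [indicator_of_mem ht, indicator_of_mem (this.2 ht)]
  · rw [indicator_of_notMem ht, indicator_of_notMem (mt this.1 ht), zero_mul]

theorem exists_lintegral_sphere_pow_le {N : ℕ} (hN : N ≠ 0) :
    ∃ C : ℝ≥0∞, C ≠ ⊤ ∧ ∀ h : ℚ_[p] → ℝ≥0∞, Measurable h →
      ∫⁻ x in Metric.sphere 0 1, h (x ^ N) ≤ C * ∫⁻ x in Metric.sphere 0 1, h x := by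
  have hN' : (N : ℚ_[p]) ≠ 0 := by exact_mod_cast hN
  have hN0 := norm_pos_iff.2 hN'
  obtain ⟨t, ht, htf, hc⟩ := (isCompact_sphere (0 : ℚ_[p]) 1).finite_cover_balls hN0
  lift t to Finset ℚ_[p] using htf
  refine ⟨∑ a ∈ t, ‖(N : ℚ_[p])‖ₑ⁻¹, ENNReal.sum_ne_top.2 fun a _ =>
    ENNReal.inv_ne_top.2 (by simpa using hN), fun h hh => ?_⟩
  refine (setLIntegral_le_sum_of_subset t _ (by simpa using hc) _).trans ?_
  rw [Finset.sum_mul]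
  refine Finset.sum_le_sum fun a ha => ?_
  have ha1 : ‖a‖ = 1 := mem_sphere_zero_iff_norm.1 (ht ha)
  have h1 := lintegral_ball_pow hN ha1 hh
  rw [lintegral_mul_const _ (by fun_prop)] at h1
  rw [← one_mul (∫⁻ x in Metric.ball a _, h (x ^ N)),
    ← ENNReal.inv_mul_cancel (a := ‖(N : ℚ_[p])‖ₑ) (by simpa using hN) enorm_ne_top, mul_assoc,
    mul_comm ‖(N : ℚ_[p])‖ₑ, h1]
  gcongr
  intro w hw
  rw [mem_sphere_zero_iff_norm]
  refine norm_eq_one_of_mem_ball (by rw [norm_pow, ha1, one_pow]) ?_ hw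
  exact mul_le_one₀ (norm_natCast_le_one N) (norm_nonneg _) (norm_natCast_le_one N)

theorem exists_lintegral_sphere_le_sum_pow {N : ℕ} (hN : N ≠ 0) :
    ∃ t : Finset ℚ_[p], (∀ b ∈ t, ‖b‖ = 1) ∧ ∀ h : ℚ_[p] → ℝ≥0∞, Measurable h →
      ∫⁻ x in Metric.sphere 0 1, h x ≤ ∑ b ∈ t, ∫⁻ x in Metric.sphere 0 1, h (b * x ^ N) := by
  have hN' : (N : ℚ_[p]) ≠ 0 := by exact_mod_cast hN
  have hN0 := norm_pos_iff.2 hN'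
  obtain ⟨t, ht, htf, hc⟩ := (isCompact_sphere (0 : ℚ_[p]) 1).finite_cover_balls (mul_pos hN0 hN0)
  lift t to Finset ℚ_[p] using htf
  have ht1 : ∀ a ∈ t, ‖a‖ = 1 := fun a ha => mem_sphere_zero_iff_norm.1 (ht ha)
  refine ⟨t, ht1, fun h hh => ?_⟩
  refine (setLIntegral_le_sum_of_subset t _ (by simpa using hc) _).trans ?_
  refine Finset.sum_le_sum fun b hb => ?_
  have hb1 := ht1 b hb
  have hb0 : b ≠ 0 := norm_ne_zero_iff.1 (by rw [hb1]; exact one_ne_zero)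
  have hbe : ‖b‖ₑ = 1 := by rw [← ofReal_norm, hb1, ENNReal.ofReal_one]
  have e1 : ∫⁻ x in Metric.ball b (‖(N : ℚ_[p])‖ * ‖(N : ℚ_[p])‖), h x
      = ∫⁻ x in Metric.ball 1 (‖(N : ℚ_[p])‖ * ‖(N : ℚ_[p])‖), h (b * x) := by
    rw [← lintegral_indicator Metric.isOpen_ball.measurableSet,
      ← lintegral_indicator Metric.isOpen_ball.measurableSet,
      ← lintegral_mul_left hb0 (hh.indicator Metric.isOpen_ball.measurableSet)]
    refine lintegral_congr fun x => ?_
    rw [hbe, mul_one]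
    have : b * x ∈ Metric.ball b (‖(N : ℚ_[p])‖ * ‖(N : ℚ_[p])‖)
        ↔ x ∈ Metric.ball 1 (‖(N : ℚ_[p])‖ * ‖(N : ℚ_[p])‖) := by
      rw [mem_ball_iff_norm, mem_ball_iff_norm]
      nth_rewrite 2 [← mul_one b]
      rw [← mul_sub, norm_mul, hb1, one_mul]
    by_cases hx : x ∈ Metric.ball (1 : ℚ_[p]) (‖(N : ℚ_[p])‖ * ‖(N : ℚ_[p])‖)
    · rw [indicator_of_mem hx, indicator_of_mem (this.2 hx)]
    · rw [indicator_of_notMem hx, indicator_of_notMem (mt this.1 hx)]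
  have h1 := lintegral_ball_pow hN (a := (1 : ℚ_[p])) norm_one (h := fun x => h (b * x))
    (by fun_prop)
  rw [one_pow] at h1
  rw [e1, ← h1]
  refine (lintegral_mono (g := fun x => h (b * x ^ N)) fun x => ?_).trans (lintegral_mono_set ?_)
  · refine mul_le_of_le_one_right' ?_
    rw [← ofReal_norm]
    exact ENNReal.ofReal_le_one.2 (norm_natCast_le_one N)
  · intro w hw
    rw [mem_sphere_zero_iff_norm]
    exact norm_eq_one_of_mem_ball norm_one (norm_natCast_le_one N) hw

theorem lintegral_closedBall_eq_tsum {c : ℚ_[p]} (hc : c ≠ 0) {h : ℚ_[p] → ℝ≥0∞}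
    (hh : Measurable h) :
    ∫⁻ x in Metric.closedBall 0 ‖c‖, h x
      = ∑' i : ℕ, (∫⁻ x in Metric.sphere 0 1, h (c * (p : ℚ_[p]) ^ i * x)) *
          ‖c * (p : ℚ_[p]) ^ i‖ₑ := by
  have hpK : (p : ℚ_[p]) ≠ 0 := by exact_mod_cast (Fact.out : p.Prime).ne_zero
  have hp1 : (1 : ℝ) < p := by exact_mod_cast (Fact.out : p.Prime).one_lt
  have hU : (Metric.closedBall (0 : ℚ_[p]) ‖c‖ : Set ℚ_[p]) \ {0}
      = ⋃ i : ℕ, Metric.sphere (0 : ℚ_[p]) ‖c * (p : ℚ_[p]) ^ i‖ := by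
    ext x
    simp only [Set.mem_sdiff, mem_closedBall_zero_iff, mem_singleton_iff, mem_iUnion,
      mem_sphere_zero_iff_norm]
    constructor
    · rintro ⟨hx, hx0⟩
      have h1 := Padic.norm_eq_zpow_neg_valuation hx0
      have h2 := Padic.norm_eq_zpow_neg_valuation hc
      rw [h1, h2, zpow_le_zpow_iff_right₀ hp1] at hx
      refine ⟨(x.valuation - c.valuation).toNat, ?_⟩
      rw [norm_mul, h1, h2, norm_pow, Padic.norm_p, ← zpow_natCast, inv_zpow', ← zpow_add₀ (by positivity)]
      congr 1
      rw [Int.toNat_of_nonneg (by omega)]; ring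
    · rintro ⟨i, hi⟩
      refine ⟨?_, ?_⟩
      · rw [hi, norm_mul, norm_pow]
        refine mul_le_of_le_one_right (norm_nonneg _) (pow_le_one₀ (norm_nonneg _) ?_)
        exact norm_natCast_le_one p
      · rintro rfl
        rw [norm_zero, eq_comm, norm_eq_zero] at hi
        exact mul_ne_zero hc (pow_ne_zero _ hpK) hi
  have e0 : ∫⁻ x in Metric.closedBall 0 ‖c‖, h x
      = ∫⁻ x in Metric.closedBall (0 : ℚ_[p]) ‖c‖ \ {0}, h x :=
    (setLIntegral_congr (sdiff_null_ae_eq_self (measure_singleton _))).symm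
  rw [e0, hU, lintegral_iUnion (fun i => Metric.isClosed_sphere.measurableSet)]
  · refine tsum_congr fun i => ?_
    rw [lintegral_sphere_mul_left (mul_ne_zero hc (pow_ne_zero _ hpK)) hh]
  · intro i j hij
    refine Set.disjoint_left.2 fun x hx hy => hij ?_
    rw [mem_sphere_zero_iff_norm] at hx hy
    rw [hx, norm_mul, norm_mul, norm_pow, norm_pow] at hy
    have := mul_left_cancel₀ (norm_ne_zero_iff.2 hc) hy
    rw [Padic.norm_p] at this
    exact pow_right_injective₀ (inv_pos.2 (by linarith)) (inv_lt_one_of_one_lt₀ hp1).ne this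

end PowerCover

section PowerCover

variable {p : ℕ} [Fact p.Prime] [MeasureSpace ℚ_[p]] [BorelSpace ℚ_[p]]
  [(volume : Measure ℚ_[p]).IsAddHaarMeasure]

theorem exists_closedBall_subset {V : Set ℚ_[p]} (hV : V ∈ 𝓝 0) :
    ∃ c : ℚ_[p], c ≠ 0 ∧ ∀ d : ℚ_[p], ‖d‖ ≤ ‖c‖ → Metric.closedBall 0 ‖d‖ ⊆ V := by
  obtain ⟨ε, hε, h⟩ := Metric.nhds_basis_closedBall.mem_iff.1 hV
  obtain ⟨c, hc0, hc⟩ := NormedField.exists_norm_lt ℚ_[p] hε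
  exact ⟨c, norm_pos_iff.1 hc0, fun d hd =>
    (Metric.closedBall_subset_closedBall (hd.trans hc.le)).trans h⟩

/-- The maps `y ↦ c y ^ N`, for finitely many `c ≠ 0`, cover a neighbourhood of `0`. -/
theorem exists_isCover_pow {N : ℕ} (hN : N ≠ 0) :
    ∃ (I : Type) (lam : I → ℚ_[p]), (∀ i, lam i ≠ 0) ∧
      IsCover (K := ℚ_[p]) (fun i (y : ℚ_[p]) => lam i * y ^ N) (fun _ y => y ^ (N - 1)) := by
  have hpK : (p : ℚ_[p]) ≠ 0 := by exact_mod_cast (Fact.out : p.Prime).ne_zero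
  obtain ⟨t, ht1, ht⟩ := exists_lintegral_sphere_le_sum_pow (p := p) hN
  obtain ⟨C, hC, hlow⟩ := exists_lintegral_sphere_pow_le (p := p) hN
  have hb0 : ∀ b ∈ t, b ≠ 0 := fun b hb => norm_ne_zero_iff.1 (by rw [ht1 b hb]; exact one_ne_zero)
  have hlam : ∀ i : t × Fin N, (i.1 : ℚ_[p]) * (p : ℚ_[p]) ^ (i.2 : ℕ) ≠ 0 := fun i =>
    mul_ne_zero (hb0 _ i.1.2) (pow_ne_zero _ hpK)
  refine ⟨t × Fin N, fun i => (i.1 : ℚ_[p]) * (p : ℚ_[p]) ^ (i.2 : ℕ), hlam, ?_⟩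
  have hNe : ∀ y : ℚ_[p], ‖y‖ₑ ^ (N - 1) * ‖y‖ₑ = ‖y‖ₑ ^ N := fun y => by
    rw [← pow_succ]; congr 1; omega
  -- the integral in a chart over a ball
  have hchart : ∀ (lam : ℚ_[p]) (c : ℚ_[p]), c ≠ 0 → ∀ h : ℚ_[p] → ℝ≥0∞, Measurable h →
      ∫⁻ y in Metric.closedBall 0 ‖c‖, h (lam * y ^ N) * ‖y ^ (N - 1)‖ₑ
        = ∑' i : ℕ, (∫⁻ z in Metric.sphere 0 1, h (lam * (c * (p : ℚ_[p]) ^ i) ^ N * z ^ N)) *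
          ‖(c * (p : ℚ_[p]) ^ i) ^ N‖ₑ := by
    intro lam c hc h hh
    rw [lintegral_closedBall_eq_tsum hc (by fun_prop)]
    refine tsum_congr fun i => ?_
    set d := c * (p : ℚ_[p]) ^ i
    have : ∫⁻ z in Metric.sphere (0 : ℚ_[p]) 1, h (lam * (d * z) ^ N) * ‖(d * z) ^ (N - 1)‖ₑ
        = ∫⁻ z in Metric.sphere 0 1, h (lam * d ^ N * z ^ N) * ‖d‖ₑ ^ (N - 1) := by
      refine setLIntegral_congr_fun Metric.isClosed_sphere.measurableSet fun z hz => ?_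
      have hz1 : ‖z‖ₑ = 1 := by
        rw [← ofReal_norm, mem_sphere_zero_iff_norm.1 hz, ENNReal.ofReal_one]
      simp only [mul_pow, enorm_mul, enorm_pow, hz1, one_pow, mul_one, mul_assoc]
    rw [this, lintegral_mul_const _ (by fun_prop), mul_assoc, hNe, enorm_pow]
  refine ⟨fun i => by fun_prop, fun i => by fun_prop, fun i => by simp [hN], fun _ => by fun_prop,
    fun _ => by fun_prop, fun A hA => ?_, fun i V hV => ?_⟩
  · obtain ⟨c, hc0, hc⟩ := exists_closedBall_subset (V := ⋂ i, A i)
      (Filter.iInter_mem.2 fun i => hA i)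
    have hcN : c ^ N ≠ 0 := pow_ne_zero _ hc0
    refine ⟨Finset.univ, Metric.closedBall 0 ‖c ^ N‖, 1,
      Metric.closedBall_mem_nhds _ (norm_pos_iff.2 hcN), ENNReal.one_ne_top, fun h hh => ?_⟩
    rw [one_mul, lintegral_closedBall_eq_tsum hcN hh]
    have hNz : NeZero N := ⟨hN⟩
    have hstep : ∀ i : ℕ, (∫⁻ x in Metric.sphere 0 1, h (c ^ N * (p : ℚ_[p]) ^ i * x)) *
          ‖c ^ N * (p : ℚ_[p]) ^ i‖ₑ
        ≤ ∑ b ∈ t, (∫⁻ z in Metric.sphere 0 1, h (c ^ N * (p : ℚ_[p]) ^ i * (b * z ^ N))) *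
          ‖c ^ N * (p : ℚ_[p]) ^ i‖ₑ := by
      intro i
      rw [← Finset.sum_mul]
      gcongr
      exact ht (fun x => h (c ^ N * (p : ℚ_[p]) ^ i * x)) (by fun_prop)
    refine (ENNReal.tsum_le_tsum hstep).trans ?_
    rw [← (Nat.divModEquiv N).symm.tsum_eq, ENNReal.tsum_prod', ENNReal.tsum_comm, tsum_fintype,
      Fintype.sum_prod_type_right]
    refine Finset.sum_le_sum fun l _ => ?_
    rw [Summable.tsum_finsetSum (fun _ _ => ENNReal.summable), ← Finset.sum_coe_sort]
    refine Finset.sum_le_sum fun b _ => ?_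
    have hsub : Metric.closedBall 0 ‖c‖ ⊆ A (b, l) :=
      (hc c le_rfl).trans (iInter_subset _ _)
    refine le_trans ?_ (lintegral_mono_set hsub)
    rw [hchart _ c hc0 h hh]
    refine ENNReal.tsum_le_tsum fun i => ?_
    have e : (Nat.divModEquiv N).symm (i, l) = i * N + l := rfl
    rw [e]
    refine mul_le_mul' (le_of_eq (lintegral_congr fun z => congrArg h ?_)) ?_
    · rw [pow_add, pow_mul, mul_pow]; ring
    · rw [pow_add, pow_mul, ← mul_assoc, ← mul_pow, enorm_mul]
      refine mul_le_of_le_one_right' ?_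
      rw [enorm_pow, ← ofReal_norm]
      exact pow_le_one' (ENNReal.ofReal_le_one.2 (norm_natCast_le_one p)) _
  · obtain ⟨c, hc0, hc⟩ := exists_closedBall_subset hV
    set lam := (i.1 : ℚ_[p]) * (p : ℚ_[p]) ^ (i.2 : ℕ) with hlam_def
    have hl0 : lam ≠ 0 := hlam i
    have hW : {y : ℚ_[p] | ‖lam * y ^ N‖ < ‖c‖} ∈ 𝓝 0 := by
      have : Continuous fun y : ℚ_[p] => ‖lam * y ^ N‖ := by fun_prop
      exact (isOpen_lt this continuous_const).mem_nhds (by simpa [hN] using hc0)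
    obtain ⟨d, hd0, hd⟩ := exists_closedBall_subset hW
    have hdc : ‖lam * d ^ N‖ < ‖c‖ := hd d le_rfl (by simp)
    have hldN : lam * d ^ N ≠ 0 := mul_ne_zero hl0 (pow_ne_zero _ hd0)
    refine ⟨Metric.closedBall 0 ‖d‖, C * ‖lam‖ₑ⁻¹,
      Metric.closedBall_mem_nhds _ (norm_pos_iff.2 hd0),
      ENNReal.mul_ne_top hC (ENNReal.inv_ne_top.2 (by simpa using hl0)), fun h hh => ?_⟩
    rw [hchart _ d hd0 h hh]
    calc _ ≤ ∑' i : ℕ, C * ((∫⁻ x in Metric.sphere 0 1,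
              h (lam * (d * (p : ℚ_[p]) ^ i) ^ N * x)) * ‖(d * (p : ℚ_[p]) ^ i) ^ N‖ₑ) := by
          refine ENNReal.tsum_le_tsum fun i => ?_
          rw [← mul_assoc]
          gcongr
          exact hlow (fun x => h (lam * (d * (p : ℚ_[p]) ^ i) ^ N * x)) (by fun_prop)
      _ = C * ‖lam‖ₑ⁻¹ * ∑' i : ℕ, (∫⁻ x in Metric.sphere 0 1,
            h (lam * d ^ N * (p : ℚ_[p]) ^ (N * i) * x)) * ‖lam * d ^ N * (p : ℚ_[p]) ^ (N * i)‖ₑ := by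
          rw [ENNReal.tsum_mul_left, mul_assoc, ← ENNReal.tsum_mul_left (a := ‖lam‖ₑ⁻¹)]
          congr 1
          refine tsum_congr fun i => ?_
          have e : lam * d ^ N * (p : ℚ_[p]) ^ (N * i) = lam * (d * (p : ℚ_[p]) ^ i) ^ N := by
            rw [mul_pow, ← pow_mul, mul_comm i N, mul_assoc]
          rw [e, enorm_mul lam, mul_left_comm, ← mul_assoc ‖lam‖ₑ⁻¹,
            ENNReal.inv_mul_cancel (by simpa using hl0) enorm_ne_top, one_mul]
      _ ≤ C * ‖lam‖ₑ⁻¹ * ∫⁻ x in Metric.closedBall 0 ‖lam * d ^ N‖, h x := by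
          rw [lintegral_closedBall_eq_tsum hldN hh]
          refine mul_le_mul_right ?_ _
          exact ENNReal.tsum_comp_le_tsum_of_injective (f := fun i => N * i)
            (mul_right_injective₀ hN) (fun i => (∫⁻ x in Metric.sphere 0 1,
            h (lam * d ^ N * (p : ℚ_[p]) ^ i * x)) * ‖lam * d ^ N * (p : ℚ_[p]) ^ i‖ₑ)
      _ ≤ _ := by
          gcongr
          exact hc _ hdc.le

end PowerCover

section BasicCovers

variable {K : Type*} [NontriviallyNormedField K] [ProperSpace K]
variable {E E' F : Type*}
  [NormedAddCommGroup E] [NormedSpace K E] [MeasureSpace E]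
  [NormedAddCommGroup E'] [NormedSpace K E'] [MeasureSpace E']
  [NormedAddCommGroup F] [NormedSpace K F] [MeasureSpace F]
  [MeasureSpace K] [BorelSpace K] [(volume : Measure K).IsAddHaarMeasure]

theorem IsCover.of_lintegral_eq [OpensMeasurableSpace E] {I : Type} {π : I → E' → E}
    {G : I → E' → K}
    (hπm : ∀ r, Measurable (π r)) (hπ : ∀ r, AnalyticAt K (π r) 0) (hπ0 : ∀ r, π r 0 = 0)
    (hGm : ∀ r, Measurable (G r)) (hG : ∀ r, AnalyticAt K (G r) 0)
    (h_int : ∀ r (h : E → ℝ≥0∞), Measurable h → ∫⁻ y, h (π r y) * ‖G r y‖ₑ = ∫⁻ x, h x)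
    (hcov : ∀ N : I → Set E', (∀ r, N r ∈ 𝓝 0) → ∃ (I0 : Finset I) (V : Set E) (A : I → Set E),
      V ∈ 𝓝 0 ∧ (∀ r, MeasurableSet (A r)) ∧ V ⊆ ⋃ r ∈ I0, A r ∧
      ∀ r ∈ I0, ∀ y, π r y ∈ A r → G r y ≠ 0 → y ∈ N r) : IsCover π G := by
  refine ⟨hπm, hπ, hπ0, hGm, hG, fun N hN => ?_, fun r V hV => ?_⟩
  · obtain ⟨I0, V, A, hV, hA, hVA, hAN⟩ := hcov N hN
    refine ⟨I0, V, 1, hV, ENNReal.one_ne_top, fun h hh => ?_⟩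
    rw [one_mul]
    refine (setLIntegral_le_sum_of_subset I0 A hVA h).trans (Finset.sum_le_sum fun r hr => ?_)
    rw [← lintegral_indicator (hA r), ← h_int r _ (hh.indicator (hA r))]
    refine le_trans ?_ (lintegral_indicator_le _ _)
    refine lintegral_mono fun y => ?_
    by_cases hy : y ∈ N r
    · rw [indicator_of_mem hy]
      exact mul_le_mul' (indicator_le_self _ _ _) le_rfl
    · by_cases hG0 : G r y = 0
      · simp [hG0]
      · have : π r y ∉ A r := fun h1 => hy (hAN r hr y h1 hG0)
        simp [indicator_of_notMem this]
  · obtain ⟨V', hV'V, hV'o, hV'0⟩ := mem_nhds_iff.1 hV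
    refine ⟨π r ⁻¹' V', 1, (hπ r).continuousAt.preimage_mem_nhds
      (by rw [hπ0]; exact hV'o.mem_nhds hV'0), ENNReal.one_ne_top, fun h hh => ?_⟩
    rw [one_mul]
    refine le_trans ?_ (lintegral_mono_set hV'V)
    rw [← lintegral_indicator hV'o.measurableSet, ← h_int r _ (hh.indicator hV'o.measurableSet),
      ← lintegral_indicator (hπm r hV'o.measurableSet)]
    refine lintegral_mono fun y => ?_
    by_cases hy : π r y ∈ V'
    · rw [indicator_of_mem (show y ∈ π r ⁻¹' V' from hy)]
      simp [hy]
    · rw [indicator_of_notMem (show y ∉ π r ⁻¹' V' from hy)]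
      exact zero_le

theorem setLIntegral_prod_eq {α β : Type*} [MeasureSpace α] [MeasureSpace β]
    [SFinite (volume : Measure α)] [SFinite (volume : Measure β)] (A : Set α) (V : Set β)
    {f : α × β → ℝ≥0∞} (hf : Measurable f) :
    ∫⁻ z in A ×ˢ V, f z = ∫⁻ t in A, ∫⁻ x in V, f (t, x) := by
  rw [Measure.volume_eq_prod, ← Measure.prod_restrict, lintegral_prod _ hf.aemeasurable]

theorem IsCover.lift [SFinite (volume : Measure E)] [SFinite (volume : Measure E')]
    [SFinite (volume : Measure F)] {I : Type} {π : I → E' → E} {G : I → E' → K}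
    (h : IsCover π G) :
    IsCover (fun r (z : F × E') => (z.1, π r z.2)) (fun r z => G r z.2) := by
  have hmeas := h.measurable_chart
  have hjac := h.measurable_jac
  refine ⟨fun r => by fun_prop, fun r => ?_, fun r => by simp [h.chart_zero], fun r => by fun_prop,
    fun r => ?_, fun N hN => ?_, fun r V hV => ?_⟩
  · exact analyticAt_fst.prod ((h.analyticAt_chart r).comp_of_eq analyticAt_snd rfl)
  · exact (h.analyticAt_jac r).comp_of_eq analyticAt_snd rfl
  · choose A hA N' hN' hAN using fun r => mem_nhds_prod_iff.1 (hN r)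
    obtain ⟨I0, V, C, hV, hC, hI⟩ := h.upper N' hN'
    refine ⟨I0, (⋂ r ∈ I0, A r) ×ˢ V, C, prod_mem_nhds ((Filter.biInter_finset_mem I0).2
      fun r _ => hA r) hV, hC, fun f hf => ?_⟩
    rw [setLIntegral_prod_eq _ _ hf]
    calc _ ≤ ∫⁻ t in ⋂ r ∈ I0, A r, C * ∑ r ∈ I0, ∫⁻ y in N' r, f (t, π r y) * ‖G r y‖ₑ :=
          lintegral_mono fun t => hI (fun x => f (t, x)) (by fun_prop)
      _ = C * ∑ r ∈ I0, ∫⁻ t in ⋂ r ∈ I0, A r, ∫⁻ y in N' r, f (t, π r y) * ‖G r y‖ₑ := by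
          have hm : ∀ r, Measurable fun t => ∫⁻ y in N' r, f (t, π r y) * ‖G r y‖ₑ := fun r =>
            Measurable.lintegral_prod_right' (f := fun z : F × E' => f (z.1, π r z.2) * ‖G r z.2‖ₑ)
              (by fun_prop)
          rw [lintegral_const_mul _ (Finset.measurable_fun_sum _ fun r _ => hm r),
            lintegral_finsetSum _ fun r _ => hm r]
      _ ≤ _ := by
          refine mul_le_mul_right (Finset.sum_le_sum fun r hr => ?_) _
          rw [← setLIntegral_prod_eq _ _ (f := fun z : F × E' => f (z.1, π r z.2) * ‖G r z.2‖ₑ) (by fun_prop)]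
          exact lintegral_mono_set
            ((prod_mono (biInter_subset_of_mem hr) subset_rfl).trans (hAN r))
  · obtain ⟨A, hA, V', hV', hAV⟩ := mem_nhds_prod_iff.1 hV
    obtain ⟨N, C, hN, hC, hI⟩ := h.lower r V' hV'
    refine ⟨A ×ˢ N, C, prod_mem_nhds hA hN, hC, fun f hf => ?_⟩
    rw [setLIntegral_prod_eq _ _ (f := fun z : F × E' => f (z.1, π r z.2) * ‖G r z.2‖ₑ) (by fun_prop)]
    calc _ ≤ ∫⁻ t in A, C * ∫⁻ x in V', f (t, x) :=
          lintegral_mono fun t => hI (fun x => f (t, x)) (by fun_prop)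
      _ = C * ∫⁻ t in A, ∫⁻ x in V', f (t, x) := lintegral_const_mul _ hf.lintegral_prod_right'
      _ = C * ∫⁻ z in A ×ˢ V', f z := by rw [setLIntegral_prod_eq _ _ hf]
      _ ≤ _ := mul_le_mul_right (lintegral_mono_set hAV) _

theorem isCover_id : IsCover (fun (_ : Unit) (x : E) => x) (fun _ _ => (1 : K)) := by
  refine ⟨fun _ => measurable_id, fun _ => analyticAt_id, fun _ => rfl, fun _ => measurable_const,
    fun _ => analyticAt_const, fun N hN => ⟨{()}, N (), 1, hN (), ENNReal.one_ne_top, ?_⟩,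
    fun _ V hV => ⟨V, 1, hV, ENNReal.one_ne_top, ?_⟩⟩ <;> simp

theorem IsCover.of_measurePreserving (e : E' ≃ᵐ E) (hmap : MeasurePreserving e)
    (he : AnalyticAt K e 0) (he0 : e 0 = 0) (hs : ContinuousAt e.symm 0) :
    IsCover (fun _ : Unit => (e : E' → E)) (fun _ _ => (1 : K)) := by
  have hs0 : e.symm 0 = 0 := by rw [← he0, e.symm_apply_apply]
  refine IsCover.of_measurableEquiv e 1 one_ne_zero ENNReal.one_ne_top ?_ he he0 hs
  rw [hmap.map_eq, one_smul]

theorem isCover_swap [BorelSpace E] [SFinite (volume : Measure E)] [BorelSpace F]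
    [SFinite (volume : Measure F)]:
    IsCover (fun (_ : Unit) (z : E × F) => (z.2, z.1)) (fun _ _ => (1 : K)) :=
by
  refine IsCover.of_measurePreserving (MeasurableEquiv.prodComm (α := E) (β := F))
    Measure.measurePreserving_swap (analyticAt_snd.prod analyticAt_fst) rfl ?_
  exact (continuous_swap (X := F) (Y := E)).continuousAt

theorem isCover_cons [SecondCountableTopology K] [SigmaFinite (volume : Measure K)]
    (n : ℕ) :
    IsCover (fun (_ : Unit) (x : Fin (n + 1) → K) => (x 0, fun k : Fin n => x k.succ))
      (fun _ _ => (1 : K)) := by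
  have := IsCover.of_measurePreserving (K := K)
    (MeasurableEquiv.piFinSuccAbove (fun _ : Fin (n + 1) => K) 0)
    (volume_preserving_piFinSuccAbove (fun _ : Fin (n + 1) => K) 0) ?_ ?_ ?_
  · exact this
  · change AnalyticAt K (fun (x : Fin (n + 1) → K) => (x 0, fun k : Fin n => x k.succ)) 0
    exact ((ContinuousLinearMap.proj (R := K) (φ := fun _ : Fin (n + 1) => K) 0).prod
      (ContinuousLinearMap.pi fun k : Fin n => ContinuousLinearMap.proj
        (R := K) (φ := fun _ : Fin (n + 1) => K) k.succ)).analyticAt 0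
  · rfl
  · change ContinuousAt (fun z : K × (Fin n → K) => Fin.insertNth (α := fun _ => K) 0 z.1 z.2) 0
    exact (Continuous.finInsertNth 0 continuous_fst continuous_snd).continuousAt

theorem isCover_cons_symm [SecondCountableTopology K]
    [SigmaFinite (volume : Measure K)] (n : ℕ) :
    IsCover (fun (_ : Unit) (z : K × (Fin n → K)) => (Fin.cons z.1 z.2 : Fin (n + 1) → K))
      (fun _ _ => (1 : K)) := by
  have := IsCover.of_measurePreserving (K := K)
    (MeasurableEquiv.piFinSuccAbove (fun _ : Fin (n + 1) => K) 0).symm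
    ((volume_preserving_piFinSuccAbove (fun _ : Fin (n + 1) => K) 0).symm _) ?_ ?_ ?_
  · convert this using 4 with _ z
    exact (Fin.insertNth_zero (α := fun _ => K) z.1 z.2).symm
  · change AnalyticAt K (fun z : K × (Fin n → K) => Fin.insertNth (α := fun _ => K) 0 z.1 z.2) 0
    refine AnalyticAt.pi fun i => ?_
    refine Fin.cases ?_ (fun k => ?_) i
    · exact analyticAt_fst
    · exact ((ContinuousLinearMap.proj (R := K) (φ := fun _ : Fin n => K) k).comp
        (ContinuousLinearMap.snd K K _)).analyticAt 0
  · ext i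
    refine Fin.cases rfl (fun k => rfl) i
  · change ContinuousAt (fun (x : Fin (n + 1) → K) => (x 0, fun k : Fin n => x k.succ)) 0
    fun_prop

end BasicCovers

section MoreCovers

variable {p : ℕ} [Fact p.Prime] [MeasureSpace ℚ_[p]] [BorelSpace ℚ_[p]]
  [(volume : Measure ℚ_[p]).IsAddHaarMeasure]

theorem lintegral_update_mul {n : ℕ} (k : Fin n) {c : ℚ_[p]} (hc : c ≠ 0)
    {h : (Fin n → ℚ_[p]) → ℝ≥0∞} (hh : Measurable h) :
    ∫⁻ x, h (Function.update x k (c * x k)) * ‖c‖ₑ = ∫⁻ x, h x := by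
  obtain _ | m := n
  · exact k.elim0
  have hup : Measurable fun x : Fin (m + 1) → ℚ_[p] => Function.update x k (c * x k) := by
    refine measurable_pi_lambda _ fun j => ?_
    by_cases hj : j = k
    · subst hj; simp only [Function.update_self]; fun_prop
    · simp only [Function.update_of_ne hj]; fun_prop
  have key : ∀ f : (Fin (m + 1) → ℚ_[p]) → ℝ≥0∞, Measurable f →
      ∫⁻ x, f x = ∫⁻ z : Fin m → ℚ_[p], ∫⁻ s : ℚ_[p], f (k.insertNth s z) := by
    intro f hf
    have h1 := ((volume_preserving_piFinSuccAbove (fun _ : Fin (m + 1) => ℚ_[p]) k).symm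
      _).lintegral_comp hf
    have hf' : Measurable fun z => f ((MeasurableEquiv.piFinSuccAbove
        (fun _ : Fin (m + 1) => ℚ_[p]) k).symm z) := hf.comp (MeasurableEquiv.measurable _)
    rw [← h1, Measure.volume_eq_prod, lintegral_prod_symm (μ := (volume : Measure ℚ_[p])) _
      hf'.aemeasurable]
    rfl
  rw [key _ (by fun_prop), key _ hh]
  refine lintegral_congr fun z => ?_
  have hins : Measurable fun s : ℚ_[p] => (k.insertNth s z : Fin (m + 1) → ℚ_[p]) :=
    (Continuous.finInsertNth k continuous_id continuous_const).measurable
  rw [← lintegral_mul_left hc (h := fun s => h (k.insertNth s z)) (hh.comp hins)]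
  refine lintegral_congr fun s => ?_
  simp only [Fin.insertNth_apply_same]
  congr 2
  ext j
  refine Fin.succAboveCases k ?_ (fun i => ?_) j
  · simp
  · simp [Fin.succAbove_ne]

/-- The charts of the blow-up of the locus `t = x k = 0`. -/
noncomputable def blowChart {n : ℕ} (k : Fin n) :
    Option ℚ_[p] → ℚ_[p] × (Fin n → ℚ_[p]) → ℚ_[p] × (Fin n → ℚ_[p])
  | some y, z => (z.2 k * (z.1 + y), z.2)
  | none, z => (z.1, Function.update z.2 k (z.1 * z.2 k))

/-- The Jacobians of the charts of the blow-up of the locus `t = x k = 0`. -/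
def blowJac {n : ℕ} (k : Fin n) : Option ℚ_[p] → ℚ_[p] × (Fin n → ℚ_[p]) → ℚ_[p]
  | some _, z => z.2 k
  | none, z => z.1

theorem analyticAt_coord_snd {n : ℕ} (k : Fin n) (z : ℚ_[p] × (Fin n → ℚ_[p])) :
    AnalyticAt ℚ_[p] (fun z : ℚ_[p] × (Fin n → ℚ_[p]) => z.2 k) z :=
  ((ContinuousLinearMap.proj (R := ℚ_[p]) (φ := fun _ : Fin n => ℚ_[p]) k).comp
    (ContinuousLinearMap.snd ℚ_[p] ℚ_[p] _)).analyticAt z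

theorem isCover_blow {n : ℕ} (k : Fin n) :
    IsCover (K := ℚ_[p]) (blowChart (p := p) k) (blowJac k) := by
  refine IsCover.of_lintegral_eq ?_ ?_ ?_ ?_ ?_ ?_ ?_
  · rintro (_ | y)
    · refine Measurable.prodMk measurable_fst (measurable_pi_lambda _ fun j => ?_)
      by_cases hj : j = k
      · subst hj; simp only [Function.update_self]; fun_prop
      · simp only [Function.update_of_ne hj]; fun_prop
    · unfold blowChart; fun_prop
  · rintro (_ | y)
    · refine analyticAt_fst.prod (AnalyticAt.pi fun j => ?_)
      by_cases hj : j = k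
      · subst hj; simp only [Function.update_self]
        exact analyticAt_fst.mul (analyticAt_coord_snd _ _)
      · simp only [Function.update_of_ne hj]
        exact analyticAt_coord_snd _ _
    · exact ((analyticAt_coord_snd _ _).mul (analyticAt_fst.add analyticAt_const)).prod
        analyticAt_snd
  · rintro (_ | y)
    · simp [blowChart]
    · simp [blowChart]
  · rintro (_ | y) <;> unfold blowJac <;> fun_prop
  · rintro (_ | y)
    · exact analyticAt_fst
    · exact analyticAt_coord_snd _ _
  · rintro (_ | y) h hh
    · have hm : Measurable fun z : ℚ_[p] × (Fin n → ℚ_[p]) =>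
          (z.1, Function.update z.2 k (z.1 * z.2 k)) := by
        refine Measurable.prodMk measurable_fst (measurable_pi_lambda _ fun j => ?_)
        by_cases hj : j = k
        · subst hj; simp only [Function.update_self]; fun_prop
        · simp only [Function.update_of_ne hj]; fun_prop
      simp only [blowChart, blowJac]
      rw [Measure.volume_eq_prod, lintegral_prod _ (by fun_prop), lintegral_prod _ (by fun_prop)]
      have hae : ∀ᵐ t : ℚ_[p], t ≠ 0 := by
        rw [ae_iff]; simp
      refine lintegral_congr_ae (hae.mono fun t ht => ?_)
      exact lintegral_update_mul k ht (h := fun x => h (t, x)) (by fun_prop)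
    · simp only [blowChart, blowJac]
      rw [Measure.volume_eq_prod, lintegral_prod_symm _ (by fun_prop),
        lintegral_prod_symm _ (by fun_prop)]
      have hae : ∀ᵐ x : Fin n → ℚ_[p], x k ≠ 0 := by
        rw [ae_iff]
        simp only [ne_eq, not_not]
        exact Measure.pi_hyperplane (fun _ : Fin n => (volume : Measure ℚ_[p])) k 0
      refine lintegral_congr_ae (hae.mono fun x hx => ?_)
      simp only
      rw [← lintegral_mul_left hx (h := fun t => h (t, x)) (by fun_prop)]
      exact lintegral_add_right_eq_self (fun t => h (x k * t, x) * ‖x k‖ₑ) y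
  · intro N hN
    choose ε hε hεN using fun r => Metric.nhds_basis_closedBall.mem_iff.1 (hN r)
    obtain ⟨T, -, hT⟩ := (isCompact_closedBall (0 : ℚ_[p]) (1 / ε none)).elim_nhds_subcover
      (fun y => Metric.closedBall y (ε (some y)))
      (fun y _ => Metric.closedBall_mem_nhds _ (hε _))
    classical
    let I0 : Finset (Option ℚ_[p]) := insert none (T.image some)
    let V : Set (ℚ_[p] × (Fin n → ℚ_[p])) := ⋂ r ∈ I0, Metric.closedBall 0 (ε r)
    have hVc : IsClosed V := isClosed_biInter fun r _ => Metric.isClosed_closedBall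
    have hV1 : ∀ r ∈ I0, ∀ z ∈ V, ‖z.1‖ ≤ ε r ∧ ‖z.2‖ ≤ ε r := by
      intro r hr z hz
      have := mem_iInter₂.1 hz r hr
      rwa [mem_closedBall_zero_iff, Prod.norm_def, max_le_iff] at this
    let S : Option ℚ_[p] → Set (ℚ_[p] × (Fin n → ℚ_[p])) := fun r => match r with
      | none => {z | ‖z.2 k‖ ≤ ε none * ‖z.1‖}
      | some y => {z | ‖z.1 - z.2 k * y‖ ≤ ε (some y) * ‖z.2 k‖}
    have hS : ∀ r, IsClosed (S r) := by
      rintro (_ | y)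
      · exact isClosed_le (by fun_prop) (by fun_prop)
      · exact isClosed_le (by fun_prop) (by fun_prop)
    refine ⟨I0, V, fun r => V ∩ S r, (Filter.biInter_finset_mem I0).2
      fun r _ => Metric.closedBall_mem_nhds _ (hε r), fun r => (hVc.inter (hS r)).measurableSet,
      fun z hz => ?_, fun r hr z hz hG => ?_⟩
    · simp only [mem_iUnion]
      by_cases h1 : ‖z.2 k‖ ≤ ε none * ‖z.1‖
      · exact ⟨none, by simp [I0], hz, h1⟩
      · rw [not_le] at h1
        have hx : 0 < ‖z.2 k‖ := lt_of_le_of_lt (mul_nonneg (hε _).le (norm_nonneg _)) h1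
        have hx0 := norm_pos_iff.1 hx
        have h2 : z.1 / z.2 k ∈ Metric.closedBall (0 : ℚ_[p]) (1 / ε none) := by
          rw [mem_closedBall_zero_iff, norm_div, div_le_div_iff₀ hx (hε _)]
          linarith
        obtain ⟨y, hy, hy1⟩ := mem_iUnion₂.1 (hT h2)
        refine ⟨some y, by simp [I0, hy], hz, ?_⟩
        rw [mem_closedBall_iff_norm] at hy1
        have : z.1 - z.2 k * y = (z.1 / z.2 k - y) * z.2 k := by
          rw [sub_mul, div_mul_cancel₀ _ hx0]; ring
        change ‖z.1 - z.2 k * y‖ ≤ _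
        rw [this, norm_mul]
        gcongr
    · refine hεN r ?_
      rw [mem_closedBall_zero_iff, Prod.norm_def, max_le_iff]
      have h1 := hV1 r hr _ hz.1
      have h2 := hz.2
      obtain _ | y := r
      · refine ⟨h1.1, (pi_norm_le_iff_of_nonneg (hε _).le).2 fun j => ?_⟩
        by_cases hj : j = k
        · subst hj
          have h3 : ‖Function.update z.2 j (z.1 * z.2 j) j‖ ≤ ε none * ‖z.1‖ := h2
          rw [Function.update_self, norm_mul, mul_comm] at h3
          exact le_of_mul_le_mul_right h3 (norm_pos_iff.2 hG)
        · have := (norm_le_pi_norm _ j).trans h1.2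
          simpa only [blowChart, Function.update_of_ne hj] using this
      · refine ⟨?_, h1.2⟩
        have h3 : ‖z.2 k * (z.1 + y) - z.2 k * y‖ ≤ ε (some y) * ‖z.2 k‖ := h2
        have h4 : z.2 k * (z.1 + y) - z.2 k * y = z.1 * z.2 k := by ring
        rw [h4, norm_mul] at h3
        exact le_of_mul_le_mul_right h3 (norm_pos_iff.2 hG)

theorem IsCover.of_linearEquiv {E E' : Type*}
    [NormedAddCommGroup E] [NormedSpace ℚ_[p] E] [MeasureSpace E] [BorelSpace E]
    [LocallyCompactSpace E] [SecondCountableTopology E] [(volume : Measure E).IsAddHaarMeasure]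
    [NormedAddCommGroup E'] [NormedSpace ℚ_[p] E'] [MeasureSpace E'] [BorelSpace E']
    [(volume : Measure E').IsAddHaarMeasure] (A : E' ≃L[ℚ_[p]] E) :
    IsCover (fun _ : Unit => (A : E' → E)) (fun _ _ => (1 : ℚ_[p])) := by
  have hae : (Measure.map A (volume : Measure E')).IsAddHaarMeasure := A.isAddHaarMeasure_map volume
  exact IsCover.of_measurableEquiv A.toHomeomorph.toMeasurableEquiv _
    (ENNReal.coe_ne_zero.2 (Measure.addHaarScalarFactor_pos_of_isAddHaarMeasure
      (Measure.map A (volume : Measure E')) (volume : Measure E)).ne') ENNReal.coe_ne_top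
    (Measure.isAddLeftInvariant_eq_smul (Measure.map A (volume : Measure E')) volume)
    ((A : E' →L[ℚ_[p]] E).analyticAt 0) (map_zero A) A.symm.continuous.continuousAt

theorem isCover_shear {E : Type*} [NormedAddCommGroup E] [NormedSpace ℚ_[p] E] [MeasureSpace E]
    [BorelSpace E] [SecondCountableTopology E]
    [SFinite (volume : Measure E)] {φ : E → ℚ_[p]} (hm : Measurable φ)
    (hφ : AnalyticAt ℚ_[p] φ 0) (hφ0 : φ 0 = 0) :
    IsCover (fun (_ : Unit) (z : ℚ_[p] × E) => (z.1 + φ z.2, z.2)) (fun _ _ => (1 : ℚ_[p])) := by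
  have hφ2 : AnalyticAt ℚ_[p] (fun z : ℚ_[p] × E => φ z.2) 0 := hφ.comp_of_eq analyticAt_snd rfl
  refine IsCover.of_lintegral_eq (fun _ => by fun_prop)
    (fun _ => (analyticAt_fst.add hφ2).prod analyticAt_snd) (fun _ => by simp [hφ0])
    (fun _ => measurable_const) (fun _ => analyticAt_const) (fun _ h hh => ?_) (fun N hN => ?_)
  · simp only [enorm_one, mul_one]
    rw [Measure.volume_eq_prod, lintegral_prod_symm _ (by fun_prop),
        lintegral_prod_symm _ (by fun_prop)]
    exact lintegral_congr fun x => lintegral_add_right_eq_self (fun t => h (t, x)) (φ x)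
  · obtain ⟨N', hN', hN'o, hN'0⟩ := mem_nhds_iff.1 (hN ())
    refine ⟨{()}, (fun z => (z.1 - φ z.2, z.2)) ⁻¹' N',
      fun _ => (fun z => (z.1 - φ z.2, z.2)) ⁻¹' N', ?_, fun _ => ?_,
      by simp [subset_def], fun r _ z hz _ => ?_⟩
    · refine ((analyticAt_fst.sub hφ2).prod analyticAt_snd).continuousAt.preimage_mem_nhds ?_
      have : ((0 : ℚ_[p] × E).1 - φ (0 : ℚ_[p] × E).2, (0 : ℚ_[p] × E).2) = 0 := by simp [hφ0]
      change N' ∈ 𝓝 ((0 : ℚ_[p] × E).1 - φ (0 : ℚ_[p] × E).2, (0 : ℚ_[p] × E).2)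
      rw [this]
      exact hN'o.mem_nhds hN'0
    · exact (show Measurable fun z : ℚ_[p] × E => (z.1 - φ z.2, z.2) by fun_prop) hN'o.measurableSet
    · simpa using hN' hz

end MoreCovers

theorem IsMon.comp_tail {K : Type*} [NontriviallyNormedField K] {n : ℕ} {f : (Fin n → K) → K}
    (hf : IsMon f) :
    IsMon fun x : Fin (n + 1) → K => f fun k => x k.succ := by
  obtain ⟨α, u, hu, hu0, he⟩ := hf
  have hL : AnalyticAt K (fun (x : Fin (n + 1) → K) (k : Fin n) => x k.succ) 0 :=
    (ContinuousLinearMap.pi fun k : Fin n => ContinuousLinearMap.proj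
        (R := K) (φ := fun _ : Fin (n + 1) => K) k.succ).analyticAt 0
  refine ⟨Fin.cons 0 α, fun x => u fun k => x k.succ, hu.comp_of_eq hL rfl, hu0, ?_⟩
  have ht : Tendsto (fun (x : Fin (n + 1) → K) (k : Fin n) => x k.succ) (𝓝 0) (𝓝 0) :=
    hL.continuousAt.tendsto
  filter_upwards [ht.eventually he] with x hx
  rw [hx, Fin.prod_univ_succ]
  simp

section LiftResolvable

variable {p : ℕ} [Fact p.Prime] [MeasureSpace ℚ_[p]] [BorelSpace ℚ_[p]]
  [(volume : Measure ℚ_[p]).IsAddHaarMeasure]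

theorem Resolvable.lift {E : Type*} [NormedAddCommGroup E] [NormedSpace ℚ_[p] E] [MeasureSpace E]
    [SFinite (volume : Measure E)] {n : ℕ} {X : Set (E → ℚ_[p])} (h : Resolvable n X) :
    Resolvable (E := ℚ_[p] × E) (n + 1)
      (insert Prod.fst ((fun (f : E → ℚ_[p]) z => f z.2) '' X)) := by
  obtain ⟨I, π, G, hc, hm⟩ := h
  refine ⟨_, _, _, (hc.lift (F := ℚ_[p])).comp fun _ => isCover_cons (K := ℚ_[p]) n,
    fun s => ⟨?_, ?_⟩⟩
  · exact (hm s.1).1.comp_tail.mul IsMon.one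
  · rintro f (rfl | ⟨f, hf, rfl⟩)
    · exact IsMon.coord 0
    · exact ((hm s.1).2 f hf).comp_tail

theorem exists_isCover_pow_pi {N : ℕ} (hN : N ≠ 0) (n : ℕ) :
    ∃ (I : Type) (lam : I → Fin n → ℚ_[p]) (G : I → (Fin n → ℚ_[p]) → ℚ_[p]),
      (∀ i k, lam i k ≠ 0) ∧ IsCover (fun i x k => lam i k * x k ^ N) G ∧ ∀ i, IsMon (G i) := by
  induction n with
  | zero =>
    refine ⟨Unit, fun _ _ => 1, fun _ _ => 1, fun _ k => k.elim0, ?_, fun _ => IsMon.one⟩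
    convert isCover_id (K := ℚ_[p]) (E := Fin 0 → ℚ_[p]) using 3
  | succ n ih =>
    obtain ⟨I, lam, G, hlam, hc, hG⟩ := ih
    obtain ⟨J, mu, hmu, hc'⟩ := exists_isCover_pow (p := p) hN
    have h := (((((isCover_cons_symm (K := ℚ_[p]) n).comp
      fun _ => isCover_swap (K := ℚ_[p]) (E := Fin n → ℚ_[p]) (F := ℚ_[p])).comp
      fun _ => hc'.lift (F := Fin n → ℚ_[p])).comp
      fun _ => isCover_swap (K := ℚ_[p]) (E := ℚ_[p]) (F := Fin n → ℚ_[p])).comp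
      fun _ => hc.lift (F := ℚ_[p])).comp fun _ => isCover_cons (K := ℚ_[p]) n
    refine ⟨Σ _ : (Σ _ : (Σ _ : (Σ _ : (Σ _ : Unit, Unit), J), Unit), I), Unit,
      fun s => Fin.cons (mu s.1.1.1.2) (lam s.1.2),
      fun s x => x 0 ^ (N - 1) * G s.1.2 fun k => x k.succ, fun s k => ?_, ?_, fun s => ?_⟩
    · exact Fin.cases (hmu _) (fun k => hlam _ k) k
    · convert h using 1
      · funext s x k
        exact Fin.cases rfl (fun k => rfl) k
      · funext s x
        simp
    · exact ((IsMon.coord 0).pow _).mul (hG _).comp_tail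

end LiftResolvable

section Expansion

variable {K : Type*} [NontriviallyNormedField K] [CompleteSpace K]
  {E : Type*} [NormedAddCommGroup E] [NormedSpace K E] [CompleteSpace E]

theorem analyticAt_slice {F : K × E → K} (hF : AnalyticAt K F 0) :
    AnalyticAt K (fun t => F (t, 0)) 0 :=
  hF.comp_of_eq (analyticAt_id.prod analyticAt_const) rfl

theorem analyticAt_restrict {F : K × E → K} (hF : AnalyticAt K F 0) :
    AnalyticAt K (fun x => F (0, x)) 0 :=
  hF.comp_of_eq (analyticAt_const.prod analyticAt_id) rfl

theorem tendsto_slice : Tendsto (fun t : K => ((t, 0) : K × E)) (𝓝 0) (𝓝 0) :=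
  (show Continuous fun t : K => ((t, 0) : K × E) by fun_prop).tendsto 0

theorem tendsto_restrict : Tendsto (fun x : E => ((0, x) : K × E)) (𝓝 0) (𝓝 0) :=
  (show Continuous fun x : E => ((0, x) : K × E) by fun_prop).tendsto 0

theorem exists_expansion_of_slice (k : ℕ) {F : K × E → K} (hF : AnalyticAt K F 0) {g : K → K}
    (hg : AnalyticAt K g 0) (hFg : ∀ᶠ t in 𝓝 0, F (t, 0) = t ^ k * g t) :
    ∃ (c : ℕ → E → K) (h : K × E → K), (∀ j, AnalyticAt K (c j) 0) ∧ (∀ j, c j 0 = 0) ∧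
      AnalyticAt K h 0 ∧ (h (0, 0) = g 0) ∧
      ∀ᶠ z in 𝓝 0, F z = ∑ j ∈ Finset.range k, c j z.2 * z.1 ^ j + z.1 ^ k * h z := by
  induction k generalizing F with
  | zero =>
    refine ⟨0, F, fun _ => analyticAt_const, fun _ => rfl, hF, ?_, by simp⟩
    simpa using hFg.self_of_nhds
  | succ k ih =>
    obtain ⟨F1, hF1, he⟩ := exists_eq_add_fst_mul hF
    have h0 : F (0, 0) = 0 := by simpa using hFg.self_of_nhds
    have h1 : ∀ᶠ t in 𝓝 0, F1 (t, 0) = t ^ k * g t := by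
      have h2 : ∀ᶠ t in 𝓝[≠] 0, F1 (t, 0) = t ^ k * g t := by
        filter_upwards [(tendsto_slice.eventually he).filter_mono nhdsWithin_le_nhds,
          hFg.filter_mono nhdsWithin_le_nhds, self_mem_nhdsWithin] with t ht ht' ht0
        simp only [h0, zero_add] at ht
        rw [ht', pow_succ', mul_assoc] at ht
        exact (mul_left_cancel₀ ht0 ht).symm
      have := (ContinuousAt.eventuallyEq_nhds_iff_eventuallyEq_nhdsNE
        (analyticAt_slice hF1).continuousAt
        ((analyticAt_id.pow k).mul hg).continuousAt).1 h2
      exact this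
    obtain ⟨c, h, hc, hc0, hh, hh0, hexp⟩ := ih hF1 h1
    refine ⟨fun j => Nat.casesOn j (fun x => F (0, x)) c, h, fun j => ?_, fun j => ?_, hh, hh0, ?_⟩
    · cases j
      · exact analyticAt_restrict hF
      · exact hc _
    · cases j
      · exact h0
      · exact hc0 _
    · filter_upwards [he, hexp] with z h2 h3
      rw [h2, h3, Finset.sum_range_succ', mul_add, Finset.mul_sum]
      simp only [pow_zero, mul_one]
      have : ∀ j, z.1 * (c j z.2 * z.1 ^ j) = c j z.2 * z.1 ^ (j + 1) := fun j => by ring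
      simp only [this]
      change _ = _ + F (0, z.2) + _
      ring

/-- The order of vanishing along the first axis. -/
noncomputable def ordT (F : K × E → K) : ℕ∞ := analyticOrderAt (fun t => F (t, 0)) 0

theorem ordT_eq_natCast {F : K × E → K} (hF : AnalyticAt K F 0) {k : ℕ} :
    ordT F = k ↔ ∃ g : K → K, AnalyticAt K g 0 ∧ g 0 ≠ 0 ∧ ∀ᶠ t in 𝓝 0, F (t, 0) = t ^ k * g t := by
  unfold ordT
  simpa using (analyticAt_slice hF).analyticOrderAt_eq_natCast (n := k)

theorem exists_expansion {k : ℕ} {F : K × E → K} (hF : AnalyticAt K F 0) (hk : ordT F = k) :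
    ∃ (c : ℕ → E → K) (h : K × E → K), (∀ j, AnalyticAt K (c j) 0) ∧ (∀ j, c j 0 = 0) ∧
      AnalyticAt K h 0 ∧ h 0 ≠ 0 ∧
      ∀ᶠ z in 𝓝 0, F z = ∑ j ∈ Finset.range k, c j z.2 * z.1 ^ j + z.1 ^ k * h z := by
  obtain ⟨g, hg, hg0, he⟩ := (ordT_eq_natCast hF).1 hk
  obtain ⟨c, h, hc, hc0, hh, hh0, hexp⟩ := exists_expansion_of_slice k hF hg he
  exact ⟨c, h, hc, hc0, hh, by rw [← Prod.mk_zero_zero, hh0]; exact hg0, hexp⟩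

/-- The partial derivative in the first variable. -/
noncomputable def derivT (F : K × E → K) : K × E → K := fun z => deriv (fun s => F (s, z.2)) z.1

theorem hasDerivAt_slice {F : K × E → K} {z : K × E} (hF : AnalyticAt K F z) :
    HasDerivAt (fun s => F (s, z.2)) (fderiv K F z (1, 0)) z.1 := by
  have h1 : HasFDerivAt F (fderiv K F z) ((fun s : K => (s, z.2)) z.1) :=
    hF.differentiableAt.hasFDerivAt
  exact h1.comp_hasDerivAt z.1 ((hasDerivAt_id z.1).prodMk (hasDerivAt_const z.1 z.2))

theorem derivT_eventuallyEq {F : K × E → K} {z : K × E} (hF : AnalyticAt K F z) :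
    derivT F =ᶠ[𝓝 z] fun w => fderiv K F w (1, 0) :=
  hF.eventually_analyticAt.mono fun _ hw => (hasDerivAt_slice hw).deriv

theorem analyticAt_derivT {F : K × E → K} {z : K × E} (hF : AnalyticAt K F z) :
    AnalyticAt K (derivT F) z := by
  refine AnalyticAt.congr ?_ (derivT_eventuallyEq hF).symm
  exact (((ContinuousLinearMap.apply K K ((1, 0) : K × E)).analyticAt _).fun_comp hF.fderiv)

theorem derivT_congr {F F' : K × E → K} {z : K × E} (h : F =ᶠ[𝓝 z] F') :
    derivT F =ᶠ[𝓝 z] derivT F' := by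
  filter_upwards [h.eventually_nhds] with w hw
  refine Filter.EventuallyEq.deriv_eq ?_
  have : Tendsto (fun s : K => (s, w.2)) (𝓝 w.1) (𝓝 w) :=
    (show Continuous fun s : K => (s, w.2) by fun_prop).tendsto w.1
  exact this.eventually hw

theorem analyticAt_iterate_derivT {F : K × E → K} {z : K × E} (hF : AnalyticAt K F z) (m : ℕ) :
    AnalyticAt K (derivT^[m] F) z := by
  induction m generalizing F with
  | zero => exact hF
  | succ m ih => exact ih (analyticAt_derivT hF)

theorem derivT_shift (F : K × E → K) (φ : E → K) :
    derivT (fun z => F (z.1 + φ z.2, z.2)) = fun z => derivT F (z.1 + φ z.2, z.2) := by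
  funext z
  exact deriv_comp_add_const (fun s => F (s, z.2)) (φ z.2) z.1

theorem iterate_derivT_shift (F : K × E → K) (φ : E → K) (m : ℕ) :
    derivT^[m] (fun z => F (z.1 + φ z.2, z.2)) = fun z => derivT^[m] F (z.1 + φ z.2, z.2) := by
  induction m generalizing F with
  | zero => rfl
  | succ m ih => rw [Function.iterate_succ_apply, derivT_shift, ih, ← Function.iterate_succ_apply]

theorem iterate_derivT_of_expansion (m : ℕ) {F : K × E → K} {c : ℕ → E → K} {h : K × E → K}
    (hh : AnalyticAt K h 0)
    (hexp : ∀ᶠ z in 𝓝 0, F z = ∑ j ∈ Finset.range m, c j z.2 * z.1 ^ j + z.1 ^ m * h z) :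
    ∀ᶠ x in 𝓝 0, derivT^[m] F (0, x) = m.factorial * h (0, x) := by
  induction m generalizing F c h with
  | zero =>
    refine (tendsto_restrict.eventually hexp).mono fun x hx => ?_
    simpa using hx
  | succ m ih =>
    have hh' : AnalyticAt K (fun z : K × E => ((m + 1 : ℕ) : K) * h z + z.1 * derivT h z) 0 :=
      (analyticAt_const.mul hh).add (analyticAt_fst.mul (analyticAt_derivT hh))
    have key : ∀ᶠ z in 𝓝 0, derivT F z = ∑ j ∈ Finset.range m,
        ((j + 1 : ℕ) * c (j + 1) z.2) * z.1 ^ j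
          + z.1 ^ m * (((m + 1 : ℕ) : K) * h z + z.1 * derivT h z) := by
      filter_upwards [derivT_congr hexp, hh.eventually_analyticAt] with z hz hhz
      rw [hz]
      have hd : HasDerivAt (fun s => h (s, z.2)) (derivT h z) z.1 := by
        have := hasDerivAt_slice hhz
        rwa [← this.deriv] at this
      have h1 : HasDerivAt (fun s => ∑ j ∈ Finset.range (m + 1), c j z.2 * s ^ j)
          (∑ j ∈ Finset.range (m + 1), c j z.2 * ((j : ℕ) * z.1 ^ (j - 1))) z.1 :=
        HasDerivAt.fun_sum fun j _ => (hasDerivAt_pow j z.1).const_mul _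
      have h2 := h1.add ((hasDerivAt_pow (m + 1) z.1).mul hd)
      refine h2.deriv.trans ?_
      rw [Finset.sum_range_succ']
      simp only [Nat.add_sub_cancel, Nat.cast_zero, zero_mul, mul_zero, add_zero]
      congr 1
      · refine Finset.sum_congr rfl fun j _ => by ring
      · ring
    refine (ih (c := fun j x => (j + 1 : ℕ) * c (j + 1) x) hh' key).mono fun x hx => ?_
    rw [Function.iterate_succ_apply, hx]
    simp only [zero_mul, add_zero, Nat.factorial_succ]
    push_cast; ring

/-- The implicit function theorem for an analytic germ. -/
theorem exists_analyticAt_implicit {g : K × E → K} (hg : AnalyticAt K g 0) (hg0 : g 0 = 0)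
    (hd : derivT g 0 ≠ 0) :
    ∃ φ : E → K, AnalyticAt K φ 0 ∧ φ 0 = 0 ∧ ∀ᶠ x in 𝓝 0, g (φ x, x) = 0 := by
  have hd' : fderiv K g 0 (1, 0) ≠ 0 := by
    rwa [(derivT_eventuallyEq hg).self_of_nhds] at hd
  set a := fderiv K g 0 (1, 0) with ha
  set L : E →L[K] K := (fderiv K g 0).comp (ContinuousLinearMap.inr K K E) with hL
  have hfd : ∀ w : K × E, fderiv K g 0 w = w.1 * a + L w.2 := by
    intro w
    have : w = w.1 • ((1, 0) : K × E) + (0, w.2) := by ext <;> simp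
    conv_lhs => rw [this, map_add, map_smul]
    simp [ha, hL]
  let i : (K × E) ≃L[K] K × E := ContinuousLinearEquiv.equivOfInverse
    ((fderiv K g 0).prod (ContinuousLinearMap.snd K K E))
    ((a⁻¹ • (ContinuousLinearMap.fst K K E - L.comp (ContinuousLinearMap.snd K K E))).prod
      (ContinuousLinearMap.snd K K E))
    (fun w => by
      ext
      · simp only [ContinuousLinearMap.prod_apply, ContinuousLinearMap.coe_snd', hfd,
          _root_.smul_apply, _root_.sub_apply,
          ContinuousLinearMap.coe_fst', ContinuousLinearMap.comp_apply, smul_eq_mul]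
        field_simp; ring
      · simp)
    (fun w => by
      ext
      · simp only [ContinuousLinearMap.prod_apply, ContinuousLinearMap.coe_snd', hfd,
          _root_.smul_apply, _root_.sub_apply,
          ContinuousLinearMap.coe_fst', ContinuousLinearMap.comp_apply, smul_eq_mul]
        field_simp; ring
      · simp)
  have hΨ : AnalyticAt K (fun z : K × E => (g z, z.2)) 0 := hg.prod analyticAt_snd
  have hfdΨ : HasStrictFDerivAt (fun z : K × E => (g z, z.2)) (i : K × E →L[K] K × E) 0 :=
    hg.hasStrictFDerivAt.prodMk hasStrictFDerivAt_snd
  set Φ := hfdΨ.toOpenPartialHomeomorph (fun z : K × E => (g z, z.2)) with hΦ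
  have hsrc : (0 : K × E) ∈ Φ.source := hfdΨ.mem_toOpenPartialHomeomorph_source
  have hΦ0 : Φ 0 = 0 := by
    change ((g 0, (0 : K × E).2) : K × E) = 0
    rw [hg0]; rfl
  have hsymm : AnalyticAt K Φ.symm 0 := by
    have := Φ.analyticAt_symm' hsrc hΨ hfdΨ.hasFDerivAt.fderiv
    rwa [hΦ0] at this
  have hsymm0 : Φ.symm 0 = 0 := by
    conv_lhs => rw [← hΦ0]
    exact Φ.left_inv hsrc
  have htgt : ∀ᶠ w in 𝓝 (0 : K × E), w ∈ Φ.target := by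
    refine Φ.open_target.mem_nhds ?_
    rw [← hΦ0]; exact Φ.map_source hsrc
  refine ⟨fun x => (Φ.symm (0, x)).1, ?_, ?_, ?_⟩
  · exact (analyticAt_fst (p := Φ.symm (0, 0))).comp_of_eq (hsymm.comp_of_eq
      (analyticAt_const.prod analyticAt_id) rfl) rfl
  · change (Φ.symm 0).1 = 0
    rw [hsymm0]; rfl
  · refine (tendsto_restrict.eventually htgt).mono fun x hx => ?_
    have h1 : (g (Φ.symm (0, x)), (Φ.symm (0, x)).2) = ((0, x) : K × E) := Φ.right_inv hx
    have h2 := (Prod.mk.inj h1)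
    have h3 : ((Φ.symm (0, x)).1, x) = Φ.symm (0, x) := Prod.ext rfl h2.2.symm
    rw [h3]; exact h2.1

/-- The Tschirnhausen transformation removes the coefficient of `t ^ (k - 1)`. -/
theorem exists_tschirnhausen [CharZero K] {k : ℕ} {F : K × E → K} (hF : AnalyticAt K F 0)
    (hk : ordT F = (k + 1 : ℕ)) :
    ∃ φ : E → K, AnalyticAt K φ 0 ∧ φ 0 = 0 ∧
      ∀ (c : ℕ → E → K) (h : K × E → K), AnalyticAt K (c k) 0 → AnalyticAt K h 0 →
        (∀ᶠ z in 𝓝 0, F (z.1 + φ z.2, z.2) =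
          ∑ j ∈ Finset.range (k + 1), c j z.2 * z.1 ^ j + z.1 ^ (k + 1) * h z) →
        c k =ᶠ[𝓝 0] 0 := by
  have split : ∀ {F : K × E → K} {c : ℕ → E → K} {h : K × E → K}, AnalyticAt K (c k) 0 →
      AnalyticAt K h 0 → (∀ᶠ z in 𝓝 0, F z =
        ∑ j ∈ Finset.range (k + 1), c j z.2 * z.1 ^ j + z.1 ^ (k + 1) * h z) →
      ∀ᶠ x in 𝓝 0, derivT^[k] F (0, x) = k.factorial * c k x := by
    intro F c h hc hh he
    have := iterate_derivT_of_expansion k (F := F) (c := c) (h := fun z => c k z.2 + z.1 * h z)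
      ((hc.comp_of_eq analyticAt_snd rfl).add (analyticAt_fst.mul hh))
      (he.mono fun z hz => by rw [hz, Finset.sum_range_succ]; ring)
    simpa using this
  obtain ⟨c, h, hc, hc0, hh, hh0, hexp⟩ := exists_expansion hF hk
  have h1 := (split (hc k) hh hexp).self_of_nhds
  have h2 := (iterate_derivT_of_expansion (k + 1) hh hexp).self_of_nhds
  rw [hc0, mul_zero] at h1
  rw [Function.iterate_succ_apply'] at h2
  obtain ⟨φ, hφ, hφ0, hφe⟩ := exists_analyticAt_implicit (analyticAt_iterate_derivT hF k) h1 (by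
    rw [← Prod.mk_zero_zero, h2]
    exact mul_ne_zero (by exact_mod_cast Nat.factorial_ne_zero _) hh0)
  refine ⟨φ, hφ, hφ0, fun c h hc hh he => ?_⟩
  filter_upwards [split hc hh he, hφe] with x hx hx'
  rw [iterate_derivT_shift] at hx
  simp only [zero_add] at hx
  rw [hx'] at hx
  have : (k.factorial : K) ≠ 0 := by exact_mod_cast Nat.factorial_ne_zero _
  simpa [this] using hx.symm

end Expansion

section Order

variable {K : Type*} [NontriviallyNormedField K] [CompleteSpace K]

/-- A nonzero Taylor coefficient bounds the order of vanishing. -/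
theorem exists_order_le_of_coeff_ne_zero {j : ℕ} {N : ℕ} (hjN : j < N) {f : K → K}
    (hf : AnalyticAt K f 0)
    {a : ℕ → K} {w : K → K} (hw : AnalyticAt K w 0) (ha : a j ≠ 0)
    (hfe : ∀ᶠ t in 𝓝 0, f t = ∑ i ∈ Finset.range N, a i * t ^ i + t ^ N * w t) :
    ∃ m : ℕ, m ≤ j ∧ analyticOrderAt f 0 = m := by
  induction j generalizing f a N with
  | zero =>
    refine ⟨0, le_rfl, ?_⟩
    rw [Nat.cast_zero, hf.analyticOrderAt_eq_zero, hfe.self_of_nhds]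
    obtain ⟨N, rfl⟩ := Nat.exists_eq_add_of_lt hjN
    rw [zero_add, Finset.sum_range_succ']
    simpa using ha
  | succ j ih =>
    obtain _ | N := N
    · omega
    by_cases h0 : a 0 = 0
    · set f1 : K → K := fun t => ∑ i ∈ Finset.range N, a (i + 1) * t ^ i + t ^ N * w t with hf1
      have hf1a : AnalyticAt K f1 0 := by
        refine AnalyticAt.add ?_ ((analyticAt_id.pow N).mul hw)
        exact Finset.analyticAt_fun_sum _ fun i _ => analyticAt_const.mul (analyticAt_id.pow i)
      obtain ⟨m, hm, hord⟩ := ih (N := N) (by omega) hf1a (a := fun i => a (i + 1)) ha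
        (Eventually.of_forall fun t => rfl)
      refine ⟨m + 1, by omega, ?_⟩
      have : f =ᶠ[𝓝 0] id * f1 := by
        filter_upwards [hfe] with t ht
        rw [ht, Finset.sum_range_succ', h0]
        simp only [Pi.mul_apply, id, hf1, mul_add, Finset.mul_sum]
        simp only [pow_succ, zero_mul, add_zero]
        congr 1
        · exact Finset.sum_congr rfl fun i _ => by ring
        · ring
      rw [analyticOrderAt_congr this, analyticOrderAt_mul analyticAt_id hf1a, hord,
        analyticOrderAt_id, add_comm]
      push_cast; rfl
    · refine ⟨0, by omega, ?_⟩
      rw [Nat.cast_zero, hf.analyticOrderAt_eq_zero, hfe.self_of_nhds]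
      rw [Finset.sum_range_succ']
      simpa using h0

theorem exists_order_le_of_leading {k : ℕ} {f : K → K} (hf : AnalyticAt K f 0)
    {a : ℕ → K} {v : K → K} (hv : AnalyticAt K v 0) (hv0 : v 0 ≠ 0)
    (hfe : ∀ᶠ t in 𝓝 0, f t = ∑ i ∈ Finset.range k, a i * t ^ i + t ^ k * v t) :
    ∃ m : ℕ, m ≤ k ∧ analyticOrderAt f 0 = m := by
  obtain ⟨w, hw, hvw⟩ : ∃ w : K → K, AnalyticAt K w 0 ∧ ∀ᶠ t in 𝓝 0, v t = v 0 + t * w t := by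
    obtain ⟨h, hh, he⟩ := exists_eq_add_fst_mul (f := fun z : K × K => v z.1)
      (hv.comp_of_eq analyticAt_fst rfl)
    exact ⟨fun t => h (t, 0), analyticAt_slice hh, tendsto_slice.eventually he⟩
  refine exists_order_le_of_coeff_ne_zero (N := k + 1) (Nat.lt_succ_self k) hf
    (a := fun i => if i = k then v 0 else a i) hw (by simpa using hv0) ?_
  filter_upwards [hfe, hvw] with t h1 h2
  have h3 : ∑ i ∈ Finset.range k, (if i = k then v 0 else a i) * t ^ i
      = ∑ i ∈ Finset.range k, a i * t ^ i :=
    Finset.sum_congr rfl fun i hi => by rw [if_neg (Finset.mem_range.1 hi).ne]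
  rw [h1, Finset.sum_range_succ, h3, if_pos rfl, h2]
  ring

/-- The order at a point of a polynomial of degree `k` is at most `k`, and it is smaller away
from the origin if the coefficient of degree `k - 1` vanishes. -/
theorem exists_order_shift_le [CharZero K] {k : ℕ} {f : K → K} (hf : AnalyticAt K f 0) {a : ℕ → K}
    {u y : K} (hu : u ≠ 0)
    (hfe : ∀ t, f t = ∑ i ∈ Finset.range k, a i * (t + y) ^ i + (t + y) ^ k * u) :
    ∃ m : ℕ, m ≤ k ∧ analyticOrderAt f 0 = m ∧
      (y ≠ 0 → 1 ≤ k → a (k - 1) = 0 → m < k) := by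
  open Polynomial in
  set Q : K[X] := ∑ i ∈ Finset.range k, C (a i) * (X + C y) ^ i + C u * (X + C y) ^ k with hQ
  have hcoeff : ∀ l, Q.coeff l = ∑ i ∈ Finset.range k, a i * (y ^ (i - l) * (i.choose l : K))
      + u * (y ^ (k - l) * (k.choose l : K)) := by
    intro l
    simp [hQ, Polynomial.coeff_X_add_C_pow]
  have hck : Q.coeff k = u := by
    rw [hcoeff, Finset.sum_eq_zero]
    · simp
    · intro i hi
      rw [Nat.choose_eq_zero_of_lt (Finset.mem_range.1 hi)]; simp
  have hdeg : Q.natDegree < k + 1 := by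
    rw [Nat.lt_succ_iff, Polynomial.natDegree_le_iff_coeff_eq_zero]
    intro l hl
    rw [hcoeff, Finset.sum_eq_zero, Nat.choose_eq_zero_of_lt hl]
    · simp
    · intro i hi
      rw [Nat.choose_eq_zero_of_lt ((Finset.mem_range.1 hi).trans hl)]; simp
  have hfQ : ∀ᶠ t in 𝓝 0, f t = ∑ i ∈ Finset.range (k + 1), Q.coeff i * t ^ i
      + t ^ (k + 1) * (0 : K → K) t := by
    refine Eventually.of_forall fun t => ?_
    rw [← Polynomial.eval_eq_sum_range' hdeg, hfe, hQ]
    simp [Polynomial.eval_finsetSum, mul_comm]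
  obtain ⟨m, hm, hord⟩ := exists_order_le_of_coeff_ne_zero (Nat.lt_succ_self k) hf
    (w := 0) analyticAt_const (by rwa [hck]) hfQ
  refine ⟨m, hm, hord, fun hy hk ha => ?_⟩
  have hc : Q.coeff (k - 1) ≠ 0 := by
    rw [hcoeff, Finset.sum_eq_zero]
    · have h1 : k - (k - 1) = 1 := by omega
      have h2 : k.choose (k - 1) = k := by
        rw [← Nat.choose_symm_of_eq_add (a := 1) (by omega), Nat.choose_one_right]
      rw [h1, h2, zero_add, pow_one]
      exact mul_ne_zero hu (mul_ne_zero hy (by exact_mod_cast (by omega : k ≠ 0)))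
    · intro i hi
      rcases (Nat.le_sub_one_of_lt (Finset.mem_range.1 hi)).lt_or_eq with h | h
      · rw [Nat.choose_eq_zero_of_lt h]; simp
      · rw [h, ha]; simp
  obtain ⟨m', hm', hord'⟩ := exists_order_le_of_coeff_ne_zero (by omega : k - 1 < k + 1) hf
    (w := 0) analyticAt_const hc hfQ
  rw [hord] at hord'
  have : m = m' := by exact_mod_cast hord'
  omega

end Order

section Chain

variable {p : ℕ} [Fact p.Prime]

theorem tendsto_padic_curve {n : ℕ} {m : Fin n → ℕ} (hm : ∀ k, 1 ≤ m k) :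
    Tendsto (fun (s : ℕ) (k : Fin n) => (p : ℚ_[p]) ^ (s * m k)) atTop (𝓝 0) := by
  rw [tendsto_pi_nhds]
  intro k
  have h1 : ‖(p : ℚ_[p])‖ < 1 := Padic.norm_p_lt_one
  refine (tendsto_pow_atTop_nhds_zero_of_norm_lt_one h1).comp ?_
  exact tendsto_id.atTop_mul_const' (by have := hm k; omega)

theorem eventually_norm_eq_of_ne_zero {E : Type*} [TopologicalSpace E] {u : E → ℚ_[p]} {x : E}
    (hu : ContinuousAt u x) (h0 : u x ≠ 0) : ∀ᶠ y in 𝓝 x, ‖u y‖ = ‖u x‖ := by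
  have := (hu.tendsto.eventually (Metric.ball_mem_nhds (u x) (norm_pos_iff.2 h0)))
  filter_upwards [this] with y hy
  rw [dist_eq_norm] at hy
  have : u y = (u y - u x) + u x := by ring
  rw [this, IsUltrametricDist.norm_add_eq_max_of_norm_ne_norm hy.ne, max_eq_right hy.le]

theorem eventually_norm_curve {n : ℕ} {f u : (Fin n → ℚ_[p]) → ℚ_[p]} {a : Fin n → ℕ}
    (hu : AnalyticAt ℚ_[p] u 0) (hu0 : u 0 ≠ 0)
    (hf : f =ᶠ[𝓝 0] fun x => (∏ k, x k ^ a k) * u x) {m : Fin n → ℕ} (hm : ∀ k, 1 ≤ m k) :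
    ∀ᶠ s : ℕ in atTop, ‖f fun k => (p : ℚ_[p]) ^ (s * m k)‖
      = ((p : ℝ)⁻¹ ^ (∑ k, a k * m k)) ^ s * ‖u 0‖ := by
  filter_upwards [(tendsto_padic_curve hm).eventually hf,
    (tendsto_padic_curve hm).eventually (eventually_norm_eq_of_ne_zero hu.continuousAt hu0)]
    with s h1 h2
  rw [h1, norm_mul, h2, norm_prod, ← pow_mul, Finset.sum_mul, ← Finset.prod_pow_eq_pow_sum]
  congr 1
  refine Finset.prod_congr rfl fun k _ => ?_
  rw [← pow_mul, norm_pow, Padic.norm_p]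
  congr 1; ring

theorem dot_eq_of_sub {n : ℕ} {f g u v w : (Fin n → ℚ_[p]) → ℚ_[p]} {a b c : Fin n → ℕ}
    (hu : AnalyticAt ℚ_[p] u 0) (hu0 : u 0 ≠ 0)
    (hf : f =ᶠ[𝓝 0] fun x => (∏ k, x k ^ a k) * u x)
    (hv : AnalyticAt ℚ_[p] v 0) (hv0 : v 0 ≠ 0)
    (hg : g =ᶠ[𝓝 0] fun x => (∏ k, x k ^ b k) * v x)
    (hw : AnalyticAt ℚ_[p] w 0)
    (hfg : f - g =ᶠ[𝓝 0] fun x => (∏ k, x k ^ c k) * w x)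
    {m : Fin n → ℕ} (hm : ∀ k, 1 ≤ m k) (hab : ∑ k, a k * m k < ∑ k, b k * m k) :
    ¬ f =ᶠ[𝓝 0] g ∧ (w 0 ≠ 0 → ∑ k, c k * m k = ∑ k, a k * m k) := by
  set q : ℝ := (p : ℝ)⁻¹ with hq
  have hp1 : (1 : ℝ) < p := by exact_mod_cast (Fact.out : p.Prime).one_lt
  have hq0 : 0 < q := by positivity
  have hq1 : q < 1 := inv_lt_one_of_one_lt₀ hp1
  set A := ∑ k, a k * m k
  set B := ∑ k, b k * m k
  set C := ∑ k, c k * m k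
  have hlim : Tendsto (fun s : ℕ => (q ^ (B - A)) ^ s * ‖v 0‖) atTop (𝓝 (0 * ‖v 0‖)) :=
    (tendsto_pow_atTop_nhds_zero_of_lt_one (by positivity)
      (pow_lt_one₀ hq0.le hq1 (by omega))).mul_const _
  rw [zero_mul] at hlim
  have hlt : ∀ᶠ s : ℕ in atTop, ‖g fun k => (p : ℚ_[p]) ^ (s * m k)‖
      < ‖f fun k => (p : ℚ_[p]) ^ (s * m k)‖ := by
    filter_upwards [eventually_norm_curve hu hu0 hf hm, eventually_norm_curve hv hv0 hg hm,
      hlim.eventually (gt_mem_nhds (norm_pos_iff.2 hu0))] with s h1 h2 h3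
    rw [h1, h2]
    have : q ^ B = q ^ A * q ^ (B - A) := by rw [← pow_add]; congr 1; omega
    change (q ^ B) ^ s * _ < (q ^ A) ^ s * _
    rw [this, mul_pow, mul_assoc]
    exact mul_lt_mul_of_pos_left h3 (by positivity)
  refine ⟨fun h => ?_, fun hw0 => ?_⟩
  · obtain ⟨s, h1, h2⟩ := (hlt.and ((tendsto_padic_curve hm).eventually h)).exists
    rw [h2] at h1
    exact lt_irrefl _ h1
  · have hev : ∀ᶠ s : ℕ in atTop, (q ^ A) ^ s * ‖u 0‖ = (q ^ C) ^ s * ‖w 0‖ := by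
      filter_upwards [eventually_norm_curve hu hu0 hf hm, eventually_norm_curve hw hw0 hfg hm, hlt]
        with s h1 h2 h3
      rw [← h1, ← h2, Pi.sub_apply, sub_eq_add_neg,
        IsUltrametricDist.norm_add_eq_max_of_norm_ne_norm (by rw [norm_neg]; exact h3.ne'),
        norm_neg, max_eq_left h3.le]
    obtain ⟨s, h1, h2⟩ := (hev.and ((tendsto_add_atTop_nat 1).eventually hev)).exists
    rw [pow_succ, mul_right_comm, h1, pow_succ, mul_right_comm _ _ ‖w 0‖] at h2
    have h3 : q ^ A = q ^ C := mul_left_cancel₀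
      (mul_ne_zero (by positivity) (norm_ne_zero_iff.2 hw0)) h2
    exact (pow_right_injective₀ hq0 hq1.ne h3).symm

theorem le_or_le_of_sub {n : ℕ} {f g u v : (Fin n → ℚ_[p]) → ℚ_[p]} {a b : Fin n → ℕ}
    (hu : AnalyticAt ℚ_[p] u 0) (hu0 : u 0 ≠ 0)
    (hf : f =ᶠ[𝓝 0] fun x => (∏ k, x k ^ a k) * u x)
    (hv : AnalyticAt ℚ_[p] v 0) (hv0 : v 0 ≠ 0)
    (hg : g =ᶠ[𝓝 0] fun x => (∏ k, x k ^ b k) * v x)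
    (hfg : f - g =ᶠ[𝓝 0] 0 ∨ IsMon (f - g)) : a ≤ b ∨ b ≤ a := by
  by_contra! hcon
  obtain ⟨h1, h2⟩ := hcon
  simp only [Pi.le_def, not_forall, not_le] at h1 h2
  obtain ⟨l, hl⟩ := h1
  obtain ⟨k, hk⟩ := h2
  have hkl : k ≠ l := by rintro rfl; omega
  let m : ℕ → ℕ → Fin n → ℕ := fun M M' i => 1 + M * (if i = k then 1 else 0)
    + M' * (if i = l then 1 else 0)
  have hm : ∀ M M' i, 1 ≤ m M M' i := fun M M' i => by simp only [m]; omega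
  have hdot : ∀ (d : Fin n → ℕ) M M', ∑ i, d i * m M M' i = ∑ i, d i + M * d k + M' * d l := by
    intro d M M'
    have : ∀ i, d i * m M M' i = d i + M * (if i = k then d i else 0)
        + M' * (if i = l then d i else 0) := by
      intro i; simp only [m]; split_ifs <;> ring
    simp only [this, Finset.sum_add_distrib, ← Finset.mul_sum]
    simp
  set A := ∑ i, a i
  set B := ∑ i, b i
  have hab : ∀ M', M' ≤ 1 → ∑ i, a i * m (A + a l + 1) M' i < ∑ i, b i * m (A + a l + 1) M' i := by
    intro M' hM'
    rw [hdot, hdot]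
    have e1 : (A + a l + 1) * (a k + 1) ≤ (A + a l + 1) * b k := Nat.mul_le_mul_left _ hk
    have e2 : M' * a l ≤ 1 * a l := Nat.mul_le_mul_right _ hM'
    rw [mul_add, mul_one] at e1
    change A + _ + _ < B + _ + _
    omega
  have hba : ∀ M', B + 1 ≤ M' → ∑ i, b i * m 0 M' i < ∑ i, a i * m 0 M' i := by
    intro M' hM'
    rw [hdot, hdot]
    have e1 : M' * (b l + 1) ≤ M' * a l := Nat.mul_le_mul_left _ hl
    rw [mul_add, mul_one] at e1
    change B + _ + _ < A + _ + _
    omega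
  rcases hfg with h | ⟨c, w, hw, hw0, hc⟩
  · refine (dot_eq_of_sub hu hu0 hf hv hv0 hg (c := 0) (w := 0) analyticAt_const ?_ (hm _ _)
      (hab 0 (by omega))).1 ?_
    · exact h.trans (Eventually.of_forall fun x => by simp)
    · filter_upwards [h] with x hx
      exact sub_eq_zero.1 hx
  · have hac := fun M' hM' => (dot_eq_of_sub hu hu0 hf hv hv0 hg hw hc (hm _ _) (hab M' hM')).2 hw0
    have hc' : g - f =ᶠ[𝓝 0] fun x => (∏ k, x k ^ c k) * (-w) x := by
      filter_upwards [hc] with x hx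
      simp only [Pi.sub_apply, Pi.neg_apply, mul_neg] at hx ⊢
      rw [← hx]; ring
    have hbc := fun M' hM' => (dot_eq_of_sub hv hv0 hg hu hu0 hf hw.neg hc' (hm _ _)
      (hba M' hM')).2 (by simpa using hw0)
    have e1 := hac 0 (by omega)
    have e2 := hac 1 (by omega)
    have e3 := hbc (B + 1) (by omega)
    have e4 := hbc (B + 2) (by omega)
    rw [hdot, hdot] at e1 e2 e3 e4
    have r1 : (B + 2) * c l = (B + 1) * c l + c l := by ring
    have r2 : (B + 2) * b l = (B + 1) * b l + b l := by ring
    rw [r1, r2] at e4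
    omega

end Chain

section Weights

variable {p : ℕ} [Fact p.Prime] [MeasureSpace ℚ_[p]] [BorelSpace ℚ_[p]]
  [(volume : Measure ℚ_[p]).IsAddHaarMeasure]

theorem prod_pow_eq_mul_of_pos {n : ℕ} {β : Fin n → ℕ} {k : Fin n} (hk : β k ≠ 0)
    (x : Fin n → ℚ_[p]) :
    ∏ l, x l ^ β l = x k * ∏ l, x l ^ (Function.update β k (β k - 1)) l := by
  rw [← Finset.mul_prod_erase _ _ (Finset.mem_univ k),
    ← Finset.mul_prod_erase _ (fun l => x l ^ (Function.update β k (β k - 1)) l)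
      (Finset.mem_univ k), ← mul_assoc, Function.update_self, ← pow_succ',
    Nat.sub_add_cancel (Nat.one_le_iff_ne_zero.2 hk)]
  congr 1
  exact Finset.prod_congr rfl fun l hl => by
    rw [Function.update_of_ne (Finset.ne_of_mem_erase hl)]

theorem prod_update_pow {n : ℕ} {β : Fin n → ℕ} (k : Fin n) (x : Fin n → ℚ_[p]) (t : ℚ_[p]) :
    ∏ l, (Function.update x k (t * x k)) l ^ β l = t ^ β k * ∏ l, x l ^ β l := by
  rw [← Finset.mul_prod_erase _ _ (Finset.mem_univ k),
    ← Finset.mul_prod_erase _ (fun l => x l ^ β l) (Finset.mem_univ k), ← mul_assoc,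
    Function.update_self, mul_pow]
  congr 1
  exact Finset.prod_congr rfl fun l hl => by
    rw [Function.update_of_ne (Finset.ne_of_mem_erase hl)]

theorem analyticAt_monomial {n : ℕ} (β : Fin n → ℕ) (z : ℚ_[p] × (Fin n → ℚ_[p])) :
    AnalyticAt ℚ_[p] (fun z : ℚ_[p] × (Fin n → ℚ_[p]) => ∏ l, z.2 l ^ β l) z :=
  Finset.analyticAt_fun_prod _ fun l _ => (analyticAt_coord_snd l z).pow _

/-- Blowing up lowers the weights of a family of weighted polynomials until the total order
of the family drops. -/
theorem resolvable_of_weights {n : ℕ} {ι : Type} [Fintype ι] {k : ι → ℕ}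
    (ih : ∀ (T : ι → ℚ_[p] × (Fin n → ℚ_[p]) → ℚ_[p]) (k' : ι → ℕ),
      (∀ i, AnalyticAt ℚ_[p] (T i) 0) → (∀ i, ordT (T i) = k' i) → ∑ i, k' i < ∑ i, k i →
      Resolvable (n + 1)
        ((range fun (l : Fin n) (z : ℚ_[p] × (Fin n → ℚ_[p])) => z.2 l) ∪ range T))
    {i₀ i₁ : ι} {j₀ : ℕ} (hj₀ : j₀ < k i₀) (hi₁ : 1 ≤ k i₁) (d : ℕ) {β : Fin n → ℕ}
    (hβ : ∑ l, β l = d) {e : ι → ℕ → (Fin n → ℚ_[p]) → ℚ_[p]}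
    {u : ι → ℚ_[p] × (Fin n → ℚ_[p]) → ℚ_[p]}
    (he : ∀ i j, AnalyticAt ℚ_[p] (e i j) 0) (hu : ∀ i, AnalyticAt ℚ_[p] (u i) 0)
    (hu0 : ∀ i, u i 0 ≠ 0) (he0 : e i₀ j₀ 0 ≠ 0) (he1 : e i₁ (k i₁ - 1) 0 = 0) :
    Resolvable (n + 1)
      ((range fun (l : Fin n) (z : ℚ_[p] × (Fin n → ℚ_[p])) => z.2 l) ∪
        range fun i z => ∑ j ∈ Finset.range (k i),
          (∏ l, z.2 l ^ β l) ^ (k i - j) * e i j z.2 * z.1 ^ j + z.1 ^ k i * u i z) := by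
  have hle : ∀ (m : ι → ℕ) (i' : ι), (∀ i, m i ≤ k i) → m i' < k i' → ∑ i, m i < ∑ i, k i :=
    fun m i' h1 h2 => Finset.sum_lt_sum (fun i _ => h1 i) ⟨i', Finset.mem_univ _, h2⟩
  have he' : ∀ i j (z : ℚ_[p] × (Fin n → ℚ_[p])), z.2 = 0 →
      AnalyticAt ℚ_[p] (fun z : ℚ_[p] × (Fin n → ℚ_[p]) => e i j z.2) z :=
    fun i j z hz => (he i j).comp_of_eq analyticAt_snd hz
  induction d generalizing β u with
  | zero =>
    have hβ0 : ∀ l, β l = 0 := fun l => by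
      rw [Finset.sum_eq_zero_iff] at hβ; exact hβ l (Finset.mem_univ _)
    have hT : ∀ i, AnalyticAt ℚ_[p] (fun z : ℚ_[p] × (Fin n → ℚ_[p]) =>
        ∑ j ∈ Finset.range (k i),
          (∏ l, z.2 l ^ β l) ^ (k i - j) * e i j z.2 * z.1 ^ j + z.1 ^ k i * u i z) 0 := fun i =>
      (Finset.analyticAt_fun_sum _ fun j _ => (((analyticAt_monomial β 0).pow _).mul
        (he' i j 0 rfl)).mul (analyticAt_fst.pow j)).add ((analyticAt_fst.pow _).mul (hu i))
    have hord : ∀ i, ∃ m : ℕ, m ≤ k i ∧ (i = i₀ → m < k i) ∧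
        ordT (fun z : ℚ_[p] × (Fin n → ℚ_[p]) => ∑ j ∈ Finset.range (k i),
          (∏ l, z.2 l ^ β l) ^ (k i - j) * e i j z.2 * z.1 ^ j + z.1 ^ k i * u i z) = m := by
      intro i
      have hfe : ∀ᶠ t : ℚ_[p] in 𝓝 0, (fun t => ∑ j ∈ Finset.range (k i),
          (∏ l, (0 : Fin n → ℚ_[p]) l ^ β l) ^ (k i - j) * e i j 0 * t ^ j
            + t ^ k i * u i (t, 0)) t
          = ∑ j ∈ Finset.range (k i), e i j 0 * t ^ j + t ^ k i * u i (t, 0) :=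
        Eventually.of_forall fun t => by simp [hβ0]
      by_cases hi : i = i₀
      · subst hi
        obtain ⟨m, hm, ho⟩ := exists_order_le_of_coeff_ne_zero (a := fun j => e i j 0) hj₀
          (analyticAt_slice (hT i)) (analyticAt_slice (hu i)) he0 hfe
        exact ⟨m, by omega, fun _ => by omega, ho⟩
      · obtain ⟨m, hm, ho⟩ := exists_order_le_of_leading (a := fun j => e i j 0)
          (analyticAt_slice (hT i)) (analyticAt_slice (hu i)) (hu0 i) hfe
        exact ⟨m, hm, fun h => absurd h hi, ho⟩
    choose m hm hm0 hmo using hord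
    exact ih _ m hT hmo (hle m i₀ hm (hm0 i₀ rfl))
  | succ d IH =>
    obtain ⟨κ, hκ⟩ : ∃ κ, β κ ≠ 0 := by
      by_contra! h
      simp [h] at hβ
    set β' := Function.update β κ (β κ - 1) with hβ'
    have hβd : ∑ l, β' l = d := by
      rw [← Finset.add_sum_erase _ _ (Finset.mem_univ κ)] at hβ ⊢
      have h1 : ∑ l ∈ Finset.univ.erase κ, β' l = ∑ l ∈ Finset.univ.erase κ, β l :=
        Finset.sum_congr rfl fun l hl => by
          rw [hβ', Function.update_of_ne (Finset.ne_of_mem_erase hl)]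
      rw [h1, hβ', Function.update_self]
      omega
    refine Resolvable.of_cover (isCover_blow κ) fun r => ?_
    cases r with
    | none =>
      set w : ℚ_[p] × (Fin n → ℚ_[p]) → ℚ_[p] := fun z => z.1 ^ (β κ - 1) * ∏ l, z.2 l ^ β l
        with hw
      have hwa : AnalyticAt ℚ_[p] w 0 := (analyticAt_fst.pow _).mul (analyticAt_monomial β 0)
      have hw0 : w 0 = 0 := by
        simp only [hw]
        rw [Finset.prod_eq_zero (Finset.mem_univ κ) (by simp [hκ]), mul_zero]
      have hχ : AnalyticAt ℚ_[p] (blowChart (p := p) κ none) 0 :=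
        (isCover_blow κ).analyticAt_chart none
      have hχ0 : blowChart (p := p) κ none 0 = 0 := (isCover_blow κ).chart_zero none
      have hlift := (show Resolvable n (range fun (l : Fin n) (x : Fin n → ℚ_[p]) => x l) from
        ⟨Unit, _, _, isCover_id, fun _ => ⟨IsMon.one, by rintro _ ⟨l, rfl⟩; exact IsMon.coord l⟩⟩).lift
      refine hlift.of_closure ?_
      have ht := Submonoid.subset_closure (mem_insert (Prod.fst : ℚ_[p] × (Fin n → ℚ_[p]) → ℚ_[p])
        ((fun (f : (Fin n → ℚ_[p]) → ℚ_[p]) (z : ℚ_[p] × (Fin n → ℚ_[p])) => f z.2) ''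
          range fun l x => x l))
      have hx : ∀ l : Fin n, (fun z : ℚ_[p] × (Fin n → ℚ_[p]) => z.2 l) ∈ Submonoid.closure
          (insert (Prod.fst : ℚ_[p] × (Fin n → ℚ_[p]) → ℚ_[p])
        ((fun (f : (Fin n → ℚ_[p]) → ℚ_[p]) (z : ℚ_[p] × (Fin n → ℚ_[p])) => f z.2) ''
          range fun l x => x l)) := fun l =>
        Submonoid.subset_closure (mem_insert_of_mem _ ⟨_, ⟨l, rfl⟩, rfl⟩)
      rintro f (rfl | ⟨g, (⟨l, rfl⟩ | ⟨i, rfl⟩), rfl⟩)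
      · exact ⟨_, ht, 1, analyticAt_const, one_ne_zero, Eventually.of_forall fun z => by
          simp [blowJac]⟩
      · by_cases hl : l = κ
        · subst hl
          exact ⟨_, mul_mem ht (hx l), 1, analyticAt_const, one_ne_zero,
            Eventually.of_forall fun z => by simp [blowChart]⟩
        · exact ⟨_, hx l, 1, analyticAt_const, one_ne_zero,
            Eventually.of_forall fun z => by simp [blowChart, Function.update_of_ne hl]⟩
      · refine ⟨_, pow_mem ht (k i), fun z => ∑ j ∈ Finset.range (k i),
          w z ^ (k i - j) * e i j (blowChart κ none z).2 + u i (blowChart κ none z), ?_, ?_, ?_⟩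
        · refine (Finset.analyticAt_fun_sum _ fun j _ => (hwa.pow _).mul ?_).add
            ((hu i).comp_of_eq hχ hχ0)
          exact (he i j).comp_of_eq (analyticAt_snd.comp hχ) (by simp [hχ0])
        · beta_reduce
          rw [Finset.sum_eq_zero, zero_add, hχ0]
          · exact hu0 i
          · intro j hj
            rw [hw0, zero_pow (by have := Finset.mem_range.1 hj; omega), zero_mul]
        · refine Eventually.of_forall fun z => ?_
          have hprod : ∏ l, (blowChart κ none z).2 l ^ β l = z.1 * w z := by
            simp only [blowChart, hw]
            rw [prod_update_pow, ← mul_assoc, ← pow_succ',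
              Nat.sub_add_cancel (Nat.one_le_iff_ne_zero.2 hκ)]
          have h1 : (blowChart κ none z).1 = z.1 := rfl
          simp only [hprod, h1, Pi.pow_apply, mul_add, Finset.mul_sum]
          congr 1
          refine Finset.sum_congr rfl fun j hj => ?_
          have := Finset.mem_range.1 hj
          have h2 : z.1 ^ k i = z.1 ^ (k i - j) * z.1 ^ j := by
            rw [← pow_add]; congr 1; omega
          rw [h2]; ring
    | some y =>
      have hχ : AnalyticAt ℚ_[p] (blowChart (p := p) κ (some y)) 0 :=
        (isCover_blow κ).analyticAt_chart _
      have hχ0 : blowChart (p := p) κ (some y) 0 = 0 := (isCover_blow κ).chart_zero _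
      set u' : ι → ℚ_[p] × (Fin n → ℚ_[p]) → ℚ_[p] := fun i z => u i (blowChart κ (some y) z)
        with hu'
      have hu'a : ∀ i, AnalyticAt ℚ_[p] (u' i) 0 := fun i => (hu i).comp_of_eq hχ hχ0
      have hu'0 : ∀ i, u' i 0 ≠ 0 := fun i => by simp only [hu', hχ0]; exact hu0 i
      set T' : ι → ℚ_[p] × (Fin n → ℚ_[p]) → ℚ_[p] := fun i z => ∑ j ∈ Finset.range (k i),
          (∏ l, z.2 l ^ β' l) ^ (k i - j) * e i j z.2 * (z.1 + y) ^ j + (z.1 + y) ^ k i * u' i z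
        with hT'
      have hT'a : ∀ i, AnalyticAt ℚ_[p] (T' i) 0 := fun i =>
        (Finset.analyticAt_fun_sum _ fun j _ => (((analyticAt_monomial β' 0).pow _).mul
          (he' i j 0 rfl)).mul ((analyticAt_fst.add analyticAt_const).pow j)).add
          (((analyticAt_fst.add analyticAt_const).pow _).mul (hu'a i))
      have hres : Resolvable (n + 1)
          ((range fun (l : Fin n) (z : ℚ_[p] × (Fin n → ℚ_[p])) => z.2 l) ∪ range T') := by
        by_cases hy : y = 0
        · have := IH hβd hu'a hu'0
          simpa only [hT', hy, add_zero] using this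
        · have hord : ∀ i, ∃ m : ℕ, m ≤ k i ∧ ordT (T' i) = m ∧
              (y ≠ 0 → 1 ≤ k i →
                (∏ l, (0 : Fin n → ℚ_[p]) l ^ β' l) ^ (k i - (k i - 1)) * e i (k i - 1) 0 = 0
                → m < k i) := by
            intro i
            refine exists_order_shift_le (a := fun j =>
              (∏ l, (0 : Fin n → ℚ_[p]) l ^ β' l) ^ (k i - j) * e i j 0)
              (analyticAt_slice (hT'a i)) (hu0 i) fun t => ?_
            simp only [hT', hu']
            congr 3
            simp [blowChart]
          choose m hm hmo hm1 using hord
          exact ih T' m hT'a hmo (hle m i₁ hm (hm1 i₁ hy hi₁ (by rw [he1, mul_zero])))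
      refine hres.of_closure ?_
      have hx : ∀ l : Fin n, (fun z : ℚ_[p] × (Fin n → ℚ_[p]) => z.2 l) ∈ Submonoid.closure
          ((range fun (l : Fin n) (z : ℚ_[p] × (Fin n → ℚ_[p])) => z.2 l) ∪ range T') := fun l =>
        Submonoid.subset_closure (Or.inl ⟨l, rfl⟩)
      rintro f (rfl | ⟨g, (⟨l, rfl⟩ | ⟨i, rfl⟩), rfl⟩)
      · exact ⟨_, hx κ, 1, analyticAt_const, one_ne_zero, Eventually.of_forall fun z => by
          simp [blowJac]⟩
      · exact ⟨_, hx l, 1, analyticAt_const, one_ne_zero,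
            Eventually.of_forall fun z => by simp [blowChart]⟩
      · refine ⟨_, mul_mem (pow_mem (hx κ) (k i)) (Submonoid.subset_closure (Or.inr ⟨i, rfl⟩)), 1,
          analyticAt_const, one_ne_zero, Eventually.of_forall fun z => ?_⟩
        have h1 : (blowChart κ (some y) z).1 = z.2 κ * (z.1 + y) := rfl
        have h2 : (blowChart κ (some y) z).2 = z.2 := rfl
        simp only [h1, h2, Pi.mul_apply, Pi.pow_apply, Pi.one_apply, mul_one, hT', hu']
        rw [mul_add (z.2 κ ^ k i), Finset.mul_sum]
        congr 1
        · refine Finset.sum_congr rfl fun j hj => ?_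
          have := Finset.mem_range.1 hj
          have h3 : z.2 κ ^ k i = z.2 κ ^ (k i - j) * z.2 κ ^ j := by
            rw [← pow_add]; congr 1; omega
          rw [h3, prod_pow_eq_mul_of_pos hκ, mul_pow, mul_pow]; ring
        · rw [mul_pow]; ring

end Weights

section Reduction

variable {p : ℕ} [Fact p.Prime]

theorem IsMon.not_eventuallyEq_zero {n : ℕ} {f : (Fin n → ℚ_[p]) → ℚ_[p]} (hf : IsMon f) :
    ¬ f =ᶠ[𝓝 0] 0 := by
  obtain ⟨a, u, hu, hu0, he⟩ := hf
  intro h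
  obtain ⟨s, h1, h2⟩ := ((eventually_norm_curve hu hu0 he (m := fun _ => 1) fun _ => le_rfl).and
    ((tendsto_padic_curve (m := fun _ => 1) fun _ => le_rfl).eventually h)).exists
  rw [h2, Pi.zero_apply, norm_zero] at h1
  have hp : (0 : ℝ) < p := by exact_mod_cast (Fact.out : p.Prime).pos
  have : 0 < ((p : ℝ)⁻¹ ^ (∑ k, a k * 1)) ^ s * ‖u 0‖ :=
    mul_pos (by positivity) (norm_pos_iff.2 hu0)
  exact absurd h1 this.ne

theorem IsMon.exists_closure_mul {n : ℕ} {f : (Fin n → ℚ_[p]) → ℚ_[p]} (hf : IsMon f)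
    {S : Set (ℚ_[p] × (Fin n → ℚ_[p]) → ℚ_[p])} (hS : ∀ l : Fin n, (fun z => z.2 l) ∈ S) :
    ∃ g ∈ Submonoid.closure S, ∃ u : ℚ_[p] × (Fin n → ℚ_[p]) → ℚ_[p],
      AnalyticAt ℚ_[p] u 0 ∧ u 0 ≠ 0 ∧ (fun z => f z.2) =ᶠ[𝓝 0] fun z => g z * u z := by
  obtain ⟨a, u, hu, hu0, he⟩ := hf
  refine ⟨∏ l, (fun z : ℚ_[p] × (Fin n → ℚ_[p]) => z.2 l) ^ a l,
    prod_mem fun l _ => pow_mem (Submonoid.subset_closure (hS l)) _, fun z => u z.2,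
    hu.comp_of_eq analyticAt_snd rfl, hu0, ?_⟩
  have ht : Tendsto (Prod.snd : ℚ_[p] × (Fin n → ℚ_[p]) → _) (𝓝 0) (𝓝 0) :=
    continuous_snd.tendsto 0
  filter_upwards [ht.eventually he] with z hz
  rw [hz, Finset.prod_apply]
  rfl

theorem exists_measurable_eventuallyEq {E : Type*} [NormedAddCommGroup E] [NormedSpace ℚ_[p] E]
    [MeasurableSpace E] [BorelSpace E] [MeasurableSpace ℚ_[p]] [BorelSpace ℚ_[p]] {φ : E → ℚ_[p]}
    {x : E} (hφ : AnalyticAt ℚ_[p] φ x) : ∃ ψ : E → ℚ_[p], Measurable ψ ∧ ψ =ᶠ[𝓝 x] φ := by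
  classical
  obtain ⟨V, hV, hVo, hxV⟩ := eventually_nhds_iff.1 hφ.eventually_analyticAt
  refine ⟨V.piecewise φ 0, ?_, ?_⟩
  · exact ContinuousOn.measurable_piecewise
      (fun y hy => (hV y hy).continuousAt.continuousWithinAt) continuousOn_const hVo.measurableSet
  · filter_upwards [hVo.mem_nhds hxV] with y hy
    exact piecewise_eq_of_mem _ _ _ hy

/-- Among pairwise comparable functions there is a smallest one. -/
theorem exists_forall_le_of_comparable {ι : Type*} {n : ℕ} (Q : Finset ι) (hQ : Q.Nonempty)
    (γ : ι → Fin n → ℕ) (h : ∀ s ∈ Q, ∀ r ∈ Q, γ s ≤ γ r ∨ γ r ≤ γ s) :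
    ∃ s ∈ Q, ∀ r ∈ Q, γ s ≤ γ r := by
  obtain ⟨s, hs, hmin⟩ := Q.exists_min_image (fun s => ∑ l, γ s l) hQ
  refine ⟨s, hs, fun r hr => (h s hs r hr).elim id fun hle => ?_⟩
  have h1 := (Finset.sum_eq_sum_iff_of_le fun l _ => hle l).1
    (le_antisymm (Finset.sum_le_sum fun l _ => hle l) (hmin r hr))
  exact fun l => (h1 l (Finset.mem_univ l)).ge

variable [MeasureSpace ℚ_[p]] [BorelSpace ℚ_[p]] [(volume : Measure ℚ_[p]).IsAddHaarMeasure]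

theorem Resolvable.exists_pow {n : ℕ} {S : Set ((Fin n → ℚ_[p]) → ℚ_[p])} (h : Resolvable n S)
    {N : ℕ} (hN : N ≠ 0) :
    ∃ (I : Type) (π : I → (Fin n → ℚ_[p]) → Fin n → ℚ_[p]) (G : I → (Fin n → ℚ_[p]) → ℚ_[p]),
      IsCover π G ∧ ∀ r, IsMon (G r) ∧ ∀ f ∈ S, ∃ (α : Fin n → ℕ) (u : (Fin n → ℚ_[p]) → ℚ_[p]),
        AnalyticAt ℚ_[p] u 0 ∧ u 0 ≠ 0 ∧
          (fun x => f (π r x)) =ᶠ[𝓝 0] fun x => (∏ k, x k ^ (N * α k)) * u x := by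
  obtain ⟨I, π, G, hc, hm⟩ := h
  obtain ⟨J, lam, H, hlam, hJ, hH⟩ := exists_isCover_pow_pi (p := p) hN n
  have key : ∀ (j : J) (f : (Fin n → ℚ_[p]) → ℚ_[p]), IsMon f →
      ∃ (α : Fin n → ℕ) (u : (Fin n → ℚ_[p]) → ℚ_[p]),
        AnalyticAt ℚ_[p] u 0 ∧ u 0 ≠ 0 ∧
          (fun x => f fun k => lam j k * x k ^ N) =ᶠ[𝓝 0]
            fun x => (∏ k, x k ^ (N * α k)) * u x := by
    rintro j f ⟨α, u, hu, hu0, he⟩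
    refine ⟨α, fun x => (∏ k, lam j k ^ α k) * u fun k => lam j k * x k ^ N,
      analyticAt_const.mul (hu.comp_of_eq (hJ.analyticAt_chart j) (hJ.chart_zero j)), ?_, ?_⟩
    · refine mul_ne_zero (Finset.prod_ne_zero_iff.2 fun k _ => pow_ne_zero _ (hlam j k)) ?_
      have := hJ.chart_zero j
      beta_reduce at this ⊢
      rwa [this]
    · filter_upwards [(hJ.tendsto_chart j).eventually he] with x hx
      rw [hx]
      simp only [mul_pow, Finset.prod_mul_distrib, pow_mul]
      ring
  refine ⟨_, _, _, hc.comp fun _ => hJ, fun s => ⟨?_, fun f hf => key s.2 _ ((hm s.1).2 f hf)⟩⟩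
  obtain ⟨α, u, hu, hu0, he⟩ := key s.2 _ (hm s.1).1
  exact IsMon.mul ⟨_, u, hu, hu0, he⟩ (hH s.2)

end Reduction

section InductiveStep

variable {p : ℕ} [Fact p.Prime] [MeasureSpace ℚ_[p]] [BorelSpace ℚ_[p]]
  [(volume : Measure ℚ_[p]).IsAddHaarMeasure]

/-- Every finite family of nonzero analytic germs in `n` variables can be monomialized. -/
def AllResolvable (p : ℕ) [Fact p.Prime] [MeasureSpace ℚ_[p]] (n : ℕ) : Prop :=
  ∀ S : Set ((Fin n → ℚ_[p]) → ℚ_[p]), S.Finite →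
    (∀ f ∈ S, AnalyticAt ℚ_[p] f 0 ∧ ¬ f =ᶠ[𝓝 0] 0) → Resolvable n S

theorem resolvable_of_eq_pow_mul {n : ℕ} {X : Set ((Fin n → ℚ_[p]) → ℚ_[p])}
    (hX : Resolvable n X) {ι : Type} {T : ι → ℚ_[p] × (Fin n → ℚ_[p]) → ℚ_[p]} {k : ι → ℕ}
    {u : ι → ℚ_[p] × (Fin n → ℚ_[p]) → ℚ_[p]} (hu : ∀ i, AnalyticAt ℚ_[p] (u i) 0)
    (hu0 : ∀ i, u i 0 ≠ 0) (hT : ∀ i, T i =ᶠ[𝓝 0] fun z => z.1 ^ k i * u i z) :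
    Resolvable (E := ℚ_[p] × (Fin n → ℚ_[p])) (n + 1)
      ((fun (f : (Fin n → ℚ_[p]) → ℚ_[p]) z => f z.2) '' X ∪ range T) := by
  refine hX.lift.of_closure ?_
  rintro f (hf | ⟨i, rfl⟩)
  · exact ⟨f, Submonoid.subset_closure (mem_insert_of_mem _ hf), 1, analyticAt_const, one_ne_zero,
      Eventually.of_forall fun z => by simp⟩
  · exact ⟨_, pow_mem (Submonoid.subset_closure (mem_insert _ _)) (k i), u i, hu i, hu0 i, hT i⟩

theorem resolvable_of_expansion {n : ℕ} (hR : AllResolvable p n) {ι : Type} [Fintype ι]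
    {X : Set ((Fin n → ℚ_[p]) → ℚ_[p])} (hXf : X.Finite)
    (hX : ∀ f ∈ X, AnalyticAt ℚ_[p] f 0 ∧ ¬ f =ᶠ[𝓝 0] 0)
    {T : ι → ℚ_[p] × (Fin n → ℚ_[p]) → ℚ_[p]} {k : ι → ℕ}
    (ih : ∀ (T : ι → ℚ_[p] × (Fin n → ℚ_[p]) → ℚ_[p]) (k' : ι → ℕ),
      (∀ i, AnalyticAt ℚ_[p] (T i) 0) → (∀ i, ordT (T i) = k' i) → ∑ i, k' i < ∑ i, k i →
      Resolvable (n + 1)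
        ((range fun (l : Fin n) (z : ℚ_[p] × (Fin n → ℚ_[p])) => z.2 l) ∪ range T))
    {c : ι → ℕ → (Fin n → ℚ_[p]) → ℚ_[p]} {u : ι → ℚ_[p] × (Fin n → ℚ_[p]) → ℚ_[p]}
    (hc : ∀ i j, AnalyticAt ℚ_[p] (c i j) 0) (hu : ∀ i, AnalyticAt ℚ_[p] (u i) 0)
    (hu0 : ∀ i, u i 0 ≠ 0)
    (hT : ∀ i, ∀ᶠ z in 𝓝 0,
      T i z = ∑ j ∈ Finset.range (k i), c i j z.2 * z.1 ^ j + z.1 ^ k i * u i z)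
    {i₁ : ι} (hi₁ : 1 ≤ k i₁) (hc1 : c i₁ (k i₁ - 1) =ᶠ[𝓝 0] 0) :
    Resolvable (E := ℚ_[p] × (Fin n → ℚ_[p])) (n + 1)
      ((fun (f : (Fin n → ℚ_[p]) → ℚ_[p]) z => f z.2) '' X ∪ range T) := by
  classical
  set P : ι × ℕ → Prop := fun q => q.2 < k q.1 ∧ ¬ c q.1 q.2 =ᶠ[𝓝 0] 0 with hP
  obtain ⟨Q, hQ⟩ : ∃ Q : Finset (ι × ℕ), ∀ q, q ∈ Q ↔ P q := by
    refine ⟨(Finset.univ ×ˢ Finset.range (∑ i, k i)).filter P, fun q => ?_⟩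
    simp only [Finset.mem_filter, Finset.mem_product, Finset.mem_univ, true_and, Finset.mem_range,
      and_iff_right_iff_imp]
    exact fun h => h.1.trans_le (Finset.single_le_sum (fun i _ => Nat.zero_le (k i))
      (Finset.mem_univ q.1))
  have hsnd : Tendsto (Prod.snd : ℚ_[p] × (Fin n → ℚ_[p]) → _) (𝓝 0) (𝓝 0) :=
    continuous_snd.tendsto 0
  by_cases hQe : Q.Nonempty
  swap
  · refine resolvable_of_eq_pow_mul (hR X hXf hX) hu hu0 (k := k) fun i => ?_
    have hz : ∀ j ∈ Finset.range (k i), ∀ᶠ z in 𝓝 (0 : ℚ_[p] × (Fin n → ℚ_[p])),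
        c i j z.2 = 0 := by
      intro j hj
      have : ¬ P (i, j) := fun h => hQe ⟨_, (hQ _).2 h⟩
      simp only [hP, not_and, not_not] at this
      exact hsnd.eventually (this (Finset.mem_range.1 hj))
    filter_upwards [hT i, (Filter.eventually_all_finset _).2 hz] with z h1 h2
    rw [h1, Finset.sum_eq_zero fun j hj => by rw [h2 j hj, zero_mul], zero_add]
  set N := (∑ i, k i).factorial with hN
  have hN0 : N ≠ 0 := Nat.factorial_ne_zero _
  set a : ι × ℕ → ℕ := fun q => N / (k q.1 - q.2) with ha
  have haN : ∀ q ∈ Q, a q * (k q.1 - q.2) = N := by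
    intro q hq
    have h1 := ((hQ q).1 hq).1
    refine Nat.div_mul_cancel (Nat.dvd_factorial (by omega) ?_)
    exact (Nat.sub_le _ _).trans (Finset.single_le_sum (fun i _ => Nat.zero_le (k i))
      (Finset.mem_univ q.1))
  set dif : (ι × ℕ) × (ι × ℕ) → (Fin n → ℚ_[p]) → ℚ_[p] := fun q =>
    c q.1.1 q.1.2 ^ a q.1 - c q.2.1 q.2.2 ^ a q.2 with hdif
  set S : Set ((Fin n → ℚ_[p]) → ℚ_[p]) := X ∪ (fun q : ι × ℕ => c q.1 q.2) '' (Q : Set (ι × ℕ)) ∪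
    {f ∈ dif '' ((Q ×ˢ Q : Finset _) : Set _) | ¬ f =ᶠ[𝓝 0] 0} with hS
  have hSf : S.Finite := (hXf.union (Q.finite_toSet.image _)).union
    (((Q ×ˢ Q).finite_toSet.image _).subset fun _ h => h.1)
  have hSa : ∀ f ∈ S, AnalyticAt ℚ_[p] f 0 ∧ ¬ f =ᶠ[𝓝 0] 0 := by
    rintro f ((hf | ⟨q, hq, rfl⟩) | ⟨⟨q, hq, rfl⟩, h⟩)
    · exact hX f hf
    · exact ⟨hc _ _, ((hQ q).1 hq).2⟩
    · exact ⟨((hc _ _).pow _).sub ((hc _ _).pow _), h⟩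
  obtain ⟨I, π, G, hcov, hmon⟩ := (hR S hSf hSa).exists_pow hN0
  have hlift := hcov.lift (F := ℚ_[p])
  refine Resolvable.of_cover hlift fun r => ?_
  obtain ⟨hGr, hSr⟩ := hmon r
  have hχ := hlift.analyticAt_chart r
  have hχ0 := hlift.chart_zero r
  have hcr : ∀ q : ι × ℕ, ∃ (α : Fin n → ℕ) (v : (Fin n → ℚ_[p]) → ℚ_[p]), AnalyticAt ℚ_[p] v 0 ∧
      (q ∈ Q → v 0 ≠ 0 ∧
        (fun x => c q.1 q.2 (π r x)) =ᶠ[𝓝 0] fun x => (∏ l, x l ^ (N * α l)) * v x) := by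
    intro q
    by_cases hq : q ∈ Q
    · obtain ⟨α, v, hv, hv0, he⟩ := hSr (c q.1 q.2) (Or.inl (Or.inr ⟨q, hq, rfl⟩))
      exact ⟨α, v, hv, fun _ => ⟨hv0, he⟩⟩
    · exact ⟨0, 1, analyticAt_const, fun h => absurd h hq⟩
  choose α v hv hcr using hcr
  have hpow : ∀ q ∈ Q, (fun x => (c q.1 q.2 (π r x)) ^ a q) =ᶠ[𝓝 0]
      fun x => (∏ l, x l ^ (N * (a q * α q l))) * (v q ^ a q) x := by
    intro q hq
    filter_upwards [(hcr q hq).2] with x hx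
    rw [hx, mul_pow, ← Finset.prod_pow, Pi.pow_apply]
    congr 1
    refine Finset.prod_congr rfl fun l _ => ?_
    rw [← pow_mul]; congr 1; ring
  have hcomp : ∀ q ∈ Q, ∀ q' ∈ Q, (a q • α q ≤ a q' • α q' ∨ a q' • α q' ≤ a q • α q) := by
    intro q hq q' hq'
    have hNle : ∀ {b b' : Fin n → ℕ}, (fun l => N * b l) ≤ (fun l => N * b' l) → b ≤ b' :=
      fun h l => Nat.le_of_mul_le_mul_left (h l) (Nat.pos_of_ne_zero hN0)
    refine (le_or_le_of_sub ((hv q).pow _) (pow_ne_zero _ (hcr q hq).1) (hpow q hq)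
      ((hv q').pow _) (pow_ne_zero _ (hcr q' hq').1) (hpow q' hq') ?_).imp
      (fun h => hNle h) (fun h => hNle h)
    by_cases hd : dif (q, q') =ᶠ[𝓝 0] 0
    · left
      filter_upwards [(hcov.tendsto_chart r).eventually hd] with x hx
      exact hx
    · right
      obtain ⟨b, w, hw, hw0, he⟩ := hSr (dif (q, q'))
        (Or.inr ⟨⟨(q, q'), by simp [hq, hq'], rfl⟩, hd⟩)
      exact ⟨_, w, hw, hw0, he⟩
  obtain ⟨q₀, hq₀, hmin⟩ := exists_forall_le_of_comparable Q hQe (fun q => a q • α q) hcomp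
  set β : Fin n → ℕ := a q₀ • α q₀ with hβ
  set e : ι → ℕ → (Fin n → ℚ_[p]) → ℚ_[p] := fun i j =>
    if (i, j) ∈ Q then fun x => (∏ l, x l ^ (N * α (i, j) l - (k i - j) * β l)) * v (i, j) x
    else 0 with he
  have hea : ∀ i j, AnalyticAt ℚ_[p] (e i j) 0 := by
    intro i j
    simp only [he]
    split_ifs
    · refine AnalyticAt.mul (Finset.analyticAt_fun_prod _ fun l _ => AnalyticAt.pow ?_ _) (hv _)
      exact (ContinuousLinearMap.proj (R := ℚ_[p]) (φ := fun _ : Fin n => ℚ_[p]) l).analyticAt 0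
    · exact analyticAt_const
  have he0 : e q₀.1 q₀.2 0 ≠ 0 := by
    simp only [he, Prod.mk.eta, if_pos hq₀]
    refine mul_ne_zero (Finset.prod_ne_zero_iff.2 fun l _ => ?_) (hcr q₀ hq₀).1
    have : N * α q₀ l - (k q₀.1 - q₀.2) * β l = 0 := by
      rw [hβ, Pi.smul_apply, smul_eq_mul, ← mul_assoc, mul_comm (k q₀.1 - q₀.2), haN q₀ hq₀]
      exact Nat.sub_self _
    rw [this, pow_zero]
    exact one_ne_zero
  have he1 : e i₁ (k i₁ - 1) 0 = 0 := by
    have : (i₁, k i₁ - 1) ∉ Q := fun h => ((hQ _).1 h).2 hc1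
    simp only [he, if_neg this, Pi.zero_apply]
  have hce : ∀ i, ∀ j ∈ Finset.range (k i), ∀ᶠ x in 𝓝 0,
      c i j (π r x) = (∏ l, x l ^ β l) ^ (k i - j) * e i j x := by
    intro i j hj
    by_cases hq : (i, j) ∈ Q
    · filter_upwards [(hcr _ hq).2] with x hx
      simp only [he, if_pos hq]
      rw [hx, ← mul_assoc, ← Finset.prod_pow, ← Finset.prod_mul_distrib]
      congr 1
      refine Finset.prod_congr rfl fun l _ => ?_
      rw [← pow_mul, ← pow_add]
      congr 1
      have h1 : β l ≤ a (i, j) * α (i, j) l := hmin _ hq l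
      have h2 := Nat.mul_le_mul_left (k i - j) h1
      rw [← mul_assoc, mul_comm (k i - j) (a (i, j)), haN _ hq] at h2
      rw [mul_comm (β l)]
      omega
    · have : ¬ P (i, j) := fun h => hq ((hQ _).2 h)
      simp only [hP, not_and, not_not] at this
      filter_upwards [(hcov.tendsto_chart r).eventually (this (Finset.mem_range.1 hj))] with x hx
      simp only [he, if_neg hq, Pi.zero_apply, mul_zero]
      exact hx
  have hres := resolvable_of_weights ih (i₀ := q₀.1) (j₀ := q₀.2) ((hQ q₀).1 hq₀).1 hi₁ _ rfl
    (β := β) (e := e) (u := fun i z => u i (z.1, π r z.2)) hea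
    (fun i => (hu i).comp_of_eq hχ hχ0) (fun i => by
      have : ((0 : ℚ_[p] × (Fin n → ℚ_[p])).1, π r (0 : ℚ_[p] × (Fin n → ℚ_[p])).2) = 0 := hχ0
      rw [this]; exact hu0 i) he0 he1
  refine hres.of_closure ?_
  rintro f (rfl | ⟨g, (⟨f, hf, rfl⟩ | ⟨i, rfl⟩), rfl⟩)
  · exact hGr.exists_closure_mul fun l => Or.inl ⟨l, rfl⟩
  · obtain ⟨b, w, hw, hw0, hbw⟩ := hSr f (Or.inl (Or.inl hf))
    exact IsMon.exists_closure_mul (f := fun x => f (π r x)) ⟨_, w, hw, hw0, hbw⟩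
      fun l => Or.inl ⟨l, rfl⟩
  · refine ⟨_, Submonoid.subset_closure (Or.inr ⟨i, rfl⟩), 1, analyticAt_const, one_ne_zero, ?_⟩
    filter_upwards [(hlift.tendsto_chart r).eventually (hT i),
      hsnd.eventually ((Filter.eventually_all_finset _).2 (hce i))] with z h1 h2
    rw [h1, Pi.one_apply, mul_one]
    congr 1
    exact Finset.sum_congr rfl fun j hj => by rw [h2 j hj]

theorem resolvable_of_order {n : ℕ} (hR : AllResolvable p n) {ι : Type} [Fintype ι] (D : ℕ)
    {X : Set ((Fin n → ℚ_[p]) → ℚ_[p])} (hXf : X.Finite)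
    (hX : ∀ f ∈ X, AnalyticAt ℚ_[p] f 0 ∧ ¬ f =ᶠ[𝓝 0] 0)
    {T : ι → ℚ_[p] × (Fin n → ℚ_[p]) → ℚ_[p]} {k : ι → ℕ}
    (hTa : ∀ i, AnalyticAt ℚ_[p] (T i) 0) (hTk : ∀ i, ordT (T i) = k i) (hkD : ∑ i, k i < D) :
    Resolvable (E := ℚ_[p] × (Fin n → ℚ_[p])) (n + 1)
      ((fun (f : (Fin n → ℚ_[p]) → ℚ_[p]) z => f z.2) '' X ∪ range T) := by
  induction D generalizing X T k with
  | zero => exact absurd hkD (Nat.not_lt_zero _)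
  | succ D IH =>
    by_cases hk : ∃ i₁, 1 ≤ k i₁
    swap
    · have hk0 : ∀ i, k i = 0 := fun i => by
        by_contra h
        exact hk ⟨i, Nat.one_le_iff_ne_zero.2 h⟩
      refine resolvable_of_eq_pow_mul (hR X hXf hX) (u := T) (k := k) hTa (fun i => ?_)
        fun i => Eventually.of_forall fun z => by simp [hk0]
      have := hTk i
      rw [hk0, Nat.cast_zero] at this
      exact (analyticAt_slice (hTa i)).analyticOrderAt_eq_zero.1 this
    obtain ⟨i₁, hi₁⟩ := hk
    obtain ⟨k', hk'⟩ : ∃ k', k i₁ = k' + 1 := ⟨k i₁ - 1, by omega⟩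
    obtain ⟨φ, hφ, hφ0, hts⟩ := exists_tschirnhausen (hTa i₁) (k := k') (by rw [hTk, hk'])
    obtain ⟨ψ, hψm, hψ⟩ := exists_measurable_eventuallyEq hφ
    have hψa : AnalyticAt ℚ_[p] ψ 0 := hφ.congr hψ.symm
    have hψ0 : ψ 0 = 0 := hψ.self_of_nhds.trans hφ0
    have hcov := isCover_shear hψm hψa hψ0
    have hχ := hcov.analyticAt_chart ()
    have hχ0 := hcov.chart_zero ()
    set T' : ι → ℚ_[p] × (Fin n → ℚ_[p]) → ℚ_[p] := fun i z => T i (z.1 + ψ z.2, z.2) with hT'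
    have hT'a : ∀ i, AnalyticAt ℚ_[p] (T' i) 0 := fun i => (hTa i).comp_of_eq hχ hχ0
    have hT'k : ∀ i, ordT (T' i) = k i := fun i => by
      rw [← hTk i]
      unfold ordT
      congr 1
      funext t
      simp only [hT', hψ0, add_zero]
    choose c h hc _ hh hh0 hexp using fun i => exists_expansion (hT'a i) (hT'k i)
    have hsnd : Tendsto (Prod.snd : ℚ_[p] × (Fin n → ℚ_[p]) → _) (𝓝 0) (𝓝 0) :=
      continuous_snd.tendsto 0
    have hc1 : c i₁ (k i₁ - 1) =ᶠ[𝓝 0] 0 := by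
      rw [hk', Nat.add_sub_cancel]
      refine hts (c i₁) (h i₁) (hc _ _) (hh _) ?_
      filter_upwards [hexp i₁, hsnd.eventually hψ] with z h1 h2
      rw [hk'] at h1
      rw [← h1, ← h2]
    have hres := resolvable_of_expansion hR hXf hX (ι := ι) (T := T') (k := k)
      (fun T'' k'' h1 h2 h3 => by
        have hco := IH (X := range fun (l : Fin n) x => x l) (finite_range _) (by
          rintro _ ⟨l, rfl⟩
          exact ⟨(ContinuousLinearMap.proj (R := ℚ_[p])
            (φ := fun _ : Fin n => ℚ_[p]) l).analyticAt 0, (IsMon.coord l).not_eventuallyEq_zero⟩)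
          h1 h2 (by omega)
        rwa [← range_comp] at hco) hc hh hh0 hexp hi₁ hc1
    refine Resolvable.of_cover hcov fun _ => hres.of_closure ?_
    rintro f (rfl | ⟨g, (⟨f, hf, rfl⟩ | ⟨i, rfl⟩), rfl⟩)
    · exact ⟨1, one_mem _, 1, analyticAt_const, one_ne_zero,
        Eventually.of_forall fun z => by simp⟩
    · exact ⟨_, Submonoid.subset_closure (Or.inl ⟨f, hf, rfl⟩), 1, analyticAt_const, one_ne_zero,
        Eventually.of_forall fun z => by simp⟩
    · exact ⟨_, Submonoid.subset_closure (Or.inr ⟨i, rfl⟩), 1, analyticAt_const, one_ne_zero,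
        Eventually.of_forall fun z => by simp [hT']⟩

end InductiveStep

section GenericDirection

variable {K : Type*} [NontriviallyNormedField K] {E : Type*} [NormedAddCommGroup E]
  [NormedSpace K E]

theorem exists_polynomial_along_line {m : ℕ} (M : ContinuousMultilinearMap K (fun _ : Fin m => E) K)
    (v w : E) : ∃ q : Polynomial K, ∀ t : K, M (fun _ => t • w + v) = q.eval t := by
  classical
  refine ⟨∑ s : Finset (Fin m), Polynomial.X ^ s.card *
    Polynomial.C (M (s.piecewise (fun _ => w) fun _ => v)), fun t => ?_⟩
  have h1 := M.map_add_univ (fun _ => t • w) (fun _ => v)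
  have h2 : ((fun _ => t • w) + fun _ => v : Fin m → E) = fun _ => t • w + v := rfl
  rw [h2] at h1
  rw [h1, Polynomial.eval_finsetSum]
  refine Finset.sum_congr rfl fun s _ => ?_
  have h3 := M.toMultilinearMap.map_piecewise_smul (fun _ => t) (s.piecewise (fun _ => w) fun _ => v) s
  have h4 : s.piecewise (fun i => t • s.piecewise (fun _ => w) (fun _ => v) i)
      (s.piecewise (fun _ => w) fun _ => v) = s.piecewise (fun _ => t • w) fun _ => v := by
    funext i
    by_cases hi : i ∈ s <;> simp [hi]
  rw [h4] at h3
  rw [mul_comm (Polynomial.X ^ _)]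
  simpa [mul_comm (t ^ _)] using h3

theorem exists_common_nonzero {S : Set (E → K)} (hS : S.Finite)
    (hpol : ∀ Φ ∈ S, ∀ v w, ∃ q : Polynomial K, ∀ t : K, Φ (t • w + v) = q.eval t)
    (hne : ∀ Φ ∈ S, ∃ v, Φ v ≠ 0) : ∃ v, ∀ Φ ∈ S, Φ v ≠ 0 := by
  classical
  induction S, hS using Set.Finite.induction_on with
  | empty => exact ⟨0, fun _ h => absurd h (notMem_empty _)⟩
  | @insert Φ₀ S _ hfin IH =>
    obtain ⟨v, hv⟩ := IH (fun Φ h => hpol Φ (mem_insert_of_mem _ h))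
      fun Φ h => hne Φ (mem_insert_of_mem _ h)
    obtain ⟨w, hw⟩ := hne Φ₀ (mem_insert _ _)
    have hbad : ∀ Φ ∈ insert Φ₀ S, {t : K | Φ (t • (w - v) + v) = 0}.Finite := by
      intro Φ hΦ
      obtain ⟨q, hq⟩ := hpol Φ hΦ v (w - v)
      have hq0 : q ≠ 0 := by
        rintro rfl
        rcases hΦ with rfl | hΦ
        · exact hw (by simpa using hq 1)
        · exact hv Φ hΦ (by simpa using hq 0)
      refine (q.roots.toFinset.finite_toSet).subset fun t ht => ?_
      simp only [mem_ofPred_eq, hq] at ht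
      simpa [hq0] using ht
    obtain ⟨t, ht⟩ := ((hfin.insert Φ₀).biUnion hbad).infinite_compl.nonempty
    refine ⟨t • (w - v) + v, fun Φ hΦ h => ht ?_⟩
    exact mem_biUnion hΦ h

theorem exists_generic_direction {S : Set (E → K)} (hS : S.Finite)
    (ha : ∀ f ∈ S, AnalyticAt K f 0 ∧ ¬ f =ᶠ[𝓝 0] 0) :
    ∃ v : E, ∀ f ∈ S, ¬ (fun t : K => f (t • v)) =ᶠ[𝓝 0] 0 := by
  have key : ∀ f : E → K, ∃ Φ : E → K, f ∈ S →
      (∀ v w, ∃ q : Polynomial K, ∀ t : K, Φ (t • w + v) = q.eval t) ∧ (∃ v, Φ v ≠ 0) ∧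
      ∀ v, Φ v ≠ 0 → ¬ (fun t : K => f (t • v)) =ᶠ[𝓝 0] 0 := by
    intro f
    by_cases hf : f ∈ S
    swap
    · exact ⟨0, fun h => absurd h hf⟩
    obtain ⟨⟨P, hP⟩, hne⟩ := ha f hf
    obtain ⟨m, v, hv⟩ : ∃ m v, P m (fun _ => v) ≠ 0 := by
      by_contra! h
      refine hne ?_
      filter_upwards [hP.eventually_hasSum] with x hx
      simp only [h, zero_add] at hx
      exact hx.unique hasSum_zero
    refine ⟨fun v => P m fun _ => v, fun _ => ⟨fun v w => exists_polynomial_along_line (P m) v w,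
      ⟨v, hv⟩, fun v hv h0 => hv ?_⟩⟩
    set L : K →L[K] E := ContinuousLinearMap.toSpanSingleton K v with hL
    have hP' : HasFPowerSeriesAt f P (L 0) := by rwa [map_zero]
    have h1 := (hP'.compContinuousLinearMap).eq_zero_of_eventually (by
      filter_upwards [h0] with t ht
      simpa [hL] using ht)
    have h2 := congrArg (fun Q : FormalMultilinearSeries K K K => Q m fun _ => 1) h1
    simp only [FormalMultilinearSeries.compContinuousLinearMap_apply] at h2
    simpa [hL, Function.comp_def] using h2
  choose Φ hΦ using key
  obtain ⟨v, hv⟩ := exists_common_nonzero (hS.image Φ)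
    (by rintro _ ⟨f, hf, rfl⟩; exact (hΦ f hf).1) (by rintro _ ⟨f, hf, rfl⟩; exact (hΦ f hf).2.1)
  exact ⟨v, fun f hf => (hΦ f hf).2.2 v (hv _ ⟨f, hf, rfl⟩)⟩

/-- The linear coordinate change which makes `v` the first coordinate direction. -/
noncomputable def directionEquiv [CompleteSpace K] {n : ℕ} (v : Fin (n + 1) → K) (hv : v 0 ≠ 0) :
    (K × (Fin n → K)) ≃L[K] (Fin (n + 1) → K) :=
  LinearEquiv.toContinuousLinearEquiv
    { toFun := fun z => Fin.cons 0 z.2 + z.1 • v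
      invFun := fun y => (y 0 / v 0, fun k => y k.succ - y 0 / v 0 * v k.succ)
      map_add' := fun z w => by
        funext k
        refine Fin.cases ?_ (fun k => ?_) k <;> simp <;> ring
      map_smul' := fun a z => by
        funext k
        refine Fin.cases ?_ (fun k => ?_) k <;> simp <;> ring
      left_inv := fun z => by
        ext k <;> simp [hv]
      right_inv := fun y => by
        funext k
        refine Fin.cases ?_ (fun k => ?_) k <;> simp [hv] }

theorem directionEquiv_apply_zero [CompleteSpace K] {n : ℕ} (v : Fin (n + 1) → K) (hv : v 0 ≠ 0)
    (t : K) : directionEquiv v hv (t, 0) = t • v := by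
  change Fin.cons 0 0 + t • v = t • v
  have : (Fin.cons 0 0 : Fin (n + 1) → K) = 0 := by
    funext k; refine Fin.cases rfl (fun _ => rfl) k
  rw [this, zero_add]

end GenericDirection

section Main

variable {p : ℕ} [Fact p.Prime] [MeasureSpace ℚ_[p]] [BorelSpace ℚ_[p]]
  [(volume : Measure ℚ_[p]).IsAddHaarMeasure]

/-- Local monomialization of finitely many nonzero analytic germs. -/
theorem allResolvable (n : ℕ) : AllResolvable p n := by
  induction n with
  | zero =>
    intro S _ hS
    refine ⟨Unit, _, _, isCover_id, fun _ => ⟨IsMon.one, fun f hf => ?_⟩⟩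
    refine IsMon.of_unit (hS f hf).1 fun h0 => (hS f hf).2 (Eventually.of_forall fun x => ?_)
    rwa [Subsingleton.elim x 0]
  | succ n ih =>
    intro S hSf hS
    have hco : AnalyticAt ℚ_[p] (fun x : Fin (n + 1) → ℚ_[p] => x 0) 0 :=
      (ContinuousLinearMap.proj (R := ℚ_[p]) (φ := fun _ : Fin (n + 1) => ℚ_[p]) 0).analyticAt 0
    obtain ⟨v, hv⟩ := exists_generic_direction (hSf.insert fun x : Fin (n + 1) → ℚ_[p] => x 0) (by
      rintro f (rfl | hf)
      · exact ⟨hco, (IsMon.coord 0).not_eventuallyEq_zero⟩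
      · exact hS f hf)
    have hv0 : v 0 ≠ 0 := fun h => hv _ (mem_insert _ _) (Eventually.of_forall fun t => by simp [h])
    set A := directionEquiv v hv0
    have hA0 : A 0 = 0 := map_zero A
    have hAa : AnalyticAt ℚ_[p] A 0 :=
      (A : ℚ_[p] × (Fin n → ℚ_[p]) →L[ℚ_[p]] Fin (n + 1) → ℚ_[p]).analyticAt 0
    have := hSf.fintype
    have hTa : ∀ f : S, AnalyticAt ℚ_[p] (fun z => f.1 (A z)) 0 := fun f =>
      (hS f.1 f.2).1.comp_of_eq hAa hA0
    have hk : ∀ f : S, ∃ k : ℕ, ordT (fun z => f.1 (A z)) = k := by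
      intro f
      have : ordT (fun z => f.1 (A z)) ≠ ⊤ := by
        unfold ordT
        rw [Ne, analyticOrderAt_eq_top]
        simp only [A, directionEquiv_apply_zero]
        exact hv f.1 (mem_insert_of_mem _ f.2)
      exact ⟨_, (ENat.natCast_toNat this).symm⟩
    choose k hk using hk
    have hres := resolvable_of_order ih (ι := S) _ (X := ∅) finite_empty (by simp)
      hTa hk (Nat.lt_succ_self _)
    have hprod : (volume : Measure (ℚ_[p] × (Fin n → ℚ_[p]))).IsAddHaarMeasure :=
      Measure.prod.instIsAddHaarMeasure (volume : Measure ℚ_[p]) (volume : Measure (Fin n → ℚ_[p]))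
    refine Resolvable.of_cover (IsCover.of_linearEquiv A) fun _ => hres.of_closure ?_
    rintro f (rfl | ⟨g, hg, rfl⟩)
    · exact ⟨1, one_mem _, 1, analyticAt_const, one_ne_zero, Eventually.of_forall fun z => by simp⟩
    · exact ⟨_, Submonoid.subset_closure (Or.inr ⟨⟨g, hg⟩, rfl⟩), 1, analyticAt_const, one_ne_zero,
        Eventually.of_forall fun z => by simp⟩

end Main

section MonomialIntegral

theorem lintegral_pi_prod_eq {α : Type*} [MeasurableSpace α] (ν : Measure α) [SigmaFinite ν]
    {n : ℕ} {φ : Fin n → α → ℝ≥0∞} (hφ : ∀ k, Measurable (φ k)) :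
    ∫⁻ x : Fin n → α, ∏ k, φ k (x k) ∂(Measure.pi fun _ => ν) = ∏ k, ∫⁻ t, φ k t ∂ν := by
  induction n with
  | zero =>
    simp [Measure.pi_of_empty (fun _ : Fin 0 => ν) (x := fun k => k.elim0)]
  | succ n ih =>
    have h := (measurePreserving_piFinSuccAbove (fun _ : Fin (n + 1) => ν) 0).symm
    rw [← h.lintegral_comp (f := fun x : Fin (n + 1) → α => ∏ k, φ k (x k)) (by fun_prop)]
    simp only [Fin.prod_univ_succ]
    have h2 : ∀ z : α × (Fin n → α), φ 0 ((MeasurableEquiv.piFinSuccAbove (fun _ => α) 0).symm z 0) *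
        ∏ i : Fin n, φ i.succ ((MeasurableEquiv.piFinSuccAbove (fun _ => α) 0).symm z i.succ)
        = φ 0 z.1 * ∏ i : Fin n, φ i.succ (z.2 i) := by
      intro z
      simp [MeasurableEquiv.piFinSuccAbove]
    simp only [h2]
    rw [lintegral_prod_mul (f := φ 0) (g := fun x : Fin n → α => ∏ i, φ i.succ (x i))
      (hφ 0).aemeasurable
      (Finset.measurable_prod _ fun i _ => (hφ i.succ).comp (measurable_pi_apply i)).aemeasurable, ih fun k => hφ k.succ]

variable {p : ℕ} [Fact p.Prime] [MeasureSpace ℚ_[p]] [BorelSpace ℚ_[p]]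
  [(volume : Measure ℚ_[p]).IsAddHaarMeasure]

theorem measurable_norm_rpow (s : ℝ) :
    Measurable fun t : ℚ_[p] => ENNReal.ofReal (‖t‖ ^ s) := by
  fun_prop

theorem volume_sphere_one_pos : 0 < volume (Metric.sphere (0 : ℚ_[p]) 1) :=
  (IsUltrametricDist.isOpen_sphere (0 : ℚ_[p]) one_ne_zero).measure_pos _ ⟨1, by simp⟩

theorem lintegral_norm_rpow {c : ℚ_[p]} (hc : c ≠ 0) (s : ℝ) :
    ∫⁻ t in Metric.closedBall (0 : ℚ_[p]) ‖c‖, ENNReal.ofReal (‖t‖ ^ s) =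
      ENNReal.ofReal (‖c‖ ^ (s + 1)) * volume (Metric.sphere (0 : ℚ_[p]) 1) *
        (1 - ENNReal.ofReal ((p : ℝ)⁻¹ ^ (s + 1)))⁻¹ := by
  have hp0 : (0 : ℝ) < p := by exact_mod_cast (Fact.out : p.Prime).pos
  have hc0 : 0 < ‖c‖ := norm_pos_iff.2 hc
  rw [lintegral_closedBall_eq_tsum hc (measurable_norm_rpow s), ← ENNReal.tsum_geometric,
    ← ENNReal.tsum_mul_left]
  refine tsum_congr fun i => ?_
  have h1 : ∫⁻ x in Metric.sphere (0 : ℚ_[p]) 1, ENNReal.ofReal (‖c * (p : ℚ_[p]) ^ i * x‖ ^ s)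
      = ENNReal.ofReal ((‖c‖ * (p : ℝ)⁻¹ ^ i) ^ s) * volume (Metric.sphere (0 : ℚ_[p]) 1) := by
    rw [← setLIntegral_const]
    refine setLIntegral_congr_fun Metric.isClosed_sphere.measurableSet fun x hx => ?_
    have hx1 : ‖x‖ = 1 := by simpa using hx
    simp [hx1]
  have h2 : ‖c * (p : ℚ_[p]) ^ i‖ₑ = ENNReal.ofReal (‖c‖ * (p : ℝ)⁻¹ ^ i) := by
    rw [← ofReal_norm]; simp
  rw [h1, h2, mul_right_comm, mul_right_comm _ (volume _), ← ENNReal.ofReal_mul (by positivity),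
    ← ENNReal.ofReal_pow (by positivity), ← ENNReal.ofReal_mul (by positivity)]
  congr 2
  have hq : 0 < ‖c‖ * (p : ℝ)⁻¹ ^ i := by positivity
  rw [← Real.rpow_add_one hq.ne', Real.mul_rpow hc0.le (by positivity), ← Real.rpow_natCast,
    ← Real.rpow_natCast, ← Real.rpow_mul (by positivity), ← Real.rpow_mul (by positivity),
    mul_comm (i : ℝ)]

theorem lintegral_norm_rpow_ne_zero {c : ℚ_[p]} (hc : c ≠ 0) (s : ℝ) :
    ∫⁻ t in Metric.closedBall (0 : ℚ_[p]) ‖c‖, ENNReal.ofReal (‖t‖ ^ s) ≠ 0 := by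
  have hc0 : 0 < ‖c‖ := norm_pos_iff.2 hc
  rw [lintegral_norm_rpow hc]
  refine mul_ne_zero (mul_ne_zero ?_ volume_sphere_one_pos.ne') ?_
  · simpa using by positivity
  · exact ENNReal.inv_ne_zero.2 (ENNReal.sub_ne_top ENNReal.one_ne_top)

theorem lintegral_norm_rpow_lt_top_iff {c : ℚ_[p]} (hc : c ≠ 0) (s : ℝ) :
    ∫⁻ t in Metric.closedBall (0 : ℚ_[p]) ‖c‖, ENNReal.ofReal (‖t‖ ^ s) < ⊤ ↔ -1 < s := by
  have hp1 : (1 : ℝ) < p := by exact_mod_cast (Fact.out : p.Prime).one_lt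
  have hq0 : (0 : ℝ) < (p : ℝ)⁻¹ := by positivity
  have hq1 : (p : ℝ)⁻¹ < 1 := inv_lt_one_of_one_lt₀ hp1
  have hc0 : 0 < ‖c‖ := norm_pos_iff.2 hc
  have hvol : volume (Metric.sphere (0 : ℚ_[p]) 1) ≠ ⊤ :=
    ((isCompact_sphere (0 : ℚ_[p]) 1).measure_lt_top).ne
  have hA : ENNReal.ofReal (‖c‖ ^ (s + 1)) * volume (Metric.sphere (0 : ℚ_[p]) 1) ≠ 0 :=
    mul_ne_zero (by simpa using by positivity) volume_sphere_one_pos.ne'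
  have hA' : ENNReal.ofReal (‖c‖ ^ (s + 1)) * volume (Metric.sphere (0 : ℚ_[p]) 1) ≠ ⊤ :=
    ENNReal.mul_ne_top ENNReal.ofReal_ne_top hvol
  have hiff : (1 - ENNReal.ofReal ((p : ℝ)⁻¹ ^ (s + 1)))⁻¹ ≠ ⊤ ↔ -1 < s := by
    rw [Ne, ENNReal.inv_eq_top, tsub_eq_zero_iff_le, not_le,
      ← ENNReal.ofReal_one, ENNReal.ofReal_lt_ofReal_iff one_pos,
      Real.rpow_lt_one_iff_of_pos hq0]
    constructor
    · rintro (⟨h, _⟩ | ⟨_, h⟩)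
      · linarith
      · linarith
    · exact fun h => Or.inr ⟨hq1, by linarith⟩
  rw [lintegral_norm_rpow hc, ← hiff, lt_top_iff_ne_top]
  constructor
  · intro h h2
    rw [h2, ENNReal.mul_top hA] at h
    exact h rfl
  · exact fun h => ENNReal.mul_ne_top hA' h

theorem lintegral_monomial_lt_top_iff {n : ℕ} {c : ℚ_[p]} (hc : c ≠ 0) (s : Fin n → ℝ) :
    ∫⁻ x in Metric.closedBall (0 : Fin n → ℚ_[p]) ‖c‖, ∏ k, ENNReal.ofReal (‖x k‖ ^ s k) < ⊤ ↔
      ∀ k, -1 < s k := by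
  have h1 : (volume : Measure (Fin n → ℚ_[p])).restrict (Metric.closedBall 0 ‖c‖)
      = Measure.pi fun _ => (volume : Measure ℚ_[p]).restrict (Metric.closedBall 0 ‖c‖) := by
    rw [closedBall_pi _ (norm_nonneg c), volume_pi, ← Measure.restrict_pi_pi]
    rfl
  rw [h1, lintegral_pi_prod_eq (φ := fun k (t : ℚ_[p]) => ENNReal.ofReal (‖t‖ ^ s k)) _
    fun k => measurable_norm_rpow (s k)]
  constructor
  · intro h k
    rw [← lintegral_norm_rpow_lt_top_iff hc, lt_top_iff_ne_top]
    intro htop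
    have : ∏ k, ∫⁻ t in Metric.closedBall (0 : ℚ_[p]) ‖c‖, ENNReal.ofReal (‖t‖ ^ s k) = ⊤ := by
      rw [← Finset.mul_prod_erase _ _ (Finset.mem_univ k), htop]
      exact ENNReal.top_mul (Finset.prod_ne_zero_iff.2 fun l _ => lintegral_norm_rpow_ne_zero hc _)
    exact h.ne this
  · intro h
    exact ENNReal.prod_lt_top fun k _ => (lintegral_norm_rpow_lt_top_iff hc _).2 (h k)

end MonomialIntegral

section RatioPow

variable {p : ℕ} [Fact p.Prime]

open Classical in
/-- The function `|f/g|^σ`, extended by zero to the zero set of `f * g`. -/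
noncomputable def ratioPow {E : Type*} (f g : E → ℚ_[p]) (σ : ℝ) (x : E) : ℝ≥0∞ :=
  if f x * g x = 0 then 0 else ENNReal.ofReal (‖f x / g x‖ ^ σ)

theorem prod_rpow_identity {n : ℕ} {t : Fin n → ℝ} (ht : ∀ k, 0 < t k) (α β γ : Fin n → ℕ)
    {a b c : ℝ} (ha : 0 < a) (hb : 0 < b) (σ : ℝ) :
    ((∏ k, t k ^ α k) * a / ((∏ k, t k ^ β k) * b)) ^ σ * ((∏ k, t k ^ γ k) * c) =
      ((a / b) ^ σ * c) * ∏ k, t k ^ (((α k : ℝ) - β k) * σ + γ k) := by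
  have h1 : (∏ k, t k ^ α k) * a / ((∏ k, t k ^ β k) * b)
      = (∏ k, t k ^ ((α k : ℝ) - β k)) * (a / b) := by
    rw [mul_div_mul_comm, ← Finset.prod_div_distrib]
    congr 1
    refine Finset.prod_congr rfl fun k _ => ?_
    rw [Real.rpow_sub (ht k), Real.rpow_natCast, Real.rpow_natCast]
  have h2 : ∏ k, t k ^ (((α k : ℝ) - β k) * σ + γ k)
      = (∏ k, t k ^ ((α k : ℝ) - β k)) ^ σ * ∏ k, t k ^ γ k := by
    rw [← Real.finsetProd_rpow _ _ fun k _ => (Real.rpow_pos_of_pos (ht k) _).le,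
      ← Finset.prod_mul_distrib]
    refine Finset.prod_congr rfl fun k _ => ?_
    rw [Real.rpow_add (ht k), Real.rpow_mul (ht k).le, Real.rpow_natCast]
  rw [h1, h2, Real.mul_rpow (Finset.prod_nonneg fun k _ => (Real.rpow_pos_of_pos (ht k) _).le)
    (by positivity)]
  ring

theorem measurable_ratioPow {E : Type*} [MeasurableSpace E] [MeasurableSpace ℚ_[p]]
    [BorelSpace ℚ_[p]] {f g : E → ℚ_[p]} (hf : Measurable f) (hg : Measurable g) (σ : ℝ) :
    Measurable (ratioPow f g σ) := by
  refine Measurable.ite ((hf.mul hg) (measurableSet_singleton 0)) measurable_const ?_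
  exact ENNReal.measurable_ofReal.comp ((measurable_norm.comp (hf.div hg)).pow_const σ)

theorem ratioPow_congr {E : Type*} {f g f' g' : E → ℚ_[p]} {x : E} (hf : f x = f' x)
    (hg : g x = g' x) (σ : ℝ) : ratioPow f g σ x = ratioPow f' g' σ x := by
  unfold ratioPow
  rw [hf, hg]

variable [MeasureSpace ℚ_[p]] [BorelSpace ℚ_[p]] [(volume : Measure ℚ_[p]).IsAddHaarMeasure]

theorem ae_forall_apply_ne_zero (n : ℕ) : ∀ᵐ y : Fin n → ℚ_[p], ∀ k, y k ≠ 0 := by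
  rw [ae_all_iff]
  intro k
  exact Measure.ae_eval_ne (μ := fun _ => (volume : Measure ℚ_[p])) k 0

theorem IsMon.exists_lintegral_ratioPow_lt_top_iff {n : ℕ} {F G J : (Fin n → ℚ_[p]) → ℚ_[p]}
    (hF : IsMon F) (hG : IsMon G) (hJ : IsMon J) :
    ∃ (a b : Fin n → ℝ), ∃ V ∈ 𝓝 (0 : Fin n → ℚ_[p]), ∀ d : ℚ_[p], d ≠ 0 →
      Metric.closedBall (0 : Fin n → ℚ_[p]) ‖d‖ ⊆ V → ∀ σ,
      (∫⁻ y in Metric.closedBall (0 : Fin n → ℚ_[p]) ‖d‖, ratioPow F G σ y * ‖J y‖ₑ < ⊤ ↔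
        ∀ k, -1 < a k * σ + b k) := by
  obtain ⟨α, u, hu, hu0, hF⟩ := hF
  obtain ⟨β, v, hv, hv0, hG⟩ := hG
  obtain ⟨γ, w, hw, hw0, hJ⟩ := hJ
  have hev := hF.and (hG.and (hJ.and ((eventually_norm_eq_of_ne_zero hu.continuousAt hu0).and
    ((eventually_norm_eq_of_ne_zero hv.continuousAt hv0).and
      (eventually_norm_eq_of_ne_zero hw.continuousAt hw0)))))
  refine ⟨fun k => (α k : ℝ) - β k, fun k => γ k, _, hev, fun d hd hdV σ => ?_⟩
  rw [← lintegral_monomial_lt_top_iff hd]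
  have hu0' := norm_pos_iff.2 hu0
  have hv0' := norm_pos_iff.2 hv0
  have hw0' := norm_pos_iff.2 hw0
  set κ : ℝ≥0∞ := ENNReal.ofReal ((‖u 0‖ / ‖v 0‖) ^ σ * ‖w 0‖) with hκ
  have hκ0 : κ ≠ 0 := by
    rw [hκ, Ne, ENNReal.ofReal_eq_zero, not_le]; positivity
  have hkey : ∫⁻ y in Metric.closedBall (0 : Fin n → ℚ_[p]) ‖d‖, ratioPow F G σ y * ‖J y‖ₑ
      = κ * ∫⁻ y in Metric.closedBall (0 : Fin n → ℚ_[p]) ‖d‖,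
        ∏ k, ENNReal.ofReal (‖y k‖ ^ (((α k : ℝ) - β k) * σ + γ k)) := by
    rw [← lintegral_const_mul' _ _ ENNReal.ofReal_ne_top]
    refine setLIntegral_congr_fun_ae Metric.isClosed_closedBall.measurableSet ?_
    filter_upwards [ae_forall_apply_ne_zero n] with y hy hyd
    obtain ⟨h1, h2, h3, h4, h5, h6⟩ := hdV hyd
    have hy' : ∀ k, 0 < ‖y k‖ := fun k => norm_pos_iff.2 (hy k)
    have hF0 : F y ≠ 0 := by
      rw [h1]
      exact mul_ne_zero (Finset.prod_ne_zero_iff.2 fun k _ => pow_ne_zero _ (hy k))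
        (norm_pos_iff.1 (h4 ▸ hu0'))
    have hG0 : G y ≠ 0 := by
      rw [h2]
      exact mul_ne_zero (Finset.prod_ne_zero_iff.2 fun k _ => pow_ne_zero _ (hy k))
        (norm_pos_iff.1 (h5 ▸ hv0'))
    rw [ratioPow, if_neg (mul_ne_zero hF0 hG0), ← ofReal_norm,
      ← ENNReal.ofReal_mul (by positivity),
      ← ENNReal.ofReal_prod_of_nonneg fun k _ => by positivity,
      ← ENNReal.ofReal_mul (by positivity), ← prod_rpow_identity hy' α β γ hu0' hv0' σ]
    congr 1
    rw [norm_div, h1, h2, h3]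
    simp [norm_prod, h4, h5, h6]
  rw [hkey]
  constructor
  · intro h
    rw [lt_top_iff_ne_top]
    intro h2
    rw [h2, ENNReal.mul_top hκ0] at h
    exact h.ne rfl
  · exact fun h => ENNReal.mul_lt_top ENNReal.ofReal_lt_top h

theorem exists_norm_closedBall_subset {E : Type*} [SeminormedAddCommGroup E] {V : Set E}
    (hV : V ∈ 𝓝 0) : ∃ d : ℚ_[p], d ≠ 0 ∧ Metric.closedBall (0 : E) ‖d‖ ⊆ V := by
  obtain ⟨ε, hε, h⟩ := Metric.nhds_basis_closedBall.mem_iff.1 hV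
  obtain ⟨d, hd, hdε⟩ := NormedField.exists_norm_lt ℚ_[p] hε
  exact ⟨d, norm_pos_iff.1 hd, (Metric.closedBall_subset_closedBall hdε.le).trans h⟩

theorem eventually_lintegral_ratioPow_lt_top_zero {n : ℕ} {f g : (Fin n → ℚ_[p]) → ℚ_[p]}
    (hf : AnalyticAt ℚ_[p] f 0) (hg : AnalyticAt ℚ_[p] g 0)
    (hf0 : ¬ f =ᶠ[𝓝 0] 0) (hg0 : ¬ g =ᶠ[𝓝 0] 0)
    (hfm : Measurable f) (hgm : Measurable g) {σ₀ : ℝ} {V : Set (Fin n → ℚ_[p])}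
    (hV : V ∈ 𝓝 0) (h : ∫⁻ x in V, ratioPow f g σ₀ x < ⊤) :
    ∃ V' ∈ 𝓝 (0 : Fin n → ℚ_[p]), ∀ᶠ σ in 𝓝 σ₀, ∫⁻ x in V', ratioPow f g σ x < ⊤ := by
  obtain ⟨I, π, G, hc, hm⟩ := allResolvable n {f, g} (by simp) (by
    rintro φ (rfl | rfl)
    exacts [⟨hf, hf0⟩, ⟨hg, hg0⟩])
  have key : ∀ r, ∃ d : ℚ_[p], d ≠ 0 ∧ ∀ᶠ σ in 𝓝 σ₀,
      ∫⁻ y in Metric.closedBall (0 : Fin n → ℚ_[p]) ‖d‖,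
        ratioPow f g σ (π r y) * ‖G r y‖ₑ < ⊤ := by
    intro r
    obtain ⟨hG, hr⟩ := hm r
    obtain ⟨a, b, V₀, hV₀, hab⟩ := IsMon.exists_lintegral_ratioPow_lt_top_iff
      (hr f (by simp)) (hr g (by simp)) hG
    obtain ⟨N, C, hN, hC, hNC⟩ := hc.lower r V hV
    obtain ⟨d, hd, hdV⟩ := exists_norm_closedBall_subset (p := p) (inter_mem hV₀ hN)
    refine ⟨d, hd, ?_⟩
    have hlt : ∫⁻ y in Metric.closedBall (0 : Fin n → ℚ_[p]) ‖d‖,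
        ratioPow f g σ₀ (π r y) * ‖G r y‖ₑ < ⊤ :=
      ((lintegral_mono_set (hdV.trans inter_subset_right)).trans
        (hNC _ (measurable_ratioPow hfm hgm σ₀))).trans_lt
        (ENNReal.mul_lt_top hC.lt_top h)
    have hiff := hab d hd (hdV.trans inter_subset_left)
    have h0 := (hiff σ₀).1 hlt
    have hev : ∀ᶠ σ in 𝓝 σ₀, ∀ k, -1 < a k * σ + b k := by
      rw [eventually_all]
      intro k
      exact (by fun_prop : Continuous fun σ => a k * σ + b k).continuousAt.eventually_const_lt (h0 k)
    filter_upwards [hev] with σ hσ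
    exact (hiff σ).2 hσ
  choose d hd hdσ using key
  obtain ⟨I₀, V', C, hV', hC, hU⟩ := hc.upper
    (fun r => Metric.closedBall (0 : Fin n → ℚ_[p]) ‖d r‖)
    fun r => Metric.closedBall_mem_nhds _ (norm_pos_iff.2 (hd r))
  refine ⟨V', hV', ?_⟩
  filter_upwards [(eventually_all_finset I₀).2 fun r _ => hdσ r] with σ hσ
  refine (hU _ (measurable_ratioPow hfm hgm σ)).trans_lt (ENNReal.mul_lt_top hC.lt_top ?_)
  exact ENNReal.sum_lt_top.2 hσ

theorem eventually_lintegral_ratioPow_lt_top {n : ℕ} {f g : (Fin n → ℚ_[p]) → ℚ_[p]}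
    {a : Fin n → ℚ_[p]} (hf : AnalyticAt ℚ_[p] f a) (hg : AnalyticAt ℚ_[p] g a)
    {σ₀ : ℝ} {V : Set (Fin n → ℚ_[p])}
    (hV : V ∈ 𝓝 a) (h : ∫⁻ x in V, ratioPow f g σ₀ x < ⊤) :
    ∃ V' ∈ 𝓝 a, ∀ᶠ σ in 𝓝 σ₀, ∫⁻ x in V', ratioPow f g σ x < ⊤ := by
  by_cases hfg0 : (f =ᶠ[𝓝 a] 0) ∨ (g =ᶠ[𝓝 a] 0)
  · have h0 : ∀ᶠ x in 𝓝 a, f x * g x = 0 := by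
      rcases hfg0 with h0 | h0
      · filter_upwards [h0] with x hx
        simp [hx]
      · filter_upwards [h0] with x hx
        simp [hx]
    obtain ⟨t, ht, hto, hta⟩ := mem_nhds_iff.1 h0
    refine ⟨t, hto.mem_nhds hta, Eventually.of_forall fun σ => ?_⟩
    rw [setLIntegral_congr_fun (f := ratioPow f g σ) (g := fun _ => 0) hto.measurableSet
      fun x hx => if_pos (ht hx)]
    simp
  push Not at hfg0
  have hsh : AnalyticAt ℚ_[p] (fun x : Fin n → ℚ_[p] => x + a) 0 := by fun_prop
  have htend : Tendsto (fun x : Fin n → ℚ_[p] => x + a) (𝓝 0) (𝓝 a) := by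
    simpa using (continuous_add_const a).tendsto (0 : Fin n → ℚ_[p])
  have htend' : Tendsto (fun x : Fin n → ℚ_[p] => x - a) (𝓝 a) (𝓝 0) := by
    simpa using (continuous_sub_right a).tendsto a
  have hf' : AnalyticAt ℚ_[p] (fun x => f (x + a)) 0 := hf.comp_of_eq hsh (by simp)
  have hg' : AnalyticAt ℚ_[p] (fun x => g (x + a)) 0 := hg.comp_of_eq hsh (by simp)
  obtain ⟨F, hFm, hF⟩ := exists_measurable_eventuallyEq hf'
  obtain ⟨G, hGm, hG⟩ := exists_measurable_eventuallyEq hg'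
  have hne : ∀ {φ Φ : (Fin n → ℚ_[p]) → ℚ_[p]}, ¬ (φ =ᶠ[𝓝 a] 0) →
      (Φ =ᶠ[𝓝 0] fun x => φ (x + a)) → ¬ (Φ =ᶠ[𝓝 0] 0) := by
    intro φ Φ hφ hΦ h0
    refine hφ ?_
    filter_upwards [htend'.eventually (hΦ.symm.trans h0)] with x hx
    simpa using hx
  obtain ⟨t, ht, hto, hta⟩ := mem_nhds_iff.1 (inter_mem (hF.and hG) (htend hV))
  have htr : ∀ (s : Set (Fin n → ℚ_[p])) (k : (Fin n → ℚ_[p]) → ℝ≥0∞),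
      ∫⁻ x in (fun x => x + a) ⁻¹' s, k (x + a) = ∫⁻ x in s, k x := fun s k =>
    (measurePreserving_add_right volume a).setLIntegral_comp_preimage_emb
      (MeasurableEquiv.addRight a).measurableEmbedding k s
  have hlt : ∫⁻ x in t, ratioPow F G σ₀ x < ⊤ := by
    rw [setLIntegral_congr_fun (g := fun x => ratioPow f g σ₀ (x + a)) hto.measurableSet
      fun x hx => ratioPow_congr (g' := fun x => g (x + a)) (f' := fun x => f (x + a))
        (ht hx).1.1 (ht hx).1.2 σ₀]
    refine lt_of_le_of_lt ?_ ((htr V (ratioPow f g σ₀)).trans_lt h)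
    exact lintegral_mono_set fun x hx => (ht hx).2
  obtain ⟨V', hV', hev⟩ := eventually_lintegral_ratioPow_lt_top_zero (hf'.congr hF.symm)
    (hg'.congr hG.symm) (hne hfg0.1 hF) (hne hfg0.2 hG) hFm hGm (hto.mem_nhds hta) hlt
  obtain ⟨s, hs, hso, hsa⟩ := mem_nhds_iff.1 (inter_mem (hF.and hG) hV')
  refine ⟨(fun x => x - a) ⁻¹' s, htend' (hso.mem_nhds hsa), ?_⟩
  filter_upwards [hev] with σ hσ
  rw [← htr]
  have hpre : (fun x => x + a) ⁻¹' ((fun x => x - a) ⁻¹' s) = s := by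
    ext x; simp
  rw [hpre, setLIntegral_congr_fun (f := fun x => ratioPow f g σ (x + a))
    (g := ratioPow F G σ) hso.measurableSet
      fun x hx => (ratioPow_congr (g' := fun x => g (x + a)) (f' := fun x => f (x + a))
        (hs hx).1.1 (hs hx).1.2 σ).symm]
  exact (lintegral_mono_set fun x hx => (hs hx).2).trans_lt hσ

end RatioPow

theorem isOpen_setOf_lintegral_ratioPow_lt_top {p : ℕ} [Fact p.Prime] {n : ℕ}
    [MeasurableSpace (Fin n → ℚ_[p])] [BorelSpace (Fin n → ℚ_[p])]
    (μ : Measure (Fin n → ℚ_[p])) [μ.IsAddHaarMeasure] {f g : (Fin n → ℚ_[p]) → ℚ_[p]}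
    {W : Set (Fin n → ℚ_[p])} (hWopen : IsOpen W) (hWcomp : IsCompact W)
    (hf : AnalyticOnNhd ℚ_[p] f W) (hg : AnalyticOnNhd ℚ_[p] g W) :
    IsOpen {σ : ℝ | ∫⁻ x in W, ratioPow f g σ x ∂μ < ⊤} := by
  rename_i m hm _
  let : MeasurableSpace ℚ_[p] := borel _
  have : BorelSpace ℚ_[p] := ⟨rfl⟩
  let : MeasureSpace ℚ_[p] := ⟨Measure.addHaar⟩
  have : (volume : Measure ℚ_[p]).IsAddHaarMeasure :=
    inferInstanceAs (Measure.addHaar : Measure ℚ_[p]).IsAddHaarMeasure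
  obtain rfl : m = MeasurableSpace.pi :=
    hm.measurable_eq.trans (Pi.borelSpace (X := fun _ : Fin n => ℚ_[p])).measurable_eq.symm
  have hμ := Measure.isAddLeftInvariant_eq_smul μ volume
  have hc0 : (Measure.addHaarScalarFactor μ volume : ℝ≥0∞) ≠ 0 := by
    exact_mod_cast (Measure.addHaarScalarFactor_pos_of_isAddHaarMeasure μ volume).ne'
  have hiff : ∀ (s : Set (Fin n → ℚ_[p])) (σ : ℝ),
      ∫⁻ x in s, ratioPow f g σ x ∂μ < ⊤ ↔ ∫⁻ x in s, ratioPow f g σ x < ⊤ := by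
    intro s σ
    rw [hμ, Measure.restrict_smul, lintegral_smul_measure]
    constructor
    · intro h
      rw [lt_top_iff_ne_top]
      intro h2
      rw [h2] at h
      exact h.ne (ENNReal.mul_top hc0)
    · exact fun h => ENNReal.mul_lt_top ENNReal.coe_lt_top h
  simp only [hiff]
  rw [isOpen_iff_mem_nhds]
  intro σ₀ hσ₀
  refine hWcomp.induction_on (p := fun s => ∀ᶠ σ in 𝓝 σ₀, ∫⁻ x in s, ratioPow f g σ x < ⊤)
    (by simp) ?_ ?_ ?_
  · intro s t hst ht
    filter_upwards [ht] with σ hσ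
    exact (lintegral_mono_set hst).trans_lt hσ
  · intro s t hs ht
    filter_upwards [hs, ht] with σ h1 h2
    exact (lintegral_union_le _ s t).trans_lt (ENNReal.add_lt_top.2 ⟨h1, h2⟩)
  · intro a ha
    obtain ⟨V, hV, h⟩ := eventually_lintegral_ratioPow_lt_top (hf a ha) (hg a ha)
      (hWopen.mem_nhds ha) hσ₀
    exact ⟨V, mem_nhdsWithin_of_mem_nhds hV, h⟩

theorem tendsto_lintegral_rpow_of_eq_top {X : Type*} [MeasurableSpace X] {ν : Measure X}
    {h : X → ℝ} (hm : AEMeasurable h ν) (hpos : ∀ᵐ x ∂ν, 0 < h x) {β : ℝ}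
    (htop : ∫⁻ x, ENNReal.ofReal (h x ^ β) ∂ν = ⊤) :
    Tendsto (fun σ : ℝ => ∫⁻ x, ENNReal.ofReal (h x ^ σ) ∂ν) (𝓝 β) (𝓝 ⊤) := by
  refine tendsto_of_seq_tendsto fun u hu => ?_
  refine tendsto_of_le_liminf_of_limsup_le ?_ le_top
  rw [← htop]
  refine le_trans (le_of_eq ?_) (lintegral_liminf_le' fun k =>
    ENNReal.measurable_ofReal.comp_aemeasurable (hm.pow_const (u k)))
  refine lintegral_congr_ae ?_
  filter_upwards [hpos] with x hx
  refine (Tendsto.liminf_eq ?_).symm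
  exact (ENNReal.continuous_ofReal.tendsto _).comp
    (((Real.continuous_const_rpow hx.ne').tendsto β).comp hu)

theorem integrable_rpow_ordConnected {X : Type*} [MeasurableSpace X] {ν : Measure X}
    {h : X → ℝ} (hm : AEMeasurable h ν) (hpos : ∀ᵐ x ∂ν, 0 < h x) :
    {σ : ℝ | Integrable (fun x => h x ^ σ) ν}.OrdConnected := by
  refine ⟨fun a ha b hb σ hσ => ?_⟩
  refine Integrable.mono' (Integrable.add ha hb) (hm.pow_const σ).aestronglyMeasurable ?_
  filter_upwards [hpos] with x hx
  rw [Real.norm_of_nonneg (by positivity)]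
  change h x ^ σ ≤ h x ^ a + h x ^ b
  have h1 : 0 ≤ h x ^ a := by positivity
  have h2 : 0 ≤ h x ^ b := by positivity
  rcases le_total 1 (h x) with h3 | h3
  · linarith [Real.rpow_le_rpow_of_exponent_le h3 hσ.2]
  · linarith [Real.rpow_le_rpow_of_exponent_ge hx h3 hσ.1]

theorem _root_.IsOpen.csInf_notMem {B : Set ℝ} (hB : IsOpen B) (hb : BddBelow B) :
    sInf B ∉ B := by
  intro h
  obtain ⟨l, hl, hl2⟩ := exists_Ioc_subset_of_mem_nhds (hB.mem_nhds h) (exists_lt _)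
  obtain ⟨y, hy1, hy2⟩ := exists_between hl
  exact absurd (csInf_le hb (hl2 ⟨hy1, hy2.le⟩)) (not_le.2 hy2)

theorem _root_.IsOpen.csSup_notMem {B : Set ℝ} (hB : IsOpen B) (hb : BddAbove B) :
    sSup B ∉ B := by
  intro h
  obtain ⟨l, hl, hl2⟩ := exists_Ico_subset_of_mem_nhds (hB.mem_nhds h) (exists_gt _)
  obtain ⟨y, hy1, hy2⟩ := exists_between hl
  exact absurd (le_csSup hb (hl2 ⟨hy1.le, hy2⟩)) (not_le.2 hy1)

end PadicMonomialization

open PadicMonomialization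

/-- The set of real exponents `σ` for which `|f/g|_p^σ` is integrable on `W ∖ D` is an
open interval containing `0`; the (l)integral blows up at each finite endpoint. -/
theorem padic_convergence_set_is_open_interval
    (p : ℕ) [Fact p.Prime] (n : ℕ)
    [MeasurableSpace (Fin n → ℚ_[p])] [BorelSpace (Fin n → ℚ_[p])]
    (μ : Measure (Fin n → ℚ_[p])) [μ.IsAddHaarMeasure]
    (hμ : μ (Set.univ.pi fun _ : Fin n => {x : ℚ_[p] | ‖x‖ ≤ 1}) = 1)
    (U : Set (Fin n → ℚ_[p])) (hUopen : IsOpen U) (hUne : U.Nonempty)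
    (f g : (Fin n → ℚ_[p]) → ℚ_[p])
    (hf : AnalyticOnNhd ℚ_[p] f U) (hg : AnalyticOnNhd ℚ_[p] g U)
    (hf0 : ∃ x ∈ U, f x ≠ 0) (hg0 : ∃ x ∈ U, g x ≠ 0)
    (hfg : ∀ c : ℚ_[p], ∃ x ∈ U, f x ≠ c * g x)
    (D : Set (Fin n → ℚ_[p])) (hD : D = {x ∈ U | f x * g x = 0})
    (W : Set (Fin n → ℚ_[p])) (hWU : W ⊆ U) (hWopen : IsOpen W)
    (hWcomp : IsCompact W) (hWne : W.Nonempty)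
    (B : Set ℝ)
    (hB : B = {σ : ℝ | IntegrableOn (fun x => ‖f x / g x‖ ^ σ) (W \ D) μ}) :
    -- B is an open interval of ℝ containing 0
    (0 : ℝ) ∈ B ∧ IsOpen B ∧ B.OrdConnected ∧
    -- divergence at the finite left endpoint β = inf B, and blow-up as σ ↓ β
    (BddBelow B →
      (∫⁻ x in W \ D, ENNReal.ofReal (‖f x / g x‖ ^ (sInf B)) ∂μ = ⊤) ∧
      Filter.Tendsto
        (fun σ : ℝ => ∫⁻ x in W \ D, ENNReal.ofReal (‖f x / g x‖ ^ σ) ∂μ)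
        (nhdsWithin (sInf B) (Set.Ioi (sInf B))) (nhds ⊤)) ∧
    -- divergence at the finite right endpoint α = sup B, and blow-up as σ ↑ α
    (BddAbove B →
      (∫⁻ x in W \ D, ENNReal.ofReal (‖f x / g x‖ ^ (sSup B)) ∂μ = ⊤) ∧
      Filter.Tendsto
        (fun σ : ℝ => ∫⁻ x in W \ D, ENNReal.ofReal (‖f x / g x‖ ^ σ) ∂μ)
        (nhdsWithin (sSup B) (Set.Iio (sSup B))) (nhds ⊤)) := by
  have hne : ∀ x ∈ W \ D, f x ≠ 0 ∧ g x ≠ 0 := by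
    intro x hx
    rw [← mul_ne_zero_iff]
    intro h0
    exact hx.2 (hD ▸ ⟨hWU hx.1, h0⟩)
  have hfW : ContinuousOn f W := hf.continuousOn.mono hWU
  have hgW : ContinuousOn g W := hg.continuousOn.mono hWU
  have hWD : W \ D = W ∩ (fun x => f x * g x) ⁻¹' {0}ᶜ := by
    ext x
    simp only [hD, Set.mem_sdiff, mem_inter_iff, mem_preimage, mem_compl_iff, mem_singleton_iff,
      mem_ofPred_eq]
    exact ⟨fun h => ⟨h.1, fun h0 => h.2 ⟨hWU h.1, h0⟩⟩, fun h => ⟨h.1, fun h0 => h.2 h0.2⟩⟩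
  have hWDm : MeasurableSet (W \ D) :=
    (hWD ▸ (hfW.mul hgW).isOpen_inter_preimage hWopen isOpen_compl_singleton).measurableSet
  have hm : AEMeasurable (fun x => ‖f x / g x‖) (μ.restrict (W \ D)) :=
    (((hfW.mono sdiff_subset).div (hgW.mono sdiff_subset)
      fun x hx => (hne x hx).2).norm).aemeasurable hWDm
  have hpos : ∀ᵐ x ∂μ.restrict (W \ D), 0 < ‖f x / g x‖ :=
    (ae_restrict_iff' hWDm).2 <| Eventually.of_forall fun x hx =>
      norm_pos_iff.2 (div_ne_zero (hne x hx).1 (hne x hx).2)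
  have h_int : ∀ σ : ℝ, σ ∈ B ↔ ∫⁻ x in W \ D, ENNReal.ofReal (‖f x / g x‖ ^ σ) ∂μ ≠ ⊤ := by
    intro σ
    rw [hB]
    exact (lintegral_ofReal_ne_top_iff_integrable (hm.pow_const σ).aestronglyMeasurable
      (Eventually.of_forall fun x => by positivity)).symm
  have hratio : ∀ σ : ℝ, ∫⁻ x in W \ D, ENNReal.ofReal (‖f x / g x‖ ^ σ) ∂μ
      = ∫⁻ x in W, ratioPow f g σ x ∂μ := by
    intro σ
    rw [← lintegral_indicator hWDm, ← lintegral_indicator hWopen.measurableSet]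
    congr 1
    ext x
    by_cases hx : x ∈ W
    · by_cases h0 : f x * g x = 0
      · rw [indicator_of_notMem (fun h => mul_ne_zero (hne x h).1 (hne x h).2 h0),
          indicator_of_mem hx, ratioPow, if_pos h0]
      · rw [indicator_of_mem (hWD ▸ ⟨hx, h0⟩ : x ∈ W \ D), indicator_of_mem hx, ratioPow, if_neg h0]
    · rw [indicator_of_notMem (fun h => hx h.1), indicator_of_notMem hx]
  have hopen : IsOpen B := by
    have := isOpen_setOf_lintegral_ratioPow_lt_top μ hWopen hWcomp (hf.mono hWU) (hg.mono hWU)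
    convert this using 1
    ext σ
    rw [h_int, hratio, mem_ofPred_eq, lt_top_iff_ne_top]
  have htop : ∀ β ∉ B, ∫⁻ x in W \ D, ENNReal.ofReal (‖f x / g x‖ ^ β) ∂μ = ⊤ := fun β hβ =>
    not_not.1 fun h => hβ ((h_int β).2 h)
  refine ⟨?_, hopen, ?_, fun hb => ?_, fun hb => ?_⟩
  · rw [h_int]
    simpa using ((measure_mono sdiff_subset).trans_lt hWcomp.measure_lt_top).ne
  · rw [hB]
    exact integrable_rpow_ordConnected hm hpos
  · have h := htop _ (hopen.csInf_notMem hb)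
    exact ⟨h, (tendsto_lintegral_rpow_of_eq_top hm hpos h).mono_left nhdsWithin_le_nhds⟩
  · have h := htop _ (hopen.csSup_notMem hb)
    exact ⟨h, (tendsto_lintegral_rpow_of_eq_top hm hpos h).mono_left nhdsWithin_le_nhds⟩
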